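/- arXiv:1112.2353 — 7 statements merged into one kernel-verified Lean document; each statement's English description precedes it below -/
import Mathlib

section
/- Let R be a commutative Noetherian ring, M an R-module, and x_1, …, x_n a sequence of exact zero-divisors on M. Then the submodule (0 :_M (x_1, …, x_n)) is isomorphic as an R-module to M/(x_1, …, x_n)M. In particular, if x_1, …, x_n is a sequence of exact zero-divisors on R (viewed as a module over itself), then the ideal (0 :_R (x_1, …, x_n)) is principal. -/
/-- `(x, y)` is a pair of exact zero-divisors on the `R`-module `M`:
`M ≠ xM`, `x ∉ (0 :_R M)`, `(0 :_M x) = yM` and `(0 :_M y) = xM`. -/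
def IsEZDPair (R : Type*) [CommRing R] (M : Type*) [AddCommGroup M] [Module R M]
    (x y : R) : Prop :=
  Ideal.span {x} • (⊤ : Submodule R M) ≠ ⊤ ∧
  (∃ m : M, x • m ≠ 0) ∧
  Submodule.torsionBy R M x = Ideal.span {y} • (⊤ : Submodule R M) ∧
  Submodule.torsionBy R M y = Ideal.span {x} • (⊤ : Submodule R M)

/-- `x 0, …, x (n-1)` is a sequence of exact zero-divisors on `M` with twins
`y 0, …, y (n-1)`: each `(x i, y i)` is a pair of exact zero-divisors on
`M ⧸ (x 0, …, x (i-1))M`. -/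
def IsEZDSeqWithTwins (R : Type*) [CommRing R] (M : Type*) [AddCommGroup M] [Module R M]
    {n : ℕ} (x y : Fin n → R) : Prop :=
  ∀ i : Fin n,
    IsEZDPair R (M ⧸ (Ideal.span (x '' {j | j < i}) • (⊤ : Submodule R M))) (x i) (y i)

/-- `x 0, …, x (n-1)` is a sequence of exact zero-divisors on `M`. -/
def IsEZDSeq (R : Type*) [CommRing R] (M : Type*) [AddCommGroup M] [Module R M]
    {n : ℕ} (x : Fin n → R) : Prop :=
  ∀ i : Fin n, ∃ y : R,
    IsEZDPair R (M ⧸ (Ideal.span (x '' {j | j < i}) • (⊤ : Submodule R M))) (x i) y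

universe u

namespace IsEZDPair

variable {R M : Type*} [CommRing R] [AddCommGroup M] [Module R M] {x y : R}

theorem smul_eq_zero_iff (h : IsEZDPair R M x y) (m : M) :
    x • m = 0 ↔ ∃ m' : M, y • m' = m := by
  rw [← Submodule.mem_torsionBy_iff, h.2.2.1, Submodule.ideal_span_singleton_smul,
    Submodule.mem_smul_pointwise_iff_exists]
  simp

theorem twin_smul_eq_zero_iff (h : IsEZDPair R M x y) (m : M) :
    y • m = 0 ↔ ∃ m' : M, x • m' = m := by
  rw [← Submodule.mem_torsionBy_iff, h.2.2.2, Submodule.ideal_span_singleton_smul,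
    Submodule.mem_smul_pointwise_iff_exists]
  simp

end IsEZDPair

/-- The elements of `M` annihilated by a sequence of exact zero-divisors are the multiples of a
single scalar `a` (a product of twins), whose annihilator in `M` is `(x 0, …, x (n-1))M`. -/
theorem IsEZDSeq.exists_torsionBySet_eq_range {R M : Type*} [CommRing R] [AddCommGroup M]
    [Module R M] {n : ℕ} {x : Fin n → R} (hx : IsEZDSeq R M x) :
    ∃ a : R, Submodule.torsionBySet R M (Set.range x) = LinearMap.range (LinearMap.lsmul R M a) ∧
      LinearMap.ker (LinearMap.lsmul R M a) =
        Ideal.span (Set.range x) • (⊤ : Submodule R M) := by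
  induction n with
  | zero =>
    refine ⟨1, ?_, ?_⟩ <;> ext m <;> simp
  | succ n ih =>
    have himage (i : Fin n) :
        (x ∘ Fin.castSucc) '' {j | j < i} = x '' {j | j < i.castSucc} := by
      rw [Set.image_comp]
      congr 1
      ext j
      constructor
      · rintro ⟨k, hk, rfl⟩
        exact hk
      · intro hj
        have hjn : j.val < n := lt_trans (show j.val < i.val from hj) i.isLt
        exact ⟨⟨j, hjn⟩, hj, rfl⟩
    have hlast : x '' {j | j < Fin.last n} = Set.range (x ∘ Fin.castSucc) := by
      rw [Set.range_comp, Fin.range_castSucc]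
      congr 1
    have hinit : IsEZDSeq R M (x ∘ Fin.castSucc) := fun i ↦ by
      rw [himage]
      exact hx i.castSucc
    have hrange : Set.range x = insert (x (Fin.last n)) (Set.range (x ∘ Fin.castSucc)) := by
      ext r
      simp [Fin.exists_fin_succ', eq_comm, or_comm]
    obtain ⟨a, htors, hker⟩ := ih hinit
    obtain ⟨y, hy⟩ := hx (Fin.last n)
    rw [hlast, ← hker] at hy
    have hmk (m m' : M) : (Submodule.Quotient.mk m : M ⧸ LinearMap.ker (LinearMap.lsmul R M a)) =
        Submodule.Quotient.mk m' ↔ a • m = a • m' := by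
      rw [Submodule.Quotient.eq, LinearMap.mem_ker, LinearMap.lsmul_apply, smul_sub, sub_eq_zero]
    have hzero (r s : R) (m : M)
        (h : r • (Submodule.Quotient.mk m : M ⧸ LinearMap.ker (LinearMap.lsmul R M a)) = 0 ↔
          ∃ q : M ⧸ LinearMap.ker (LinearMap.lsmul R M a), s • q = Submodule.Quotient.mk m) :
        a • r • m = 0 ↔ ∃ m' : M, a • s • m' = a • m := by
      rw [(Submodule.Quotient.mk_surjective _).exists] at h
      simp only [← Submodule.Quotient.mk_smul, ← Submodule.Quotient.mk_zero, hmk] at h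
      simpa using h
    refine ⟨a * y, ?_, ?_⟩
    · ext m
      have hmem : m ∈ Submodule.torsionBySet R M (Set.range x) ↔
          x (Fin.last n) • m = 0 ∧ m ∈ LinearMap.range (LinearMap.lsmul R M a) := by
        rw [← htors, hrange]
        simp [Submodule.mem_torsionBySet_iff]
      rw [hmem]
      constructor
      · rintro ⟨hm, m, rfl⟩
        rw [LinearMap.lsmul_apply, smul_comm, hzero _ _ _ (hy.smul_eq_zero_iff _)] at hm
        obtain ⟨m', hm'⟩ := hm
        exact ⟨m', by simpa [mul_smul] using hm'⟩
      · rintro ⟨m, rfl⟩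
        refine ⟨?_, y • m, by simp only [LinearMap.lsmul_apply, mul_smul]⟩
        rw [LinearMap.lsmul_apply, mul_smul, smul_comm,
          hzero _ _ _ (hy.smul_eq_zero_iff _)]
        exact ⟨m, rfl⟩
    · ext m
      rw [hrange, Ideal.span_insert, Submodule.sup_smul, ← hker,
        Submodule.ideal_span_singleton_smul, LinearMap.mem_ker, LinearMap.lsmul_apply, mul_smul,
        hzero _ _ _ (hy.twin_smul_eq_zero_iff _), Submodule.mem_sup]
      constructor
      · rintro ⟨m', hm'⟩
        refine ⟨x (Fin.last n) • m', Submodule.smul_mem_pointwise_smul _ _ _ trivial,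
          m - x (Fin.last n) • m', ?_, by abel⟩
        simp [smul_sub, hm']
      · rintro ⟨_, hu, v, hv, rfl⟩
        obtain ⟨m', -, rfl⟩ := (Submodule.mem_smul_pointwise_iff_exists _ _ _).1 hu
        rw [LinearMap.mem_ker, LinearMap.lsmul_apply] at hv
        exact ⟨m', by rw [smul_add, hv, add_zero]⟩

/-- `(0 :_M (x 0, …, x (n-1)))` is isomorphic to `M/(x 0, …, x (n-1))M`; in particular,
for a sequence of exact zero-divisors on `R` itself, `(0 :_R (x 0, …, x (n-1)))`
is a principal ideal. -/
theorem torsion_iso_quotient_of_isEZDSeq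
    (R : Type u) [CommRing R] [IsNoetherianRing R]
    (M : Type u) [AddCommGroup M] [Module R M] {n : ℕ} (x : Fin n → R)
    (hx : IsEZDSeq R M x) :
    Nonempty ((Submodule.torsionBySet R M (Set.range x)) ≃ₗ[R]
      (M ⧸ (Ideal.span (Set.range x) • (⊤ : Submodule R M)))) ∧
    (IsEZDSeq R R x →
      ∃ a : R, Submodule.torsionBySet R R (Set.range x) = Ideal.span {a}) := by
  constructor
  · obtain ⟨a, htors, hker⟩ := hx.exists_torsionBySet_eq_range
    rw [htors, ← hker]
    exact ⟨(LinearMap.quotKerEquivRange _).symm⟩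
  · intro h
    obtain ⟨a, htors, -⟩ := h.exists_torsionBySet_eq_range
    refine ⟨a, htors.trans ?_⟩
    ext r
    simp [Ideal.mem_span_singleton', mul_comm]
end

section
/- Let (R, m, k) be a commutative Noetherian local ring, M a finitely generated R-module, and (x, y) a pair of exact zero-divisors on M. Then depth_R M = depth_R (M/xM) = depth_R (M/yM). -/
/-- The depth of an `R`-module `M` over a Noetherian local ring `(R, 𝔪)`:
the supremum (in `ℕ∞`) of the lengths of `M`-regular sequences contained in `𝔪`. -/
noncomputable def moduleDepth (R : Type*) [CommRing R] [IsLocalRing R]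
    (M : Type*) [AddCommGroup M] [Module R M] : ℕ∞ :=
  sSup {d : ℕ∞ | ∃ rs : List R, (∀ r ∈ rs, r ∈ IsLocalRing.maximalIdeal R) ∧
    RingTheory.Sequence.IsRegular M rs ∧ (rs.length : ℕ∞) = d}

universe u

open IsLocalRing RingTheory.Sequence CategoryTheory Abelian Pointwise

/-- The local ring `R` has an `M`-regular sequence of length `n` in its maximal ideal. -/
def HasRegularSequence (R : Type*) [CommRing R] [IsLocalRing R]
    (M : Type*) [AddCommGroup M] [Module R M] (n : ℕ) : Prop :=
  ∃ rs : List R, rs.length = n ∧ (∀ r ∈ rs, r ∈ maximalIdeal R) ∧ IsRegular M rs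

/-- The elements of `M` killed by `x` are the multiples of `y`. -/
def AnnihilatorEqImage {R : Type*} [CommRing R] (M : Type*) [AddCommGroup M] [Module R M]
    (x y : R) : Prop :=
  ∀ m : M, x • m = 0 ↔ ∃ z : M, y • z = m

lemma moduleDepth_eq_sSup_image (R : Type*) [CommRing R] [IsLocalRing R]
    (M : Type*) [AddCommGroup M] [Module R M] :
    moduleDepth R M = sSup ((fun n : ℕ ↦ (n : ℕ∞)) '' {n | HasRegularSequence R M n}) := by
  rw [moduleDepth]
  congr 1
  ext d
  constructor
  · rintro ⟨rs, hm, hr, rfl⟩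
    exact ⟨_, ⟨rs, rfl, hm, hr⟩, rfl⟩
  · rintro ⟨_, ⟨rs, rfl, hm, hr⟩, rfl⟩
    exact ⟨rs, hm, hr, rfl⟩

lemma moduleDepth_congr {R : Type*} [CommRing R] [IsLocalRing R]
    {M N : Type*} [AddCommGroup M] [Module R M] [AddCommGroup N] [Module R N]
    (h : ∀ n, HasRegularSequence R M n ↔ HasRegularSequence R N n) :
    moduleDepth R M = moduleDepth R N := by
  simp_rw [moduleDepth_eq_sSup_image, h]

section

variable {R : Type u} [CommRing R] [IsLocalRing R]

lemma hasRegularSequence_zero (M : Type*) [AddCommGroup M] [Module R M] [Nontrivial M] :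
    HasRegularSequence R M 0 :=
  ⟨[], rfl, by simp, IsRegular.nil R M⟩

lemma LinearEquiv.hasRegularSequence_congr {M N : Type*} [AddCommGroup M] [Module R M]
    [AddCommGroup N] [Module R N] (e : M ≃ₗ[R] N) (n : ℕ) :
    HasRegularSequence R M n ↔ HasRegularSequence R N n := by
  simp only [HasRegularSequence, e.isRegular_congr]

lemma hasRegularSequence_succ {M : Type*} [AddCommGroup M] [Module R M] {n : ℕ} :
    HasRegularSequence R M (n + 1) ↔ ∃ r ∈ maximalIdeal R, IsSMulRegular M r ∧
      HasRegularSequence R (QuotSMulTop r M) n := by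
  constructor
  · rintro ⟨_ | ⟨r, rs⟩, hl, hm, hr⟩
    · simp at hl
    · rw [isRegular_cons_iff] at hr
      exact ⟨r, hm r (by simp), hr.1, rs, by simpa using hl,
        fun a ha ↦ hm a (by simp [ha]), hr.2⟩
  · rintro ⟨r, hrm, hr, rs, hl, hm, hrs⟩
    exact ⟨r :: rs, by simpa using hl, by simpa using ⟨hrm, hm⟩, hrs.cons hr⟩

variable [IsNoetherianRing R]

/-- Dividing by a regular element of the maximal ideal lowers the lengths of regular sequences
by at most one, whether or not the element starts the given sequence. -/
lemma HasRegularSequence.quotSMulTop {M : Type u} [AddCommGroup M] [Module R M]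
    [Module.Finite R M] {n : ℕ} (h : HasRegularSequence R M (n + 1)) {r : R}
    (hrm : r ∈ maximalIdeal R) (hr : IsSMulRegular M r) :
    HasRegularSequence R (QuotSMulTop r M) n := by
  have smul_lt (L : Type u) [AddCommGroup L] [Module R L] [Module.Finite R L] [Nontrivial L] :
      maximalIdeal R • (⊤ : Submodule R L) < ⊤ :=
    (Submodule.top_ne_ideal_smul_of_le_jacobson_annihilator
      (maximalIdeal_le_jacobson _)).symm.lt_top
  have : Nontrivial M := h.choose_spec.2.2.nontrivial
  have := nontrivial_quotSMulTop_of_mem_maximalIdeal M hrm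
  have h₁ := ((ModuleCat.exists_isRegular_tfae (maximalIdeal R) (n + 1) (ModuleCat.of R M)
    (smul_lt M)).out 3 1).mp h
  refine ((ModuleCat.exists_isRegular_tfae (maximalIdeal R) n
    (ModuleCat.of R (QuotSMulTop r M)) (smul_lt _)).out 1 3).mp fun i hi ↦ ?_
  have zero₁ := AddCommGrpCat.isZero_of_iff_subsingleton.mpr (h₁ i (by omega))
  have zero₂ := AddCommGrpCat.isZero_of_iff_subsingleton.mpr (h₁ (i + 1) (by omega))
  have hr' : IsSMulRegular (ModuleCat.of R M) r := hr
  exact AddCommGrpCat.subsingleton_of_isZero <| ShortComplex.Exact.isZero_of_both_zeros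
    ((Ext.covariant_sequence_exact₃' _ hr'.smulShortComplex_shortExact) i (i + 1) rfl)
    (zero₁.eq_zero_of_src _) (zero₂.eq_zero_of_tgt _)

lemma exists_isSMulRegular_mem_maximalIdeal_of_socle_eq_zero
    (M : Type*) [AddCommGroup M] [Module R M] [Module.Finite R M]
    (h : ∀ s : M, (∀ r ∈ maximalIdeal R, r • s = 0) → s = 0) :
    ∃ r ∈ maximalIdeal R, IsSMulRegular M r := by
  by_contra! hreg
  have hsub : (maximalIdeal R : Set R) ⊆ ⋃ p ∈ associatedPrimes R M, p := by
    rw [biUnion_associatedPrimes_eq_compl_regular]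
    exact hreg
  obtain ⟨p, hp, hle⟩ := (Ideal.subset_union_prime_finite (associatedPrimes.finite R M)
    (f := id) 0 0 fun _ hp _ _ ↦ hp.isPrime).mp hsub
  obtain ⟨hprime, s, rfl⟩ := isAssociatedPrime_iff.mp hp
  apply hprime.ne_top
  rw [h s fun r hr ↦ by simpa [Submodule.mem_colon_singleton] using hle hr]
  simp

end

namespace AnnihilatorEqImage

variable {R : Type*} [CommRing R] {M : Type*} [AddCommGroup M] [Module R M] {x y : R}

lemma smul_smul_eq_zero (h : AnnihilatorEqImage M x y) (m : M) : x • y • m = 0 :=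
  (h _).mpr ⟨m, rfl⟩

lemma isSMulRegular_quotient (h : AnnihilatorEqImage M y x) {r : R} (hr : IsSMulRegular M r) :
    IsSMulRegular (M ⧸ (Ideal.span {x} • (⊤ : Submodule R M))) r := by
  rw [isSMulRegular_quotient_iff_mem_of_smul_mem]
  simp only [Submodule.ideal_span_singleton_smul, Submodule.mem_smul_pointwise_iff_exists,
    Submodule.mem_top, true_and]
  intro m hm
  rw [← h] at hm ⊢
  rw [smul_comm] at hm
  exact hr.right_eq_zero_of_smul hm

lemma quotSMulTop (hx : AnnihilatorEqImage M x y) (hy : AnnihilatorEqImage M y x) {r : R}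
    (hr : IsSMulRegular M r) : AnnihilatorEqImage (QuotSMulTop r M) x y := by
  intro m
  obtain ⟨m, rfl⟩ := Submodule.Quotient.mk_surjective _ m
  constructor
  · intro hm
    rw [← Submodule.Quotient.mk_smul, Submodule.Quotient.mk_eq_zero,
      Submodule.mem_smul_pointwise_iff_exists] at hm
    obtain ⟨z, -, hz⟩ := hm
    obtain ⟨w, rfl⟩ : ∃ w, x • w = z := by
      rw [← hy]
      apply hr.right_eq_zero_of_smul
      rw [smul_comm, hz, hy.smul_smul_eq_zero]
    obtain ⟨v, hv⟩ := (hx (m - r • w)).mp (by rw [smul_sub, ← hz, smul_comm, sub_self])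
    refine ⟨Submodule.Quotient.mk v, ?_⟩
    rw [← Submodule.Quotient.mk_smul, hv, Submodule.Quotient.eq,
      Submodule.mem_smul_pointwise_iff_exists]
    exact ⟨-w, trivial, by rw [smul_neg]; abel⟩
  · rintro ⟨z, hz⟩
    obtain ⟨z, rfl⟩ := Submodule.Quotient.mk_surjective _ z
    rw [← hz, ← Submodule.Quotient.mk_smul, ← Submodule.Quotient.mk_smul,
      hx.smul_smul_eq_zero, Submodule.Quotient.mk_zero]

end AnnihilatorEqImage

section

variable {R : Type u} [CommRing R] [IsLocalRing R] [IsNoetherianRing R]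

/-- A nonzero socle element of `M` is of the form `y • t`, and then `t` is a nonzero socle element
of `M ⧸ xM`. -/
lemma exists_isSMulRegular_of_isSMulRegular_quotient {M : Type*} [AddCommGroup M] [Module R M]
    [Module.Finite R M] {x y : R} (hxm : x ∈ maximalIdeal R) (hx : AnnihilatorEqImage M x y)
    (hy : AnnihilatorEqImage M y x) {r : R} (hrm : r ∈ maximalIdeal R)
    (hr : IsSMulRegular (M ⧸ (Ideal.span {x} • (⊤ : Submodule R M))) r) :
    ∃ a ∈ maximalIdeal R, IsSMulRegular M a := by
  refine exists_isSMulRegular_mem_maximalIdeal_of_socle_eq_zero M fun s hs ↦ ?_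
  obtain ⟨t, rfl⟩ := (hx s).mp (hs x hxm)
  rw [isSMulRegular_quotient_iff_mem_of_smul_mem] at hr
  simp only [Submodule.ideal_span_singleton_smul, Submodule.mem_smul_pointwise_iff_exists,
    Submodule.mem_top, true_and, ← hy _] at hr
  exact hr t (by rw [smul_comm, hs r hrm])

lemma hasRegularSequence_quotient_iff (n : ℕ) (M : Type u) [AddCommGroup M] [Module R M]
    [Module.Finite R M] [Nontrivial M] {x y : R} (hxm : x ∈ maximalIdeal R)
    (hx : AnnihilatorEqImage M x y) (hy : AnnihilatorEqImage M y x) :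
    HasRegularSequence R M n ↔
      HasRegularSequence R (M ⧸ (Ideal.span {x} • (⊤ : Submodule R M))) n := by
  induction n generalizing M with
  | zero =>
    have : Nontrivial (M ⧸ (Ideal.span {x} • (⊤ : Submodule R M))) := by
      rw [Submodule.ideal_span_singleton_smul]
      exact nontrivial_quotSMulTop_of_mem_maximalIdeal M hxm
    exact iff_of_true (hasRegularSequence_zero _) (hasRegularSequence_zero _)
  | succ n ih =>
    have step {r : R} (hrm : r ∈ maximalIdeal R) (hr : IsSMulRegular M r) :
        HasRegularSequence R (QuotSMulTop r M) n ↔ HasRegularSequence R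
          (QuotSMulTop r (M ⧸ (Ideal.span {x} • (⊤ : Submodule R M)))) n := by
      have := nontrivial_quotSMulTop_of_mem_maximalIdeal M hrm
      have e := (Submodule.quotOfListConsSMulTopEquivQuotSMulTopInner M r [x]).symm.trans
        (Submodule.quotOfListConsSMulTopEquivQuotSMulTopOuter M r [x])
      rw [Ideal.ofList_singleton] at e
      rw [ih _ (hx.quotSMulTop hy hr) (hy.quotSMulTop hx hr), e.hasRegularSequence_congr]
    constructor
    · intro h
      obtain ⟨r, hrm, hr, h⟩ := hasRegularSequence_succ.mp h
      exact hasRegularSequence_succ.mpr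
        ⟨r, hrm, hy.isSMulRegular_quotient hr, (step hrm hr).mp h⟩
    · intro h
      obtain ⟨a, ham, ha, -⟩ := hasRegularSequence_succ.mp h
      obtain ⟨r, hrm, hr⟩ := exists_isSMulRegular_of_isSMulRegular_quotient hxm hx hy ham ha
      exact hasRegularSequence_succ.mpr
        ⟨r, hrm, hr, (step hrm hr).mpr (h.quotSMulTop hrm (hy.isSMulRegular_quotient hr))⟩

end


/-- If `(x, y)` is a pair of exact zero-divisors on a finitely generated module `M`
over a Noetherian local ring, then `depth M = depth M/xM = depth M/yM`. -/
theorem depth_eq_of_isEZDPair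
    (R : Type u) [CommRing R] [IsNoetherianRing R] [IsLocalRing R]
    (M : Type u) [AddCommGroup M] [Module R M] [Module.Finite R M] (x y : R)
    (hxy : IsEZDPair R M x y) :
    moduleDepth R M = moduleDepth R (M ⧸ (Ideal.span {x} • (⊤ : Submodule R M))) ∧
    moduleDepth R M = moduleDepth R (M ⧸ (Ideal.span {y} • (⊤ : Submodule R M))) := by
  obtain ⟨hne, ⟨m₀, hm₀⟩, hx, hy⟩ := hxy
  have mem_span (a : R) (m : M) :
      m ∈ Ideal.span {a} • (⊤ : Submodule R M) ↔ ∃ z, a • z = m := by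
    simp [Submodule.ideal_span_singleton_smul, Submodule.mem_smul_pointwise_iff_exists]
  have hx' : AnnihilatorEqImage M x y := fun m ↦ by
    rw [← mem_span, ← hx, Submodule.mem_torsionBy_iff]
  have hy' : AnnihilatorEqImage M y x := fun m ↦ by
    rw [← mem_span, ← hy, Submodule.mem_torsionBy_iff]
  have : Nontrivial M := nontrivial_of_ne _ _ hm₀
  have hxm : x ∈ maximalIdeal R := by
    rw [mem_maximalIdeal, mem_nonunits_iff]
    intro hu
    apply hne
    rw [Ideal.span_singleton_eq_top.mpr hu, Submodule.top_smul]
  have hym : y ∈ maximalIdeal R := by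
    rw [mem_maximalIdeal, mem_nonunits_iff]
    rintro ⟨u, rfl⟩
    exact hm₀ ((hx' m₀).mpr ⟨u⁻¹ • m₀, smul_inv_smul u m₀⟩)
  exact ⟨moduleDepth_congr fun n ↦ hasRegularSequence_quotient_iff n M hxm hx' hy',
    moduleDepth_congr fun n ↦ hasRegularSequence_quotient_iff n M hym hy' hx'⟩
end

section
/- Let R be a commutative Noetherian local ring and M a finitely generated R-module with dim M = 1. Let x ∈ R be a parameter element of M and set y = ux for some u ∈ R. If the map M/xM → M/yM given by m + xM ↦ um + yM is injective, then y is also a parameter element of M. -/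
/-- The Krull dimension of the `R`-module `M`, i.e. the Krull dimension
of the ring `R/ann_R(M)`. -/
noncomputable def moduleDim (R : Type*) [CommRing R]
    (M : Type*) [AddCommGroup M] [Module R M] : WithBot (WithTop ℕ) :=
  ringKrullDim (R ⧸ Module.annihilator R M)

universe u

/-- On a module of finite length, if `f ∘ g = 0` and `ker g ≤ range f`, then also
`ker f ≤ range g`. -/
theorem LinearMap.ker_le_range_of_isFiniteLength {R T : Type*} [Ring R] [AddCommGroup T]
    [Module R T] [IsArtinian R T] [IsNoetherian R T] (f g : T →ₗ[R] T)
    (hfg : ∀ t, f (g t) = 0) (hgf : ker g ≤ range f) : ker f ≤ range g := by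
  have hle : range g ≤ ker f := by
    rintro _ ⟨t, rfl⟩
    exact hfg t
  have add_length (k : T →ₗ[R] T) :
      Module.length R T = Module.length R (ker k) + Module.length R (range k) :=
    Module.length_eq_add_of_exact (ker k).subtype k.rangeRestrict
      (Submodule.subtype_injective _) k.surjective_rangeRestrict
      (LinearMap.exact_iff.mpr (by rw [ker_rangeRestrict, Submodule.range_subtype]))
  have hker : Module.length R (ker g) ≤ Module.length R (range f) :=
    Module.length_le_of_injective (Submodule.inclusion hgf) (Submodule.inclusion_injective hgf)
  by_contra hnot
  have hlt : Module.length R (range g) < Module.length R (ker f) := by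
    simpa only [Module.length_submodule] using
      Submodule.height_strictMono (lt_of_le_not_ge hle hnot)
  have hsum := (add_length f).symm.trans (add_length g)
  rw [add_comm] at hsum
  exact (ENat.add_lt_add_of_le_of_lt Module.length_ne_top hker hlt).ne' hsum

/-- Let `N` be a finitely generated module over a Noetherian local ring such that the
`x ^ n`-torsion is Artinian for every `n`. If `g` is an endomorphism of `N` with `x • g = 0`
and `ker g ≤ x N`, then `N` is killed by a power of `x`. -/
theorem exists_pow_smul_eq_zero_of_ker_le {R N : Type*} [CommRing R] [IsNoetherianRing R]
    [IsLocalRing R] [AddCommGroup N] [Module R N] [Module.Finite R N] {x : R}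
    (hx : x ∈ IsLocalRing.maximalIdeal R)
    (hart : ∀ n : ℕ, IsArtinian R (Submodule.torsionBy R N (x ^ n))) (g : N →ₗ[R] N)
    (hxg : ∀ z, x • g z = 0) (hker : ∀ z, g z = 0 → ∃ v, z = x • v) :
    ∃ n : ℕ, ∀ z : N, x ^ n • z = 0 := by
  obtain ⟨n, hn⟩ := monotone_stabilizes_iff_noetherian.mpr (inferInstance : IsNoetherian R N)
    ⟨fun n ↦ Submodule.torsionBy R N (x ^ n), fun a b hab ↦
      Submodule.torsionBy_le_torsionBy_of_dvd _ _ (pow_dvd_pow x hab)⟩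
  have hstab (z : N) (hz : x ^ (n + 1) • z = 0) : x ^ n • z = 0 := by
    have heq : Submodule.torsionBy R N (x ^ n) = Submodule.torsionBy R N (x ^ (n + 1)) :=
      hn (n + 1) n.le_succ
    exact heq.ge hz
  set T := Submodule.torsionBy R N (x ^ n)
  have := hart n
  have hgT : ∀ t ∈ T, g t ∈ T := fun t (ht : x ^ n • t = 0) ↦ by
    change x ^ n • g t = 0
    rw [← map_smul, ht, map_zero]
  have key := LinearMap.ker_le_range_of_isFiniteLength (LinearMap.lsmul R T x) (g.restrict hgT)
    (fun t ↦ Subtype.ext (hxg t)) (fun t ht ↦ by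
      obtain ⟨v, hv⟩ := hker t (congrArg Subtype.val ht)
      have hvT : v ∈ T := hstab v (by rw [pow_succ, mul_smul, ← hv]; exact t.2)
      exact ⟨⟨v, hvT⟩, Subtype.ext hv.symm⟩)
  refine ⟨n, fun z ↦ ?_⟩
  suffices (⊤ : Submodule R N) ≤ T from this Submodule.mem_top
  refine Submodule.le_of_le_smul_of_le_jacobson_bot (I := Ideal.span {x}) Module.Finite.fg_top
    (((Ideal.span_singleton_le_iff_mem _).mpr hx).trans
      (IsLocalRing.maximalIdeal_le_jacobson _)) fun w _ ↦ ?_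
  have hgw : g w ∈ T := hstab _ (by rw [pow_succ, mul_smul, hxg, smul_zero])
  obtain ⟨t, ht⟩ := key (show (⟨g w, hgw⟩ : T) ∈ _ from Subtype.ext (hxg w))
  obtain ⟨v, hv⟩ := hker (w - t) (by
    rw [map_sub, sub_eq_zero]
    exact (congrArg Subtype.val ht).symm)
  rw [← add_sub_cancel (t : N) w, hv]
  exact Submodule.add_mem_sup t.2
    (Submodule.smul_mem_smul (Ideal.mem_span_singleton_self x) Submodule.mem_top)

/-- A finitely generated module over a Noetherian ring is Artinian if every prime ideal
containing its annihilator is maximal. -/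
theorem isArtinian_of_forall_isPrime_isMaximal {R P : Type*} [CommRing R] [IsNoetherianRing R]
    [AddCommGroup P] [Module R P] [Module.Finite R P]
    (h : ∀ q : Ideal R, q.IsPrime → Module.annihilator R P ≤ q → q.IsMaximal) :
    IsArtinian R P := by
  let I := Module.annihilator R P
  let _ : Module (R ⧸ I) P := (Module.isTorsionBySet_annihilator R P).module
  have : IsScalarTower R (R ⧸ I) P := (Module.isTorsionBySet_annihilator R P).isScalarTower
  have : Ring.KrullDimLE 0 (R ⧸ I) :=
    Ideal.krullDimLE_zero_quotient_iff_forall_minimalPrimes_isMaximal.mpr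
      fun J hJ ↦ h J hJ.1.1 hJ.1.2
  have : IsArtinianRing (R ⧸ I) := IsNoetherianRing.isArtinianRing_of_krullDimLE_zero
  have : Module.Finite (R ⧸ I) P := Module.Finite.of_restrictScalars_finite R _ _
  have : IsArtinian (R ⧸ I) P := isArtinian_of_fg_of_artinian'
  exact isArtinian_of_surjective_algebraMap (R := R ⧸ I) Ideal.Quotient.mk_surjective

/-- If `R ⧸ I` has Krull dimension at most one, a non-maximal prime containing `I` is minimal
over `I`. -/
theorem Ideal.IsPrime.mem_minimalPrimes_of_krullDimLE_one_quotient {R : Type*} [CommRing R]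
    {I J : Ideal R} [Ring.KrullDimLE 1 (R ⧸ I)] (hJ : J.IsPrime) (hIJ : I ≤ J)
    (hmax : ¬ J.IsMaximal) : J ∈ I.minimalPrimes := by
  have hsurj : Function.Surjective (Ideal.Quotient.mk I) := Ideal.Quotient.mk_surjective
  have hcomap : (J.map (Ideal.Quotient.mk I)).comap (Ideal.Quotient.mk I) = J := by
    rw [Ideal.comap_map_of_surjective' _ hsurj, Ideal.mk_ker, sup_eq_left.mpr hIJ]
  have hprime : (J.map (Ideal.Quotient.mk I)).IsPrime :=
    Ideal.map_isPrime_of_surjective hsurj (by rwa [Ideal.mk_ker])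
  rcases Ring.krullDimLE_one_iff.mp ‹_› _ hprime with h | h
  · rw [Ideal.minimalPrimes_eq_comap]
    exact ⟨_, h, hcomap⟩
  · exact (hmax (hcomap ▸ Ideal.comap_isMaximal_of_surjective _ hsurj)).elim

/-- If `M` is a finitely generated module of dimension `1` over a Noetherian local
ring, `x` is a parameter element of `M` (i.e. `dim M/xM = 0`), `y = u * x`, and the
map `M/xM → M/yM`, `m + xM ↦ u•m + yM`, is injective, then `y` is a parameter
element of `M`. -/
theorem parameter_of_injective_mul
    (R : Type u) [CommRing R] [IsNoetherianRing R] [IsLocalRing R]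
    (M : Type u) [AddCommGroup M] [Module R M] [Module.Finite R M]
    (hdim : moduleDim R M = 1) (x u y : R) (hy : y = u * x)
    (hx : moduleDim R (M ⧸ (Ideal.span {x} • (⊤ : Submodule R M))) = 0)
    (hinj : ∀ m : M, u • m ∈ Ideal.span {y} • (⊤ : Submodule R M) →
      m ∈ Ideal.span {x} • (⊤ : Submodule R M)) :
    moduleDim R (M ⧸ (Ideal.span {y} • (⊤ : Submodule R M))) = 0 := by
  have hQx := hx
  rw [moduleDim, ← Module.supportDim_eq_ringKrullDim_quotient_annihilator] at hQx
  have hprime (q : Ideal R) (hq : q.IsPrime) (hann : Module.annihilator R M ≤ q) (hxq : x ∈ q) :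
      q.IsMaximal := by
    have hmem : (⟨q, hq⟩ : PrimeSpectrum R) ∈
        Module.support R (M ⧸ (Ideal.span {x} • (⊤ : Submodule R M))) := by
      rw [Module.support_quotient, Module.support_eq_zeroLocus]
      exact ⟨hann, (Ideal.span_singleton_le_iff_mem q).mpr hxq⟩
    rw [support_of_supportDim_eq_zero R _ hQx] at hmem
    exact (IsLocalRing.maximalIdeal.isMaximal R).eq_of_le hq.ne_top hmem ▸
      IsLocalRing.maximalIdeal.isMaximal R
  have hnt : Nontrivial (M ⧸ (Ideal.span {x} • (⊤ : Submodule R M))) := by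
    rw [← Module.supportDim_ne_bot_iff_nontrivial R, hQx]
    exact WithBot.coe_ne_bot
  have hxm : x ∈ IsLocalRing.maximalIdeal R := by
    by_contra hunit
    rw [IsLocalRing.mem_maximalIdeal, mem_nonunits_iff, not_not] at hunit
    rw [Submodule.Quotient.nontrivial_iff, Ideal.span_singleton_eq_top.mpr hunit,
      Submodule.top_smul] at hnt
    exact hnt rfl
  have hMnt : Nontrivial M := (Submodule.mkQ_surjective (Ideal.span {x} • (⊤ : Submodule R M))).nontrivial
  have hym : y ∈ IsLocalRing.maximalIdeal R := hy ▸ Ideal.mul_mem_left _ u hxm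
  have hynt : Nontrivial (M ⧸ (Ideal.span {y} • (⊤ : Submodule R M))) := by
    rw [Submodule.Quotient.nontrivial_iff, ne_comm]
    exact Submodule.top_ne_ideal_smul_of_le_jacobson_annihilator
      (((Ideal.span_singleton_le_iff_mem _).mpr hym).trans
        (IsLocalRing.maximalIdeal_le_jacobson _))
  -- the submodule killed by `y` is killed by a power of `x`
  let N := Submodule.torsionBy R M y
  obtain ⟨n, hn⟩ : ∃ n : ℕ, ∀ z : N, x ^ n • z = 0 := by
    refine exists_pow_smul_eq_zero_of_ker_le hxm (fun n ↦ ?_) (LinearMap.lsmul R N u)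
      (fun z ↦ ?_) (fun z hz ↦ ?_)
    · refine isArtinian_of_forall_isPrime_isMaximal fun q hq hle ↦ hprime q hq ?_ ?_
      · refine le_trans (fun r hr ↦ Module.mem_annihilator.mpr fun t ↦ ?_) hle
        exact Subtype.ext (Subtype.ext (Module.mem_annihilator.mp hr _))
      · exact hq.mem_of_pow_mem n (hle (Module.mem_annihilator.mpr fun t ↦ Subtype.ext t.2))
    · have hz : y • (z : M) = 0 := z.2
      rw [hy, mul_comm, mul_smul] at hz
      exact Subtype.ext hz
    · have hz0 : u • (z : M) = 0 := congrArg Subtype.val hz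
      have hzx := hinj z (hz0 ▸ zero_mem _)
      rw [Submodule.ideal_span_singleton_smul] at hzx
      obtain ⟨v, -, hv⟩ := hzx
      have hv' : x • v = z := hv
      have hvN : v ∈ N := by
        change y • v = 0
        rw [hy, mul_smul, hv', hz0]
      exact ⟨⟨v, hvN⟩, Subtype.ext hv'.symm⟩
  have hone : Ring.KrullDimLE 1 (R ⧸ Module.annihilator R M) := by
    rw [Ring.KrullDimLE, Order.krullDimLE_iff]
    exact hdim.le
  have : Nontrivial (R ⧸ Module.annihilator R (M ⧸ (Ideal.span {y} • (⊤ : Submodule R M)))) :=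
    Ideal.Quotient.nontrivial_iff.mpr (mt Module.annihilator_eq_top_iff.mp
      (not_subsingleton _))
  refine ringKrullDimZero_iff_ringKrullDim_eq_zero.mp ?_
  rw [Ideal.krullDimLE_zero_quotient_iff_forall_minimalPrimes_isMaximal]
  intro J hJ
  have hJp : J.IsPrime := hJ.1.1
  have hsupp : (⟨J, hJp⟩ : PrimeSpectrum R) ∈
      Module.support R (M ⧸ (Ideal.span {y} • (⊤ : Submodule R M))) := by
    rw [Module.support_eq_zeroLocus]
    exact hJ.1.2
  rw [Module.support_quotient, Module.support_eq_zeroLocus] at hsupp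
  have hann : Module.annihilator R M ≤ J := hsupp.1
  have hyJ : y ∈ J := hsupp.2 (Ideal.mem_span_singleton_self y)
  by_contra hmax
  have hass := Module.associatedPrimes.minimalPrimes_annihilator_subset_associatedPrimes R M
    (hJp.mem_minimalPrimes_of_krullDimLE_one_quotient hann hmax)
  obtain ⟨-, z, hz⟩ := isAssociatedPrime_iff.mp hass
  have hmem (r : R) : r ∈ J ↔ r • z = 0 := by
    rw [hz, Submodule.mem_colon_singleton, Submodule.mem_bot]
  have hxn : x ^ n • z = 0 := congrArg Subtype.val (hn ⟨z, (hmem y).mp hyJ⟩)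
  exact hmax (hprime J hJp hann (hJp.mem_of_pow_mem n ((hmem _).mpr hxn)))
end

section
/- Let (R, m, k) be a commutative Noetherian local ring, M a finitely generated R-module of dimension d, and (x, y) a pair of exact zero-divisors on M. Then dim_R M = dim_R (M/xM) = dim_R (M/yM). -/
universe u

theorem LinearMap.isArtinian_ker_pow {A N : Type*} [Ring A] [AddCommGroup N] [Module A N]
    (f : Module.End A N) [IsArtinian A (LinearMap.ker f)] (n : ℕ) :
    IsArtinian A (LinearMap.ker (f ^ n)) := by
  induction n with
  | zero =>
    rw [pow_zero, Module.End.one_eq_id, LinearMap.ker_id]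
    infer_instance
  | succ n ih =>
    have hle : LinearMap.ker f ≤ LinearMap.ker (f ^ (n + 1)) := by
      rw [pow_succ]
      exact LinearMap.ker_le_ker_comp f (f ^ n)
    have hmaps : ∀ z ∈ LinearMap.ker (f ^ (n + 1)), f z ∈ LinearMap.ker (f ^ n) := fun z hz ↦ by
      rwa [LinearMap.mem_ker, pow_succ] at hz
    refine isArtinian_of_range_eq_ker (Submodule.inclusion hle) (f.restrict hmaps) ?_
    rw [Submodule.range_inclusion]
    ext z
    simp [Subtype.ext_iff]

/-- If the cokernel of `f` is Artinian and isomorphic to its kernel, then the stable kernel of `f`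
and the range of `f` span the module. -/
theorem LinearMap.exists_ker_pow_sup_range_eq_top {A N : Type*} [Ring A] [AddCommGroup N]
    [Module A N] [IsNoetherian A N] (f : Module.End A N) [IsArtinian A (N ⧸ LinearMap.range f)]
    (e : (N ⧸ LinearMap.range f) ≃ₗ[A] LinearMap.ker f) :
    ∃ n, LinearMap.ker (f ^ n) ⊔ LinearMap.range f = ⊤ := by
  have : IsArtinian A (LinearMap.ker f) := isArtinian_of_linearEquiv e
  obtain ⟨n, hn⟩ := Filter.eventually_atTop.mp f.eventually_iSup_ker_pow_eq
  refine ⟨n, ?_⟩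
  have hstab : LinearMap.ker (f ^ (n + 1)) = LinearMap.ker (f ^ n) :=
    (hn (n + 1) n.le_succ).symm.trans (hn n le_rfl)
  have : IsArtinian A (LinearMap.ker (f ^ n)) := LinearMap.isArtinian_ker_pow f n
  have mem_iff (z : N) : f z ∈ LinearMap.ker (f ^ n) ↔ z ∈ LinearMap.ker (f ^ n) := by
    rw [LinearMap.mem_ker, ← Module.End.mul_apply, ← pow_succ, ← LinearMap.mem_ker, hstab]
  have hle : LinearMap.ker f ≤ LinearMap.ker (f ^ n) := by
    rw [← hstab, pow_succ]
    exact LinearMap.ker_le_ker_comp f (f ^ n)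
  let h : Module.End A (LinearMap.ker (f ^ n)) := f.restrict fun z hz ↦ (mem_iff z).2 hz
  have hker : Module.length A (LinearMap.ker (f ^ n)) =
      Module.length A (LinearMap.ker f) + Module.length A (LinearMap.range h) := by
    refine Module.length_eq_add_of_exact (Submodule.inclusion hle) h.rangeRestrict
      (Submodule.inclusion_injective hle) h.surjective_rangeRestrict ?_
    rw [LinearMap.exact_iff, LinearMap.ker_rangeRestrict, Submodule.range_inclusion]
    ext z
    simp [h, Subtype.ext_iff]
  have hcoker : Module.length A (LinearMap.ker (f ^ n)) =
      Module.length A (LinearMap.range h) +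
        Module.length A (LinearMap.ker (f ^ n) ⧸ LinearMap.range h) :=
    Module.length_eq_add_of_exact (LinearMap.range h).subtype (LinearMap.range h).mkQ
      (Submodule.subtype_injective _) (Submodule.mkQ_surjective _)
      (LinearMap.exact_subtype_mkQ _)
  have hlen : Module.length A (LinearMap.ker (f ^ n) ⧸ LinearMap.range h) =
      Module.length A (N ⧸ LinearMap.range f) := by
    rw [e.length_eq]
    rw [hker, add_comm] at hcoker
    exact (WithTop.add_left_cancel Module.length_ne_top hcoker).symm
  let φ : (LinearMap.ker (f ^ n) ⧸ LinearMap.range h) →ₗ[A] N ⧸ LinearMap.range f :=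
    Submodule.mapQ _ _ (LinearMap.ker (f ^ n)).subtype <| by
      rintro _ ⟨z, rfl⟩
      exact ⟨z, rfl⟩
  have hφ : Function.Injective φ := by
    rw [← LinearMap.ker_eq_bot, LinearMap.ker_eq_bot']
    intro z hz
    obtain ⟨z, rfl⟩ := Submodule.Quotient.mk_surjective _ z
    obtain ⟨w, hw⟩ := (Submodule.Quotient.mk_eq_zero _).1 hz
    refine (Submodule.Quotient.mk_eq_zero _).2 ⟨⟨w, (mem_iff w).1 ?_⟩, Subtype.ext hw⟩
    rw [hw]
    exact z.2
  have hrange : LinearMap.range φ = ⊤ := by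
    by_contra hne
    refine (Submodule.length_lt hne).ne ?_
    rw [← hlen, (LinearEquiv.ofInjective φ hφ).length_eq]
  refine eq_top_iff.2 fun z _ ↦ ?_
  obtain ⟨w, hw⟩ := LinearMap.range_eq_top.1 hrange (Submodule.Quotient.mk z)
  obtain ⟨w, rfl⟩ := Submodule.Quotient.mk_surjective _ w
  have := (Submodule.Quotient.eq _).1 hw.symm
  exact Submodule.mem_sup.2 ⟨w, w.2, z - w, this, by simp⟩

/-- A finite module over a Noetherian local ring is Artinian if it is annihilated by an ideal over
which the maximal ideal is a minimal prime. -/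
theorem IsLocalRing.isArtinian_of_maximalIdeal_mem_minimalPrimes {A N : Type*} [CommRing A]
    [IsLocalRing A] [IsNoetherianRing A] [AddCommGroup N] [Module A N] [Module.Finite A N]
    {I : Ideal A} (hI : IsLocalRing.maximalIdeal A ∈ I.minimalPrimes)
    (hN : I ≤ Module.annihilator A N) : IsArtinian A N := by
  have := IsLocalRing.quotient_artinian_of_mem_minimalPrimes_of_isLocalRing I hI
  have htors : Module.IsTorsionBySet A N I := fun z a ↦ Module.mem_annihilator.1 (hN a.2) z
  let := htors.module
  have : IsScalarTower A (A ⧸ I) N := Module.IsTorsionBySet.isScalarTower htors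
  have : Module.Finite (A ⧸ I) N := Module.Finite.of_restrictScalars_finite A (A ⧸ I) N
  have : IsArtinian (A ⧸ I) N := isArtinian_of_fg_of_artinian'
  exact isArtinian_of_surjective_algebraMap (R := A ⧸ I) Ideal.Quotient.mk_surjective

/-- If a prime `q` is minimal over `ann M + (x)`, where `(x, y)` is exact on `M`, then `x` lies in
every prime of the support of `M` contained in `q`. -/
theorem mem_of_mem_minimalPrimes_of_exact {R M : Type*} [CommRing R] [IsNoetherianRing R]
    [AddCommGroup M] [Module R M] [Module.Finite R M] {x y : R}
    (hxy : Function.Exact (LinearMap.lsmul R M y) (LinearMap.lsmul R M x))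
    (hyx : Function.Exact (LinearMap.lsmul R M x) (LinearMap.lsmul R M y))
    {p q : PrimeSpectrum R} (hp : p ∈ Module.support R M) (hpq : p ≤ q)
    (hq : q.asIdeal ∈ (Module.annihilator R M ⊔ Ideal.span {x}).minimalPrimes) :
    x ∈ p.asIdeal := by
  let S := q.asIdeal.primeCompl
  let A := Localization.AtPrime q.asIdeal
  let N := LocalizedModule S M
  have lsmul_eq (r : R) (z : N) : IsLocalizedModule.map S (LocalizedModule.mkLinearMap S M)
      (LocalizedModule.mkLinearMap S M) (LinearMap.lsmul R M r) z =
      LinearMap.lsmul A N (algebraMap R A r) z := by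
    induction z using LocalizedModule.induction_on with
    | h m s =>
      simp [IsLocalizedModule.map_LocalizedModules, LocalizedModule.smul'_mk, N, A, S]
  let f : Module.End A N := LinearMap.lsmul A N (algebraMap R A x)
  let g : Module.End A N := LinearMap.lsmul A N (algebraMap R A y)
  have hfg : LinearMap.ker f = LinearMap.range g := by
    rw [← LinearMap.exact_iff]
    intro z
    simpa only [lsmul_eq, Set.mem_range] using IsLocalizedModule.map_exact S
      (LocalizedModule.mkLinearMap S M) (LocalizedModule.mkLinearMap S M)
      (LocalizedModule.mkLinearMap S M) _ _ hxy z
  have hgf : LinearMap.ker g = LinearMap.range f := by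
    rw [← LinearMap.exact_iff]
    intro z
    simpa only [lsmul_eq, Set.mem_range] using IsLocalizedModule.map_exact S
      (LocalizedModule.mkLinearMap S M) (LocalizedModule.mkLinearMap S M)
      (LocalizedModule.mkLinearMap S M) _ _ hyx z
  have : IsArtinian A (N ⧸ LinearMap.range f) := by
    refine IsLocalRing.isArtinian_of_maximalIdeal_mem_minimalPrimes
      (I := (Module.annihilator R M ⊔ Ideal.span {x}).map (algebraMap R A)) ?_ ?_
    · rwa [IsLocalization.minimalPrimes_map S A, Set.mem_preimage,
        Localization.AtPrime.under_maximalIdeal]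
    · rw [Ideal.map_le_iff_le_comap, sup_le_iff, Ideal.span_singleton_le_iff_mem]
      constructor
      · intro a ha
        rw [Ideal.mem_comap, Module.mem_annihilator]
        intro z
        obtain ⟨z, rfl⟩ := Submodule.Quotient.mk_surjective _ z
        rw [← Submodule.Quotient.mk_smul]
        convert Submodule.Quotient.mk_zero (p := LinearMap.range f)
        induction z using LocalizedModule.induction_on with
        | h m s =>
          rw [algebraMap_smul, LocalizedModule.smul'_mk, Module.mem_annihilator.1 ha,
            LocalizedModule.zero_mk]
      · rw [Ideal.mem_comap, Module.mem_annihilator]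
        intro z
        obtain ⟨z, rfl⟩ := Submodule.Quotient.mk_surjective _ z
        exact (Submodule.Quotient.mk_eq_zero _).2 ⟨z, rfl⟩
  obtain ⟨n, hn⟩ := LinearMap.exists_ker_pow_sup_range_eq_top f
    ((Submodule.quotEquivOfEq _ _ hgf.symm).trans <| g.quotKerEquivRange.trans <|
      LinearEquiv.ofEq _ _ hfg.symm)
  have hxq : x ∈ q.asIdeal := hq.1.2 (Ideal.mem_sup_right (Ideal.mem_span_singleton_self x))
  have hker : ⊤ ≤ LinearMap.ker (f ^ n) := by
    refine Submodule.le_of_le_smul_of_le_jacobson_bot (I := Ideal.span {algebraMap R A x})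
      Module.Finite.fg_top ?_ ?_
    · rw [Ideal.span_singleton_le_iff_mem]
      refine IsLocalRing.maximalIdeal_le_jacobson _ ?_
      exact (IsLocalization.AtPrime.to_map_mem_maximal_iff A q.asIdeal x).2 hxq
    · refine hn.symm.le.trans (sup_le_sup_left ?_ _)
      rintro _ ⟨z, rfl⟩
      exact Submodule.smul_mem_smul (Ideal.mem_span_singleton_self _) Submodule.mem_top
  by_contra hxp
  obtain ⟨m, hm⟩ := Module.mem_support_iff'.1 hp
  have hzero : x ^ n • LocalizedModule.mkLinearMap S M m = 0 := by
    have hpow (k : ℕ) (z : N) : (f ^ k) z = x ^ k • z := by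
      induction k with
      | zero => simp
      | succ k ih =>
        rw [pow_succ', Module.End.mul_apply, ih, pow_succ', mul_smul]
        exact algebraMap_smul A x _
    rw [← hpow]
    exact hker Submodule.mem_top
  rw [← map_smul, IsLocalizedModule.eq_zero_iff S] at hzero
  obtain ⟨s, hs⟩ := hzero
  refine hm (s * x ^ n) ?_ (by rw [mul_smul]; exact hs)
  intro hmem
  exact (p.isPrime.mem_or_mem hmem).elim (fun h ↦ s.2 (hpq h))
    fun h ↦ hxp (p.isPrime.mem_of_pow_mem n h)

theorem LTSeries.length_le_supportDim {R M : Type*} [CommRing R] [AddCommGroup M] [Module R M]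
    (l : LTSeries (PrimeSpectrum R)) (hl : l.head ∈ Module.support R M) :
    (l.length : WithBot ℕ∞) ≤ Module.supportDim R M :=
  Order.LTSeries.length_le_krullDim (α := Module.support R M) <|
    LTSeries.mk l.length (fun i ↦ ⟨l i, Module.mem_support_mono (l.head_le i) hl⟩)
      fun _ _ h ↦ l.strictMono h

/-- Dividing by `x` does not lower the dimension of a module on which `(x, y)` is exact. -/
theorem Module.supportDim_eq_supportDim_quotient_of_exact {R M : Type*} [CommRing R]
    [IsNoetherianRing R] [IsLocalRing R] [AddCommGroup M] [Module R M] [Module.Finite R M] {x y : R}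
    (hxy : Function.Exact (LinearMap.lsmul R M y) (LinearMap.lsmul R M x))
    (hyx : Function.Exact (LinearMap.lsmul R M x) (LinearMap.lsmul R M y))
    (hx : Ideal.span {x} • (⊤ : Submodule R M) ≠ ⊤) :
    Module.supportDim R M =
      Module.supportDim R (M ⧸ (Ideal.span {x} • (⊤ : Submodule R M))) := by
  refine le_antisymm (iSup_le fun l ↦ ?_)
    (Module.supportDim_le_of_surjective _ (Submodule.mkQ_surjective (Ideal.span {x} • ⊤)))
  have hxm : x ∈ IsLocalRing.maximalIdeal R := by
    by_contra hux
    rw [IsLocalRing.mem_maximalIdeal, mem_nonunits_iff, not_not] at hux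
    exact hx (by rw [Ideal.span_singleton_eq_top.2 hux, Submodule.top_smul])
  have mem_supp (r : PrimeSpectrum R) :
      r ∈ Module.support R (M ⧸ (Ideal.span {x} • (⊤ : Submodule R M))) ↔
        r ∈ Module.support R M ∧ x ∈ r.asIdeal := by
    rw [Module.support_quotient]
    simp [PrimeSpectrum.mem_zeroLocus]
  let l₀ : LTSeries (PrimeSpectrum R) := l.map Subtype.val fun _ _ h ↦ h
  have hp : l₀.head ∈ Module.support R M := l.head.2
  by_cases hxp : x ∈ l₀.head.asIdeal
  · exact l₀.length_le_supportDim ((mem_supp _).2 ⟨hp, hxp⟩)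
  have hdim : (l.length : WithBot ℕ∞) ≤
      Module.supportDim R (QuotSMulTop x (R ⧸ l₀.head.asIdeal)) + 1 := by
    refine le_trans ?_ (Module.supportDim_le_supportDim_quotSMulTop_succ hxm)
    refine l₀.length_le_supportDim ?_
    rw [Module.mem_support_iff_of_finite, Ideal.annihilator_quotient]
  obtain hlen | ⟨k, hk⟩ : l.length = 0 ∨ ∃ k, l.length = k + 1 := by
    cases l.length <;> simp
  · have : Nontrivial (M ⧸ (Ideal.span {x} • (⊤ : Submodule R M))) :=
      Submodule.Quotient.nontrivial_iff.2 hx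
    have := (Module.nonempty_support_of_nontrivial (R := R)
      (M := M ⧸ (Ideal.span {x} • (⊤ : Submodule R M)))).to_subtype
    rw [hlen]
    exact Order.krullDim_nonneg
  rw [hk, Nat.cast_succ] at hdim
  obtain ⟨s, hs⟩ := Order.le_krullDim_iff.1 (ENat.WithBot.add_le_add_one_right_iff.1 hdim)
  let s₀ : LTSeries (PrimeSpectrum R) := s.map Subtype.val fun _ _ h ↦ h
  have hq : s₀.head ∈ Module.support R (R ⧸ l₀.head.asIdeal) ∩ PrimeSpectrum.zeroLocus {x} := by
    rw [← Module.support_quotSMulTop]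
    exact s.head.2
  have hpq : l₀.head.asIdeal ≤ s₀.head.asIdeal := by
    simpa only [Ideal.annihilator_quotient] using Module.annihilator_le_of_mem_support hq.1
  have hxq : x ∈ s₀.head.asIdeal := hq.2 rfl
  obtain ⟨r, hr, hrq⟩ :
      ∃ r ∈ Module.support R (M ⧸ (Ideal.span {x} • (⊤ : Submodule R M))), r < s₀.head := by
    by_contra! hmin
    refine hxp (mem_of_mem_minimalPrimes_of_exact hxy hyx hp hpq ⟨⟨s₀.head.2, ?_⟩, ?_⟩)
    · rw [sup_le_iff, Ideal.span_singleton_le_iff_mem]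
      exact ⟨(Module.annihilator_le_of_mem_support hp).trans hpq, hxq⟩
    · rintro I ⟨hI, hle⟩ hIq
      rw [sup_le_iff, Ideal.span_singleton_le_iff_mem] at hle
      by_contra hne
      exact hmin ⟨I, hI⟩ ((mem_supp _).2 ⟨Module.mem_support_iff_of_finite.2 hle.1, hle.2⟩)
        (lt_of_le_not_ge hIq hne)
  have hcons : (s₀.cons r hrq).length = l.length := by
    rw [RelSeries.cons_length, hk, ← hs]
    rfl
  rw [← hcons]
  exact LTSeries.length_le_supportDim (s₀.cons r hrq) hr

theorem moduleDim_eq_supportDim (R M : Type*) [CommRing R] [AddCommGroup M] [Module R M]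
    [Module.Finite R M] : moduleDim R M = Module.supportDim R M :=
  (Module.supportDim_eq_ringKrullDim_quotient_annihilator R M).symm

theorem exact_lsmul_of_torsionBy_eq {R M : Type*} [CommRing R] [AddCommGroup M] [Module R M]
    {x y : R} (h : Submodule.torsionBy R M x = Ideal.span {y} • (⊤ : Submodule R M)) :
    Function.Exact (LinearMap.lsmul R M y) (LinearMap.lsmul R M x) := fun m ↦ by
  rw [LinearMap.lsmul_apply, ← Submodule.mem_torsionBy_iff, h, Submodule.ideal_span_singleton_smul,
    Submodule.mem_smul_pointwise_iff_exists]
  simp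

/-- If `(x, y)` is a pair of exact zero-divisors on a finitely generated module `M`
of dimension `d` over a Noetherian local ring, then
`dim M = dim M/xM = dim M/yM`. -/
theorem dim_eq_of_isEZDPair
    (R : Type u) [CommRing R] [IsNoetherianRing R] [IsLocalRing R]
    (M : Type u) [AddCommGroup M] [Module R M] [Module.Finite R M]
    (d : WithBot (WithTop ℕ)) (hd : moduleDim R M = d) (x y : R)
    (hxy : IsEZDPair R M x y) :
    moduleDim R M = moduleDim R (M ⧸ (Ideal.span {x} • (⊤ : Submodule R M))) ∧
    moduleDim R M = moduleDim R (M ⧸ (Ideal.span {y} • (⊤ : Submodule R M))) := by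
  have hyx := exact_lsmul_of_torsionBy_eq hxy.2.2.1
  have hxy' := exact_lsmul_of_torsionBy_eq hxy.2.2.2
  have hy : Ideal.span {y} • (⊤ : Submodule R M) ≠ ⊤ := fun h ↦ by
    obtain ⟨m, hm⟩ := hxy.2.1
    refine hm ((Submodule.mem_torsionBy_iff x m).1 ?_)
    rw [hxy.2.2.1, h]
    exact Submodule.mem_top
  simp only [moduleDim_eq_supportDim]
  exact ⟨Module.supportDim_eq_supportDim_quotient_of_exact hyx hxy' hxy.1,
    Module.supportDim_eq_supportDim_quotient_of_exact hxy' hyx hy⟩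
end

section
/- Let R be a commutative Noetherian local ring, M a finitely generated R-module, and x_1, …, x_n a sequence of exact zero-divisors on M. Then M is a Cohen–Macaulay R-module if and only if M/(x_1, …, x_n)M is a Cohen–Macaulay R-module. -/
/-- A finitely generated module `M` over a Noetherian local ring is
Cohen–Macaulay if `depth M = dim M`. -/
def IsCohenMacaulayModule (R : Type*) [CommRing R] [IsLocalRing R]
    (M : Type*) [AddCommGroup M] [Module R M] : Prop :=
  ((moduleDepth R M : ℕ∞) : WithBot ℕ∞) = moduleDim R M

universe u

section Auxiliary

open IsLocalRing RingTheory.Sequence Pointwise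

/-- `(0 :_M x) = yM`, i.e. `M --y--> M --x--> M` is exact. -/
def SMulExact (R : Type*) [CommRing R] (M : Type*) [AddCommGroup M] [Module R M] (x y : R) : Prop :=
  ∀ m : M, x • m = 0 ↔ ∃ w : M, y • w = m

/-- `M` has a nonzero element annihilated by the maximal ideal. -/
def HasSocle (R : Type*) [CommRing R] [IsLocalRing R]
    (M : Type*) [AddCommGroup M] [Module R M] : Prop :=
  ∃ z : M, z ≠ 0 ∧ ∀ r ∈ maximalIdeal R, r • z = 0

/-- `M` has a weakly regular sequence of length `k` in the maximal ideal. -/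
def HasRegularSeq (R : Type*) [CommRing R] [IsLocalRing R]
    (M : Type*) [AddCommGroup M] [Module R M] (k : ℕ) : Prop :=
  ∃ rs : List R, rs.length = k ∧ (∀ r ∈ rs, r ∈ maximalIdeal R) ∧ IsWeaklyRegular M rs

theorem mk_quotSMulTop_eq_zero_iff {R : Type*} [CommRing R] {M : Type*} [AddCommGroup M]
    [Module R M] {r : R} {m : M} :
    (Submodule.Quotient.mk m : QuotSMulTop r M) = 0 ↔ ∃ w : M, r • w = m := by
  rw [Submodule.Quotient.mk_eq_zero, Submodule.mem_smul_pointwise_iff_exists]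
  simp

theorem isSMulRegular_quotSMulTop_iff {R : Type*} [CommRing R] {M : Type*} [AddCommGroup M]
    [Module R M] {r s : R} :
    IsSMulRegular (QuotSMulTop r M) s ↔ ∀ m w : M, s • m = r • w → ∃ v, r • v = m := by
  rw [isSMulRegular_iff_right_eq_zero_of_smul]
  constructor
  · intro h m w e
    rw [← mk_quotSMulTop_eq_zero_iff]
    apply h
    rw [← Submodule.Quotient.mk_smul, mk_quotSMulTop_eq_zero_iff]
    exact ⟨w, e.symm⟩
  · intro h z hz
    obtain ⟨m, rfl⟩ := Submodule.Quotient.mk_surjective _ z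
    rw [← Submodule.Quotient.mk_smul, mk_quotSMulTop_eq_zero_iff] at hz
    obtain ⟨w, hw⟩ := hz
    exact mk_quotSMulTop_eq_zero_iff.2 (h m w hw.symm)

/-- The quotients of `M` by `rM` and then by `sM`, in either order, agree. -/
noncomputable def quotSMulTopComm {R : Type*} [CommRing R] (M : Type*) [AddCommGroup M]
    [Module R M] (r s : R) : QuotSMulTop r (QuotSMulTop s M) ≃ₗ[R] QuotSMulTop s (QuotSMulTop r M) :=
  let e (r s : R) : QuotSMulTop r (QuotSMulTop s M) ≃ₗ[R]
      M ⧸ ((s • ⊤ : Submodule R M) ⊔ r • ⊤) :=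
    Submodule.quotEquivOfEq _ _ (by
      rw [Submodule.map_pointwise_smul, Submodule.map_top, Submodule.range_mkQ]) ≪≫ₗ
      Submodule.quotientQuotientEquivQuotientSup (s • ⊤ : Submodule R M) (r • ⊤)
  e r s ≪≫ₗ Submodule.quotEquivOfEq _ _ (sup_comm _ _) ≪≫ₗ (e s r).symm

theorem IsSMulRegular.of_prod {R : Type*} [CommRing R] {M : Type*} [AddCommGroup M] [Module R M]
    {N : Type*} [AddCommGroup N] [Module R N] {r : R} (h : IsSMulRegular (M × N) r) :
    IsSMulRegular M r ∧ IsSMulRegular N r :=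
  ⟨fun a b e => congrArg Prod.fst (h (a₁ := (a, 0)) (a₂ := (b, 0)) (Prod.ext e rfl)),
    fun a b e => congrArg Prod.snd (h (a₁ := (0, a)) (a₂ := (0, b)) (Prod.ext rfl e))⟩

theorem IsSMulRegular.quotSMulTop_swap {R : Type*} [CommRing R] {M : Type*} [AddCommGroup M]
    [Module R M] {s t : R} (hs : IsSMulRegular M s) (hts : IsSMulRegular (QuotSMulTop s M) t) :
    IsSMulRegular (QuotSMulTop t M) s := by
  rw [isSMulRegular_quotSMulTop_iff] at hts ⊢
  intro z w e
  obtain ⟨v, rfl⟩ := hts w z e.symm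
  exact ⟨v, hs (by simpa [smul_comm s t] using e.symm)⟩

theorem SMulExact.quotSMulTop {R : Type*} [CommRing R] {M : Type*} [AddCommGroup M] [Module R M]
    {r x y : R} (hr : IsSMulRegular M r) (h : SMulExact R M x y)
    (h' : SMulExact R M y x) : SMulExact R (QuotSMulTop r M) x y := by
  intro z
  obtain ⟨m, rfl⟩ := Submodule.Quotient.mk_surjective _ z
  constructor
  · intro hz
    rw [← Submodule.Quotient.mk_smul, mk_quotSMulTop_eq_zero_iff] at hz
    obtain ⟨w, hw⟩ := hz
    have hyw : y • w = 0 := by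
      refine hr.right_eq_zero_of_smul ?_
      rw [smul_comm, hw]
      exact (h' _).2 ⟨m, rfl⟩
    obtain ⟨v, rfl⟩ := (h' w).1 hyw
    obtain ⟨u, hu⟩ := (h (m - r • v)).1 (by rw [smul_sub, ← hw, smul_comm, sub_self])
    refine ⟨Submodule.Quotient.mk u, ?_⟩
    rw [← Submodule.Quotient.mk_smul, hu, ← sub_eq_zero, ← Submodule.Quotient.mk_sub,
      mk_quotSMulTop_eq_zero_iff]
    exact ⟨-v, by simp⟩
  · rintro ⟨w, hw⟩
    obtain ⟨w, rfl⟩ := Submodule.Quotient.mk_surjective _ w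
    rw [← hw, ← Submodule.Quotient.mk_smul, ← Submodule.Quotient.mk_smul, (h _).2 ⟨w, rfl⟩,
      Submodule.Quotient.mk_zero]

theorem SMulExact.isSMulRegular_quotSMulTop {R : Type*} [CommRing R] {M : Type*}
    [AddCommGroup M] [Module R M] {r x y : R} (hr : IsSMulRegular M r)
    (h' : SMulExact R M y x) : IsSMulRegular (QuotSMulTop x M) r := by
  rw [isSMulRegular_quotSMulTop_iff]
  intro m w e
  refine (h' m).1 (hr.right_eq_zero_of_smul ?_)
  rw [smul_comm, e]
  exact (h' _).2 ⟨w, rfl⟩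

section Depth

variable {R : Type*} [CommRing R] [IsLocalRing R]
  {M : Type*} [AddCommGroup M] [Module R M] {N : Type*} [AddCommGroup N] [Module R N]

theorem LinearEquiv.hasRegularSeq_congr (e : M ≃ₗ[R] N) {k : ℕ} :
    HasRegularSeq R M k ↔ HasRegularSeq R N k := by
  simp only [HasRegularSeq, e.isWeaklyRegular_congr]

theorem hasRegularSeq_zero : HasRegularSeq R M 0 := ⟨[], by simp⟩

theorem hasRegularSeq_succ_iff {k : ℕ} :
    HasRegularSeq R M (k + 1) ↔
      ∃ r ∈ maximalIdeal R, IsSMulRegular M r ∧ HasRegularSeq R (QuotSMulTop r M) k := by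
  constructor
  · rintro ⟨_ | ⟨r, rs⟩, hl, hm, hr⟩
    · simp at hl
    · rw [isWeaklyRegular_cons_iff] at hr
      exact ⟨r, hm r (by simp), hr.1, rs, by simpa using hl, fun s hs => hm s (by simp [hs]), hr.2⟩
  · rintro ⟨r, hr, hreg, rs, hl, hm, hrs⟩
    exact ⟨r :: rs, by simp [hl], by simpa using ⟨hr, hm⟩, .cons hreg hrs⟩

theorem HasRegularSeq.not_hasSocle {k : ℕ} (h : HasRegularSeq R M (k + 1)) : ¬ HasSocle R M := by
  obtain ⟨r, hr, hreg, -⟩ := hasRegularSeq_succ_iff.1 h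
  rintro ⟨z, hz, h⟩
  exact hz (hreg.right_eq_zero_of_smul (h r hr))

theorem exists_isSMulRegular_of_not_hasSocle [IsNoetherianRing R] [Module.Finite R M]
    (h : ¬ HasSocle R M) : ∃ r ∈ maximalIdeal R, IsSMulRegular M r := by
  by_contra! hn
  obtain ⟨P, hP, hle⟩ := ((maximalIdeal R).subset_union_prime_finite
    (associatedPrimes.finite R M) (f := id) 0 0 fun _ h _ _ ↦ h.isPrime).1 <| by
      simp_rw [id, biUnion_associatedPrimes_eq_compl_regular]
      exact hn
  have hP' := hP
  rw [AssociatedPrimes.mem_iff, isAssociatedPrime_iff] at hP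
  obtain ⟨prime, z, rfl⟩ := hP
  refine h ⟨z, ?_, fun r hr => ?_⟩
  · rintro rfl
    exact prime.ne_top (by simp)
  · simpa [Submodule.mem_colon_singleton] using hle hr

theorem not_hasSocle_prod (hM : ¬ HasSocle R M) (hN : ¬ HasSocle R N) : ¬ HasSocle R (M × N) := by
  rintro ⟨⟨a, b⟩, hz, h⟩
  have ha : a = 0 := by
    by_contra ha
    exact hM ⟨a, ha, fun r hr => congrArg Prod.fst (h r hr)⟩
  have hb : b = 0 := by
    by_contra hb
    exact hN ⟨b, hb, fun r hr => congrArg Prod.snd (h r hr)⟩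
  exact hz (by simp [ha, hb])

/-- If `M/sM` has socle then so does `M/rM`, for `M`-regular elements `r`, `s`. -/
theorem HasSocle.quotSMulTop {r s : R} (hr : r ∈ maximalIdeal R) (hrM : IsSMulRegular M r)
    (hsM : IsSMulRegular M s) (h : HasSocle R (QuotSMulTop s M)) :
    HasSocle R (QuotSMulTop r M) := by
  obtain ⟨z, hz, h⟩ := h
  obtain ⟨z, rfl⟩ := Submodule.Quotient.mk_surjective _ z
  have h' : ∀ a ∈ maximalIdeal R, ∃ w, s • w = a • z := fun a ha => by
    rw [← mk_quotSMulTop_eq_zero_iff]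
    exact h a ha
  obtain ⟨w, hw⟩ := h' r hr
  refine ⟨Submodule.Quotient.mk w, fun h0 => ?_, fun a ha => ?_⟩
  · obtain ⟨v, rfl⟩ := mk_quotSMulTop_eq_zero_iff.1 h0
    refine hz (mk_quotSMulTop_eq_zero_iff.2 ⟨v, hrM ?_⟩)
    simpa [smul_comm r s] using hw
  · obtain ⟨u, hu⟩ := h' a ha
    rw [← Submodule.Quotient.mk_smul, mk_quotSMulTop_eq_zero_iff]
    refine ⟨u, hsM ?_⟩
    change s • r • u = s • a • w
    rw [smul_comm s r, hu, smul_comm s a, hw, smul_comm]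

/-- The quotients of `M` by regular elements of the maximal ideal have regular sequences of the
same lengths. -/
theorem HasRegularSeq.quotSMulTop_of_quotSMulTop {R : Type*} [CommRing R] [IsLocalRing R]
    [IsNoetherianRing R] (k : ℕ) : ∀ {M : Type*} [AddCommGroup M] [Module R M] [Module.Finite R M]
    {r s : R}, r ∈ maximalIdeal R → s ∈ maximalIdeal R → IsSMulRegular M r → IsSMulRegular M s →
    HasRegularSeq R (QuotSMulTop s M) k → HasRegularSeq R (QuotSMulTop r M) k := by
  induction k with
  | zero => intros; exact hasRegularSeq_zero
  | succ k ih =>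
    intro M _ _ _ r s hr hs hrM hsM h
    have hMs := h.not_hasSocle
    have hMr : ¬ HasSocle R (QuotSMulTop r M) := fun h' => hMs (h'.quotSMulTop hs hsM hrM)
    have hM : ¬ HasSocle R M := fun ⟨z, hz, h⟩ => hz (hrM.right_eq_zero_of_smul (h r hr))
    obtain ⟨t, ht, htp⟩ := exists_isSMulRegular_of_not_hasSocle
      (not_hasSocle_prod hM (not_hasSocle_prod hMr hMs))
    obtain ⟨htM, htp⟩ := htp.of_prod
    obtain ⟨htr, hts⟩ := htp.of_prod
    obtain ⟨u, hu, hus, hreg⟩ := hasRegularSeq_succ_iff.1 h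
    have h1 : HasRegularSeq R (QuotSMulTop t (QuotSMulTop s M)) k := ih ht hu hts hus hreg
    rw [(quotSMulTopComm M t s).hasRegularSeq_congr] at h1
    have h2 : HasRegularSeq R (QuotSMulTop r (QuotSMulTop t M)) k :=
      ih hr hs (hrM.quotSMulTop_swap htr) (hsM.quotSMulTop_swap hts) h1
    rw [(quotSMulTopComm M r t).hasRegularSeq_congr] at h2
    exact hasRegularSeq_succ_iff.2 ⟨t, ht, htr, h2⟩

theorem SMulExact.hasSocle_quotSMulTop_iff {x y : R} (hx : x ∈ maximalIdeal R)
    (h : SMulExact R M x y) (h' : SMulExact R M y x) :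
    HasSocle R (QuotSMulTop x M) ↔ HasSocle R M := by
  constructor
  · rintro ⟨z, hz, hs⟩
    obtain ⟨v, rfl⟩ := Submodule.Quotient.mk_surjective _ z
    refine ⟨y • v, fun h0 => hz (mk_quotSMulTop_eq_zero_iff.2 ((h' v).1 h0)), fun r hr => ?_⟩
    obtain ⟨w, hw⟩ := mk_quotSMulTop_eq_zero_iff.1 (hs r hr)
    change x • w = r • v at hw
    rw [smul_comm, ← hw]
    exact (h' _).2 ⟨w, rfl⟩
  · rintro ⟨z, hz, hs⟩
    obtain ⟨v, rfl⟩ := (h z).1 (hs x hx)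
    refine ⟨Submodule.Quotient.mk v, fun h0 => hz ((h' v).2 (mk_quotSMulTop_eq_zero_iff.1 h0)),
      fun r hr => ?_⟩
    rw [← Submodule.Quotient.mk_smul, mk_quotSMulTop_eq_zero_iff]
    exact (h' _).1 (by rw [smul_comm, hs r hr])

theorem SMulExact.hasRegularSeq_quotSMulTop_iff {R : Type*} [CommRing R] [IsLocalRing R]
    [IsNoetherianRing R] {x y : R} (hx : x ∈ maximalIdeal R) (k : ℕ) :
    ∀ {M : Type*} [AddCommGroup M] [Module R M] [Module.Finite R M],
    SMulExact R M x y → SMulExact R M y x →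
    (HasRegularSeq R (QuotSMulTop x M) k ↔ HasRegularSeq R M k) := by
  induction k with
  | zero => intros; exact iff_of_true hasRegularSeq_zero hasRegularSeq_zero
  | succ k ih =>
    intro M _ _ _ h h'
    have key : ∀ r, IsSMulRegular M r → (HasRegularSeq R (QuotSMulTop r (QuotSMulTop x M)) k ↔
        HasRegularSeq R (QuotSMulTop r M) k) := fun r hr => by
      rw [(quotSMulTopComm M r x).hasRegularSeq_congr]
      exact ih (h.quotSMulTop hr h') (h'.quotSMulTop hr h)
    constructor
    · intro hA
      obtain ⟨r, hr, hrM⟩ := exists_isSMulRegular_of_not_hasSocle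
        (mt (SMulExact.hasSocle_quotSMulTop_iff hx h h').2 hA.not_hasSocle)
      obtain ⟨s, hs, hsA, hA⟩ := hasRegularSeq_succ_iff.1 hA
      exact hasRegularSeq_succ_iff.2 ⟨r, hr, hrM, (key r hrM).1
        (hA.quotSMulTop_of_quotSMulTop k hr hs (h'.isSMulRegular_quotSMulTop hrM) hsA)⟩
    · intro hM
      obtain ⟨r, hr, hrM, hM⟩ := hasRegularSeq_succ_iff.1 hM
      exact hasRegularSeq_succ_iff.2 ⟨r, hr, h'.isSMulRegular_quotSMulTop hrM, (key r hrM).2 hM⟩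

end Depth

/-- For `x` in the maximal ideal with `(0 :_M x) = yM` and `(0 :_M y) = xM`, if `M/xM` has finite
length then `x` is nilpotent on `M`. -/
theorem SMulExact.exists_pow_smul_eq_zero {R : Type*} [CommRing R] [IsLocalRing R]
    [IsNoetherianRing R] {M : Type*} [AddCommGroup M] [Module R M] [Module.Finite R M] {x y : R}
    (hx : x ∈ maximalIdeal R) (h : SMulExact R M x y) (h' : SMulExact R M y x)
    (hmin : ∀ P : Ideal R, P.IsPrime → Module.annihilator R M ≤ P → x ∈ P → P = maximalIdeal R) :
    ∃ n : ℕ, ∀ m : M, x ^ n • m = 0 := by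
  have artinian : ∀ (N : Submodule R M) (k : ℕ), (∀ m : M, x ^ k • m ∈ N) →
      IsArtinian R (M ⧸ N) := by
    intro N k hk
    let I := Module.annihilator R (M ⧸ N)
    by_cases hI : I = ⊤
    · have : Subsingleton (M ⧸ N) := Module.annihilator_eq_top_iff.1 hI
      infer_instance
    have hxI : x ^ k ∈ I := Module.mem_annihilator.2 fun z => by
      obtain ⟨m, rfl⟩ := Submodule.Quotient.mk_surjective _ z
      rw [← Submodule.Quotient.mk_smul, Submodule.Quotient.mk_eq_zero]
      exact hk m
    have hle : Module.annihilator R M ≤ I :=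
      N.mkQ.annihilator_le_of_surjective N.mkQ_surjective
    have : IsArtinianRing (R ⧸ I) :=
      quotient_artinian_of_mem_minimalPrimes_of_isLocalRing I
        ⟨⟨inferInstance, le_maximalIdeal hI⟩, fun P hP _ =>
          (hmin P hP.1 (hle.trans hP.2) (hP.1.mem_of_pow_mem k (hP.2 hxI))).ge⟩
    let _ : Module (R ⧸ I) (M ⧸ N) := Module.quotientAnnihilator
    have : IsScalarTower R (R ⧸ I) (M ⧸ N) := inferInstance
    have : Module.Finite (R ⧸ I) (M ⧸ N) := Module.Finite.of_restrictScalars_finite R _ _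
    exact isArtinian_of_surjective_algebraMap (R := R ⧸ I) Ideal.Quotient.mk_surjective
  let f : Module.End R M := LinearMap.lsmul R M x
  let g : Module.End R M := LinearMap.lsmul R M y
  have hf : ∀ k m, (f ^ k) m = x ^ k • m := fun k m => by
    induction k generalizing m with
    | zero => simp
    | succ k ih => rw [pow_succ, Module.End.mul_apply, ih, pow_succ, mul_smul]; rfl
  obtain ⟨n, hn, hn1⟩ := ((Module.End.eventually_disjoint_ker_pow_range_pow f).and
    (Filter.eventually_ge_atTop 1)).exists
  obtain ⟨n, rfl⟩ : ∃ k, n = k + 1 := ⟨n - 1, by omega⟩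
  let N : Submodule R M := LinearMap.range (f ^ (n + 1))
  have hxN : ∀ m : M, x ^ (n + 1) • m ∈ N := fun m => ⟨m, hf _ m⟩
  have := artinian N (n + 1) hxN
  let f' : Module.End R (M ⧸ N) := LinearMap.lsmul R (M ⧸ N) x
  have len1 : Module.length R (LinearMap.ker f) = Module.length R (M ⧸ LinearMap.range f) := by
    have e1 : LinearMap.range g = LinearMap.ker f := by
      ext m
      exact (h m).symm
    have e2 : LinearMap.ker g = LinearMap.range f := by
      ext m
      exact h' m
    rw [← e1, ← e2]
    exact g.quotKerEquivRange.symm.length_eq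
  have len2 : Module.length R (LinearMap.ker f') =
      Module.length R ((M ⧸ N) ⧸ LinearMap.range f') := by
    have h1 := Module.length_eq_add_of_exact (LinearMap.ker f').subtype f'.rangeRestrict
      (Submodule.subtype_injective _) f'.surjective_rangeRestrict
      (LinearMap.exact_iff.2 (by rw [LinearMap.ker_rangeRestrict, Submodule.range_subtype]))
    have h2 := Module.length_eq_add_of_exact (LinearMap.range f').subtype
      (LinearMap.range f').mkQ (Submodule.subtype_injective _) (Submodule.mkQ_surjective _)
      (LinearMap.exact_subtype_mkQ _)
    have hfin : Module.length R (LinearMap.range f') ≠ ⊤ := Module.length_ne_top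
    rw [h2, add_comm] at h1
    exact ((ENat.add_left_injective_of_ne_top hfin) h1).symm
  have len3 : Module.length R ((M ⧸ N) ⧸ LinearMap.range f') ≤
      Module.length R (M ⧸ LinearMap.range f) := by
    refine Module.length_le_of_surjective ((LinearMap.range f).mapQ (LinearMap.range f') N.mkQ ?_) ?_
    · rintro _ ⟨m, rfl⟩
      exact ⟨N.mkQ m, rfl⟩
    · intro z
      obtain ⟨z, rfl⟩ := Submodule.Quotient.mk_surjective _ z
      obtain ⟨z, rfl⟩ := Submodule.Quotient.mk_surjective _ z
      exact ⟨Submodule.Quotient.mk z, rfl⟩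
  let φ : LinearMap.ker f →ₗ[R] LinearMap.ker f' :=
    N.mkQ.restrict (fun m (hm : x • m = 0) => by
      change x • N.mkQ m = 0
      rw [← map_smul, hm, map_zero])
  have hφ : Function.Injective φ := by
    rw [injective_iff_map_eq_zero]
    rintro ⟨m, hm⟩ h0
    have hmN : m ∈ N := (Submodule.Quotient.mk_eq_zero N).1 (congrArg Subtype.val h0)
    have hmk : m ∈ LinearMap.ker (f ^ (n + 1)) := by
      rw [LinearMap.mem_ker, hf, pow_succ, mul_smul, show x • m = 0 from hm, smul_zero]
    exact Subtype.ext (Submodule.disjoint_def.1 hn m hmk hmN)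
  have hsurj : LinearMap.range φ = ⊤ := by
    by_contra hne
    have := Submodule.length_lt hne
    rw [← (LinearEquiv.ofInjective φ hφ).length_eq, len1, len2] at this
    exact absurd len3 this.not_ge
  have hNN : N ≤ (maximalIdeal R) • N := by
    rintro _ ⟨m, rfl⟩
    have hmem : N.mkQ (x ^ n • m) ∈ LinearMap.ker f' := by
      change x • N.mkQ _ = 0
      rw [← map_smul, smul_smul, ← pow_succ']
      exact (Submodule.Quotient.mk_eq_zero N).2 (hxN m)
    obtain ⟨⟨k, hk⟩, hφk⟩ : (⟨_, hmem⟩ : LinearMap.ker f') ∈ LinearMap.range φ := by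
      rw [hsurj]; trivial
    have hd : x ^ n • m - k ∈ N :=
      (Submodule.Quotient.eq N).1 (congrArg Subtype.val hφk).symm
    have : x • (x ^ n • m - k) = (f ^ (n + 1)) m := by
      rw [smul_sub, show x • k = 0 from hk, sub_zero, hf, smul_smul, pow_succ']
    rw [← this]
    exact Submodule.smul_mem_smul hx hd
  have hN : N = ⊥ := Submodule.eq_bot_of_le_smul_of_le_jacobson_bot _ N
    (IsNoetherian.noetherian N) hNN (maximalIdeal_le_jacobson _)
  exact ⟨n + 1, fun m => by simpa [hN] using hxN m⟩

theorem LocalizedModule.mk_eq_zero_iff_exists {R : Type*} [CommRing R] {M : Type*} [AddCommGroup M]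
    [Module R M] {S : Submonoid R} {m : M} {s : S} :
    LocalizedModule.mk m s = 0 ↔ ∃ t : S, t • m = 0 := by
  rw [IsLocalizedModule.mk_eq_mk', IsLocalizedModule.mk'_eq_zero']

theorem SMulExact.localizedModule {R : Type*} [CommRing R] {M : Type*} [AddCommGroup M]
    [Module R M] (S : Submonoid R) {x y : R} (h : SMulExact R M x y) :
    SMulExact (Localization S) (LocalizedModule S M) (algebraMap R _ x) (algebraMap R _ y) := by
  intro z
  simp only [algebraMap_smul]
  constructor
  · induction z with | h m s
    intro hz
    rw [LocalizedModule.smul'_mk, LocalizedModule.mk_eq_zero_iff_exists] at hz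
    obtain ⟨t, ht⟩ := hz
    obtain ⟨w, hw⟩ := (h ((t : R) • m)).1 (by rw [smul_comm]; exact ht)
    refine ⟨LocalizedModule.mk w (t * s), ?_⟩
    rw [LocalizedModule.smul'_mk, hw]
    exact LocalizedModule.mk_cancel_common_left t s m
  · rintro ⟨w, rfl⟩
    induction w with | h m s
    rw [LocalizedModule.smul'_mk, LocalizedModule.smul'_mk, (h _).2 ⟨m, rfl⟩,
      LocalizedModule.zero_mk]

/-- If `q` is minimal in the support of `M/xM`, then `x` lies in every prime of the support of `M`
contained in `q`. -/
theorem SMulExact.mem_of_le_of_minimal {R : Type*} [CommRing R] [IsNoetherianRing R]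
    {M : Type*} [AddCommGroup M] [Module R M] [Module.Finite R M] {x y : R}
    (h : SMulExact R M x y) (h' : SMulExact R M y x) {q : Ideal R} [q.IsPrime] (hxq : x ∈ q)
    (hmin : ∀ P : Ideal R, P.IsPrime → Module.annihilator R M ≤ P → x ∈ P → P ≤ q → P = q)
    {p : Ideal R} [p.IsPrime] (hp : Module.annihilator R M ≤ p) (hpq : p ≤ q) : x ∈ p := by
  have : IsNoetherianRing (Localization.AtPrime q) := inferInstance
  obtain ⟨n, hn⟩ := SMulExact.exists_pow_smul_eq_zero (R := Localization.AtPrime q)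
    (M := LocalizedModule q.primeCompl M) (x := algebraMap R _ x) (y := algebraMap R _ y)
    ((IsLocalization.AtPrime.to_map_mem_maximal_iff (Localization.AtPrime q) q x).2 hxq)
    (h.localizedModule _) (h'.localizedModule _) (fun P hP hann hxP => by
      have hle : P.comap (algebraMap R _) ≤ q :=
        (Ideal.comap_mono (le_maximalIdeal hP.ne_top)).trans
          (Localization.AtPrime.under_maximalIdeal (I := q)).le
      have := hmin (P.comap (algebraMap R _)) (hP.comap _) (fun r hr => hann ?_) hxP hle
      · exact (IsLocalization.map_under q.primeCompl _ P).symm.trans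
          ((congrArg (Ideal.map (algebraMap R (Localization.AtPrime q))) this).trans
            Localization.AtPrime.map_eq_maximalIdeal)
      · rw [Module.mem_annihilator] at hr ⊢
        intro z
        induction z with | h m s
        rw [algebraMap_smul, LocalizedModule.smul'_mk, hr, LocalizedModule.zero_mk])
  have hn' : ∀ m : M, ∃ r ∉ q, (r * x ^ n) • m = 0 := fun m => by
    have := hn (LocalizedModule.mk m 1)
    rw [← map_pow, algebraMap_smul, LocalizedModule.smul'_mk,
      LocalizedModule.mk_eq_zero_iff_exists] at this
    obtain ⟨t, ht⟩ := this
    exact ⟨t, t.2, by rw [mul_smul]; exact ht⟩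
  obtain ⟨m, hm⟩ := Module.mem_support_iff'.1
    ((Module.mem_support_iff_of_finite (p := ⟨p, inferInstance⟩)).2 hp)
  obtain ⟨r, hr, h0⟩ := hn' m
  have : r * x ^ n ∈ p := by
    by_contra hc
    exact hm _ hc h0
  exact (‹p.IsPrime›.mem_or_mem this).elim (fun hc => absurd (hpq hc) hr)
    (‹p.IsPrime›.mem_of_pow_mem n)

theorem SMulExact.supportDim_quotSMulTop {R : Type*} [CommRing R] [IsLocalRing R]
    [IsNoetherianRing R] {M : Type*} [AddCommGroup M] [Module R M] [Module.Finite R M] {x y : R}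
    (hx : x ∈ maximalIdeal R) (h : SMulExact R M x y) (h' : SMulExact R M y x) :
    Module.supportDim R (QuotSMulTop x M) = Module.supportDim R M := by
  have mem_supp : ∀ p : PrimeSpectrum R, p ∈ Module.support R (QuotSMulTop x M) ↔
      p ∈ Module.support R M ∧ x ∈ p.asIdeal := fun p => by
    simp [Module.support_quotSMulTop]
  refine le_antisymm
    (Module.supportDim_le_of_surjective (Submodule.mkQ _) (Submodule.mkQ_surjective _)) ?_
  refine iSup_le_iff.mpr fun p => ?_
  suffices H : ∃ q : LTSeries (Module.support R (QuotSMulTop x M)), p.length ≤ q.length by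
    obtain ⟨q, hq⟩ := H
    exact (Nat.cast_le.mpr hq).trans (le_iSup (fun q : LTSeries _ => (q.length : WithBot ℕ∞)) q)
  wlog hxp : x ∈ p.last.1.1 generalizing p
  · obtain ⟨p', hle, hm⟩ := Module.exists_ltSeries_support_isMaximal_last_of_ltSeries_support p
    obtain ⟨q, hq⟩ := this p' (by rw [eq_maximalIdeal hm]; exact hx)
    exact ⟨q, hle.trans hq⟩
  obtain ⟨q, hxq, hq, h0, -⟩ :=
    PrimeSpectrum.exist_ltSeries_mem_one_of_mem_last (p.map Subtype.val fun _ _ lt => lt) hxp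
  replace hq : p.length = q.length := hq
  have hqM : ∀ i, q i ∈ Module.support R M := fun i =>
    Module.mem_support_mono (q.monotone (Fin.zero_le i)) (by
      change q.head ∈ _
      rw [← h0]
      exact p.head.2)
  have lift : ∀ s : LTSeries (PrimeSpectrum R), (∀ i, s i ∈ Module.support R M) →
      x ∈ (s 0).asIdeal →
      ∃ t : LTSeries (Module.support R (QuotSMulTop x M)), t.length = s.length :=
    fun s hs hxs => ⟨⟨s.length,
      fun i => ⟨s i, (mem_supp _).2 ⟨hs i, s.monotone (Fin.zero_le i) hxs⟩⟩, s.step⟩, rfl⟩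
  by_cases hx0 : x ∈ (q 0).asIdeal
  · obtain ⟨t, ht⟩ := lift q hqM hx0
    exact ⟨t, by omega⟩
  have hlen : q.length ≠ 0 := fun hl => by
    have : (1 : Fin (q.length + 1)) = 0 := Fin.ext (by
      have := (1 : Fin (q.length + 1)).2; simp; omega)
    exact hx0 (this ▸ hxq)
  have : ∃ P : PrimeSpectrum R, P ∈ Module.support R M ∧ x ∈ P.asIdeal ∧ P < q 1 := by
    by_contra! hc
    refine hx0 (h.mem_of_le_of_minimal h' hxq (fun P hP hann hxP hle => ?_)
      (Module.mem_support_iff_of_finite.1 (hqM 0)) (q.monotone (Fin.zero_le 1)))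
    by_contra hne
    exact hc ⟨P, hP⟩ (Module.mem_support_iff_of_finite.2 hann) hxP
      (lt_of_le_of_ne hle fun e => hne (congrArg PrimeSpectrum.asIdeal e))
  obtain ⟨P, hPM, hxP, hPq⟩ := this
  let q' := q.drop (1 : Fin (q.length + 1))
  have hP' : P < q'.head := by simpa [q'] using hPq
  obtain ⟨t, ht⟩ := lift (q'.cons P hP') (fun i => by
    refine Module.mem_support_mono (LTSeries.monotone (q'.cons P hP') (Fin.zero_le i)) ?_
    simpa using! hPM) (by simpa using! hxP)
  refine ⟨t, ?_⟩
  have h1 : (1 : Fin (q.length + 1)).val = 1 :=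
    (Fin.val_one' _).trans (Nat.mod_eq_of_lt (by omega))
  have h2 : q'.length = q.length - (1 : Fin (q.length + 1)).val := rfl
  rw [ht, RelSeries.cons_length, h2, h1]
  omega

theorem IsEZDPair.smulExact {R : Type*} [CommRing R] {M : Type*} [AddCommGroup M] [Module R M]
    {x y : R} (h : IsEZDPair R M x y) : SMulExact R M x y ∧ SMulExact R M y x := by
  have aux : ∀ {a b : R}, Submodule.torsionBy R M a = Ideal.span {b} • (⊤ : Submodule R M) →
      SMulExact R M a b := fun {a b} e m => by
    rw [← Submodule.mem_torsionBy_iff, e, Submodule.ideal_span_singleton_smul,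
      Submodule.mem_smul_pointwise_iff_exists]
    simp
  exact ⟨aux h.2.2.1, aux h.2.2.2⟩

theorem IsEZDPair.mem_maximalIdeal {R : Type*} [CommRing R] [IsLocalRing R] {M : Type*}
    [AddCommGroup M] [Module R M] {x y : R} (h : IsEZDPair R M x y) : x ∈ maximalIdeal R := by
  rw [IsLocalRing.mem_maximalIdeal, mem_nonunits_iff]
  intro hu
  exact h.1 (by rw [Ideal.span_singleton_eq_top.2 hu, Submodule.top_smul])

theorem LinearEquiv.isCohenMacaulayModule_congr {R : Type*} [CommRing R] [IsLocalRing R]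
    {M N : Type*} [AddCommGroup M] [Module R M] [AddCommGroup N] [Module R N] (e : M ≃ₗ[R] N) :
    IsCohenMacaulayModule R M ↔ IsCohenMacaulayModule R N := by
  rw [IsCohenMacaulayModule, IsCohenMacaulayModule, moduleDim, moduleDim, e.annihilator_eq]
  simp only [moduleDepth, e.isRegular_congr]

theorem moduleDepth_eq_sSup_hasRegularSeq {R : Type*} [CommRing R] [IsLocalRing R] {M : Type*}
    [AddCommGroup M] [Module R M] [Module.Finite R M] [Nontrivial M] :
    moduleDepth R M = sSup {d : ℕ∞ | ∃ k : ℕ, HasRegularSeq R M k ∧ (k : ℕ∞) = d} := by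
  rw [moduleDepth]
  congr 1
  ext d
  constructor
  · rintro ⟨rs, hm, hr, hl⟩
    exact ⟨rs.length, ⟨rs, rfl, hm, hr.toIsWeaklyRegular⟩, hl⟩
  · rintro ⟨_, ⟨rs, rfl, hm, hr⟩, hl⟩
    exact ⟨rs, hm, (IsLocalRing.isRegular_iff_isWeaklyRegular_of_subset_maximalIdeal hm).2 hr, hl⟩

theorem IsEZDPair.isCohenMacaulayModule_quotSMulTop_iff {R : Type*} [CommRing R] [IsLocalRing R]
    [IsNoetherianRing R] {M : Type*} [AddCommGroup M] [Module R M] [Module.Finite R M] {x y : R}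
    (h : IsEZDPair R M x y) :
    IsCohenMacaulayModule R (QuotSMulTop x M) ↔ IsCohenMacaulayModule R M := by
  have hx := h.mem_maximalIdeal
  obtain ⟨hxy, hyx⟩ := h.smulExact
  obtain ⟨m, hm⟩ := h.2.1
  have : Nontrivial M := ⟨_, _, hm⟩
  have : Nontrivial (QuotSMulTop x M) := nontrivial_quotSMulTop_of_mem_maximalIdeal M hx
  have hdim := SMulExact.supportDim_quotSMulTop hx hxy hyx
  rw [Module.supportDim_eq_ringKrullDim_quotient_annihilator,
    Module.supportDim_eq_ringKrullDim_quotient_annihilator] at hdim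
  simp only [IsCohenMacaulayModule, moduleDim, hdim, moduleDepth_eq_sSup_hasRegularSeq,
    SMulExact.hasRegularSeq_quotSMulTop_iff hx _ hxy hyx]

/-- The quotient of `M` by `(a, I)M` is the quotient of `M/IM` by `a`. -/
noncomputable def quotSpanInsertSMulTopEquiv {R : Type*} [CommRing R] (M : Type*) [AddCommGroup M]
    [Module R M] (a : R) (s : Set R) :
    (M ⧸ (Ideal.span (insert a s) • (⊤ : Submodule R M))) ≃ₗ[R]
      QuotSMulTop a (M ⧸ (Ideal.span s • (⊤ : Submodule R M))) :=
  Submodule.quotEquivOfEq _ (Ideal.span s • ⊤ ⊔ a • ⊤) (by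
      rw [Ideal.span_insert, Submodule.sup_smul, Submodule.ideal_span_singleton_smul, sup_comm]) ≪≫ₗ
    (Submodule.quotientQuotientEquivQuotientSup (Ideal.span s • ⊤ : Submodule R M) (a • ⊤)).symm ≪≫ₗ
    Submodule.quotEquivOfEq _ _ (by
      rw [Submodule.map_pointwise_smul, Submodule.map_top, Submodule.range_mkQ])

theorem IsEZDSeq.isCohenMacaulayModule_quotient_iff {R : Type*} [CommRing R] [IsNoetherianRing R]
    [IsLocalRing R] {M : Type*} [AddCommGroup M] [Module R M] [Module.Finite R M] {n : ℕ}
    {x : Fin n → R} (hx : IsEZDSeq R M x) (k : ℕ) (hk : k ≤ n) :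
    IsCohenMacaulayModule R
        (M ⧸ (Ideal.span (x '' {j | (j : ℕ) < k}) • (⊤ : Submodule R M))) ↔
      IsCohenMacaulayModule R M := by
  induction k with
  | zero => exact (Submodule.quotEquivOfEqBot _ (by simp)).isCohenMacaulayModule_congr
  | succ k ih =>
    obtain ⟨y, hy⟩ := hx ⟨k, hk⟩
    have hset : x '' {j | (j : ℕ) < k + 1} =
        insert (x ⟨k, hk⟩) (x '' {j | j < (⟨k, hk⟩ : Fin n)}) := by
      rw [← Set.image_insert_eq]
      congr 1
      ext j
      simp only [Set.mem_ofPred_eq, Set.mem_insert_iff, Fin.ext_iff, Fin.lt_def]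
      omega
    rw [hset, (quotSpanInsertSMulTopEquiv M _ _).isCohenMacaulayModule_congr,
      hy.isCohenMacaulayModule_quotSMulTop_iff]
    exact ih (by omega)

end Auxiliary

/-- If `x 0, …, x (n-1)` is a sequence of exact zero-divisors on a finitely
generated module `M` over a Noetherian local ring, then `M` is Cohen–Macaulay
iff `M/(x 0, …, x (n-1))M` is Cohen–Macaulay. -/
theorem isCohenMacaulay_iff_of_isEZDSeq
    (R : Type u) [CommRing R] [IsNoetherianRing R] [IsLocalRing R]
    (M : Type u) [AddCommGroup M] [Module R M] [Module.Finite R M]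
    {n : ℕ} (x : Fin n → R) (hx : IsEZDSeq R M x) :
    IsCohenMacaulayModule R M ↔
      IsCohenMacaulayModule R (M ⧸ (Ideal.span (Set.range x) • (⊤ : Submodule R M))) := by
  have h := hx.isCohenMacaulayModule_quotient_iff n le_rfl
  rw [show {j : Fin n | (j : ℕ) < n} = Set.univ from Set.eq_univ_of_forall fun j => j.2,
    Set.image_univ] at h
  exact h.symm
end

section
/- Let R be a commutative Noetherian ring, (x, y) a pair of exact zero-divisors on R, M an R-module, and set R̄ = R/(x). Consider the statements: (i) (x, y) is a pair of exact zero-divisors on M; (ii) Ext^i_R(R̄, M) = 0 for all i > 0; (iii) Tor^R_i(R̄, M) = 0 for all i > 0. Then (i) implies (ii), and (ii) is equivalent to (iii). Moreover, if M ≠ xM and x ∉ (0 :_R M), then (i), (ii), and (iii) are all equivalent. -/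
universe u

open CategoryTheory in
/-- `Ext^i_R(M, N)` as an `R`-module. -/
noncomputable def extRMod (R : Type u) [CommRing R] (M N : ModuleCat.{u} R) (i : ℕ) :
    ModuleCat.{u} R :=
  ((Ext R (ModuleCat.{u} R) i).obj (Opposite.op M)).obj N

open CategoryTheory in
/-- `Tor_i^R(M, N)` as an `R`-module. -/
noncomputable def torRMod (R : Type u) [CommRing R] (M N : ModuleCat.{u} R) (i : ℕ) :
    ModuleCat.{u} R :=
  ((Tor (ModuleCat.{u} R) i).obj M).obj N

section

open CategoryTheory Limits MonoidalCategory

variable {R : Type u} [CommRing R]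

/-- Multiplication by `a` on `R`, as a morphism of `R`-modules. -/
noncomputable abbrev mulHom (a : R) : ModuleCat.of R R ⟶ ModuleCat.of R R :=
  ModuleCat.ofHom (LinearMap.mulLeft R a)

lemma mulHom_comp_eq_zero {a b : R} (h : a * b = 0) : mulHom a ≫ mulHom b = 0 := by
  ext
  simp [mul_comm b a, h]

lemma mem_span_singleton_smul_top {M : Type*} [AddCommGroup M] [Module R M] (a : R) (m : M) :
    m ∈ Ideal.span {a} • (⊤ : Submodule R M) ↔ ∃ n, a • n = m := by
  simp [Submodule.ideal_span_singleton_smul, Submodule.mem_smul_pointwise_iff_exists]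

lemma torsionBy_eq_span_smul_top_iff_exact {M : Type*} [AddCommGroup M] [Module R M] (a b : R) :
    Submodule.torsionBy R M a = Ideal.span {b} • (⊤ : Submodule R M) ↔
      Function.Exact (b • · : M → M) (a • · : M → M) := by
  simp only [SetLike.ext_iff, Submodule.mem_torsionBy_iff, mem_span_singleton_smul_top,
    Function.Exact, Set.mem_range]

lemma IsEZDPair.mul_eq_zero {x y : R} (h : IsEZDPair R R x y) : x * y = 0 := by
  have : y ∈ Submodule.torsionBy R R x := by
    rw [h.2.2.1, mem_span_singleton_smul_top]
    exact ⟨1, by simp⟩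
  simpa using this

lemma IsEZDPair.symm {x y : R} (h : IsEZDPair R R x y) : IsEZDPair R R y x := by
  obtain ⟨h1, ⟨r, hr⟩, h3, h4⟩ := h
  refine ⟨fun h => hr ?_, ?_, h4, h3⟩
  · rw [← Submodule.mem_torsionBy_iff, h3, h]
    trivial
  · by_contra! hy
    exact h1 (h4 ▸ eq_top_iff.2 fun m _ => (Submodule.mem_torsionBy_iff y m).2 (hy m))

/-- The periodic complex `⋯ ⟶ R --y--> R --x--> R ⟶ 0`. -/
noncomputable def ezdComplex (x y : R) (h : x * y = 0) : ChainComplex (ModuleCat.{u} R) ℕ :=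
  HomologicalComplex.alternatingConst (ModuleCat.of R R) (φ := mulHom y) (ψ := mulHom x)
    (mulHom_comp_eq_zero (by rw [mul_comm, h])) (mulHom_comp_eq_zero h)
    fun _ _ => ComplexShape.down_nat_odd_add

lemma ezdComplex_d_of_odd (x y : R) (h : x * y = 0) (n : ℕ) (hn : Odd (n + 1)) :
    (ezdComplex x y h).d (n + 1) n = mulHom x := by
  simp [ezdComplex, Nat.not_even_iff_odd.2 hn]
  rfl

lemma ezdComplex_d_of_even (x y : R) (h : x * y = 0) (n : ℕ) (hn : Even (n + 1)) :
    (ezdComplex x y h).d (n + 1) n = mulHom y := by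
  simp [ezdComplex, hn]
  rfl

/-- The augmentation of `ezdComplex` given by the projection `R ⟶ R/(x)`. -/
noncomputable def ezdComplexπ (x y : R) (h : x * y = 0) :
    ezdComplex x y h ⟶
      (ChainComplex.single₀ (ModuleCat R)).obj (ModuleCat.of R (R ⧸ Ideal.span {x})) :=
  ((ezdComplex x y h).toSingle₀Equiv _).symm
    ⟨ModuleCat.ofHom (Submodule.mkQ (Ideal.span {x})), by
      rw [ezdComplex_d_of_odd _ _ _ _ (by simp)]
      refine ModuleCat.hom_ext (LinearMap.ext_ring ?_)
      exact (Submodule.Quotient.mk_eq_zero _).2 (by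
        change x * 1 ∈ Ideal.span {x}
        simp)⟩

lemma ezdComplexπ_quasiIso (x y : R) (hxy : IsEZDPair R R x y) :
    QuasiIso (ezdComplexπ x y hxy.mul_eq_zero) where
  quasiIsoAt m := by
    have h1 := (torsionBy_eq_span_smul_top_iff_exact _ _).1 hxy.2.2.1
    have h2 := (torsionBy_eq_span_smul_top_iff_exact _ _).1 hxy.2.2.2
    cases m with
    | zero =>
      rw [ChainComplex.quasiIsoAt₀_iff, ShortComplex.quasiIso_iff_of_zeros' _ rfl rfl rfl]
      constructor
      · rw [ShortComplex.ShortExact.moduleCat_exact_iff_function_exact]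
        have := ezdComplex_d_of_odd x y hxy.mul_eq_zero 0 (by simp)
        change Function.Exact ((ezdComplex x y hxy.mul_eq_zero).d 1 0).hom
          (Submodule.mkQ (Ideal.span {x}))
        rw [this]
        intro (a : R)
        refine ((Submodule.Quotient.mk_eq_zero _).trans Ideal.mem_span_singleton').trans ?_
        exact exists_congr fun b => by rw [mul_comm]; rfl
      · rw [ModuleCat.epi_iff_surjective]
        exact Submodule.mkQ_surjective _
    | succ m =>
      rw [quasiIsoAt_iff_exactAt' (hL := ChainComplex.exactAt_succ_single_obj ..),
          HomologicalComplex.exactAt_iff' _ (m + 2) (m + 1) m (by simp) (by simp),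
          ShortComplex.ShortExact.moduleCat_exact_iff_function_exact]
      dsimp [HomologicalComplex.sc', HomologicalComplex.shortComplexFunctor']
      rcases Nat.even_or_odd (m + 1) with hm | hm
      · rw [ezdComplex_d_of_even _ _ _ _ hm, ezdComplex_d_of_odd _ _ _ _ hm.add_one]
        exact h2
      · rw [ezdComplex_d_of_odd _ _ _ _ hm, ezdComplex_d_of_even _ _ _ _ hm.add_one]
        exact h1

/-- The periodic free resolution of `R/(x)` for a pair `(x, y)` of exact zero-divisors. -/
noncomputable def ezdResolution (x y : R) (hxy : IsEZDPair R R x y) :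
    ProjectiveResolution (ModuleCat.of R (R ⧸ Ideal.span {x})) where
  complex := ezdComplex x y hxy.mul_eq_zero
  projective _ := inferInstanceAs (Projective (ModuleCat.of R R))
  π := ezdComplexπ x y hxy.mul_eq_zero
  quasiIso := ezdComplexπ_quasiIso x y hxy

lemma exact_precomp_mul_iff (M : Type u) [AddCommGroup M] [Module R M] (a b : R) :
    Function.Exact (fun f : ModuleCat.of R R ⟶ ModuleCat.of R M => mulHom b ≫ f)
      (fun f : ModuleCat.of R R ⟶ ModuleCat.of R M => mulHom a ≫ f) ↔
    Submodule.torsionBy R M a = Ideal.span {b} • (⊤ : Submodule R M) := by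
  rw [torsionBy_eq_span_smul_top_iff_exact]
  have key (c : R) (f : ModuleCat.of R R ⟶ ModuleCat.of R M) (m : M) :
      mulHom c ≫ f = ModuleCat.ofHom (LinearMap.toSpanSingleton R M m) ↔ c • f.hom 1 = m := by
    rw [ModuleCat.hom_ext_iff, LinearMap.ext_ring_iff]
    simp [← map_smul]
  have e (f : ModuleCat.of R R ⟶ ModuleCat.of R M) :
      f = ModuleCat.ofHom (LinearMap.toSpanSingleton R M (f.hom 1)) := by
    rw [ModuleCat.hom_ext_iff, LinearMap.ext_ring_iff]
    simp
  have key0 (f : ModuleCat.of R R ⟶ ModuleCat.of R M) : mulHom a ≫ f = 0 ↔ a • f.hom 1 = 0 := by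
    rw [← key, LinearMap.toSpanSingleton_zero]; rfl
  simp only [Function.Exact, Set.mem_range]
  constructor
  · intro h m
    have := h (ModuleCat.ofHom (LinearMap.toSpanSingleton R M m))
    rw [key0] at this
    simp only [key] at this
    simp only [ModuleCat.hom_ofHom, LinearMap.toSpanSingleton_apply, one_smul] at this
    rw [this]
    refine ⟨fun ⟨f, hf⟩ => ⟨_, hf⟩, fun ⟨n, hn⟩ =>
      ⟨ModuleCat.ofHom (LinearMap.toSpanSingleton R M n), by simpa using hn⟩⟩
  · intro h f
    rw [key0, h]
    conv_rhs => rw [e f]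
    simp only [key]
    refine ⟨fun ⟨n, hn⟩ => ⟨ModuleCat.ofHom (LinearMap.toSpanSingleton R M n), by simpa using hn⟩,
      fun ⟨f, hf⟩ => ⟨_, hf⟩⟩

lemma subsingleton_extRMod_iff_exact (x y : R) (hxy : IsEZDPair R R x y)
    (M : Type u) [AddCommGroup M] [Module R M] (n : ℕ) :
    Subsingleton
      (extRMod R (ModuleCat.of R (R ⧸ Ideal.span {x})) (ModuleCat.of R M) (n + 1)) ↔
    Function.Exact
      (fun f : ModuleCat.of R R ⟶ ModuleCat.of R M =>
        (ezdComplex x y hxy.mul_eq_zero).d (n + 1) n ≫ f)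
      (fun f : ModuleCat.of R R ⟶ ModuleCat.of R M =>
        (ezdComplex x y hxy.mul_eq_zero).d (n + 2) (n + 1) ≫ f) := by
  rw [← ModuleCat.isZero_iff_subsingleton]
  unfold extRMod
  rw [((ezdResolution x y hxy).isoExt (R := R) (n + 1) (ModuleCat.of R M)).isZero_iff,
    ← HomologicalComplex.exactAt_iff_isZero_homology,
    HomologicalComplex.exactAt_iff' _ n (n + 1) (n + 2) (by simp) (by simp),
    ShortComplex.ShortExact.moduleCat_exact_iff_function_exact]
  rfl

lemma forall_subsingleton_extRMod_iff (x y : R) (hxy : IsEZDPair R R x y)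
    (M : Type u) [AddCommGroup M] [Module R M] :
    (∀ i : ℕ, 0 < i →
      Subsingleton (extRMod R (ModuleCat.of R (R ⧸ Ideal.span {x})) (ModuleCat.of R M) i)) ↔
    Submodule.torsionBy R M x = Ideal.span {y} • (⊤ : Submodule R M) ∧
    Submodule.torsionBy R M y = Ideal.span {x} • (⊤ : Submodule R M) := by
  rw [← exact_precomp_mul_iff, ← exact_precomp_mul_iff]
  constructor
  · intro h
    have h1 := (subsingleton_extRMod_iff_exact x y hxy M 0).1 (h 1 (by simp))
    have h2 := (subsingleton_extRMod_iff_exact x y hxy M 1).1 (h 2 (by simp))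
    rw [ezdComplex_d_of_odd _ _ _ _ (by decide), ezdComplex_d_of_even _ _ _ _ (by decide)] at h1
    rw [ezdComplex_d_of_even _ _ _ _ (by decide), ezdComplex_d_of_odd _ _ _ _ (by decide)] at h2
    exact ⟨h2, h1⟩
  · rintro ⟨h1, h2⟩ (_ | n) hn
    · exact absurd hn (lt_irrefl _)
    · rw [subsingleton_extRMod_iff_exact x y hxy]
      rcases Nat.even_or_odd (n + 1) with hm | hm
      · rw [ezdComplex_d_of_even _ _ _ _ hm, ezdComplex_d_of_odd _ _ _ _ hm.add_one]
        exact h1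
      · rw [ezdComplex_d_of_odd _ _ _ _ hm, ezdComplex_d_of_even _ _ _ _ hm.add_one]
        exact h2

/-- The complex `X ⊗ P`, whose homology is `Tor(X, M)` when `P` is a projective resolution of
`M`. -/
noncomputable abbrev tensorResolution {M : ModuleCat.{u} R} (P : ProjectiveResolution M)
    (X : ModuleCat.{u} R) : ChainComplex (ModuleCat.{u} R) ℕ :=
  (((tensoringLeft (ModuleCat.{u} R)).obj X).mapHomologicalComplex _).obj P.complex

/-- The short complex of complexes obtained by tensoring a resolution with a short complex. -/
noncomputable def tensorResolutionShortComplex {M : ModuleCat.{u} R} (P : ProjectiveResolution M)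
    (S : ShortComplex (ModuleCat.{u} R)) : ShortComplex (ChainComplex (ModuleCat.{u} R) ℕ) where
  X₁ := tensorResolution P S.X₁
  X₂ := tensorResolution P S.X₂
  X₃ := tensorResolution P S.X₃
  f := (NatTrans.mapHomologicalComplex ((tensoringLeft (ModuleCat.{u} R)).map S.f) _).app P.complex
  g := (NatTrans.mapHomologicalComplex ((tensoringLeft (ModuleCat.{u} R)).map S.g) _).app P.complex
  zero := by
    ext n : 1
    exact (S.map (tensorRight (P.complex.X n))).zero

lemma tensorResolutionShortComplex_shortExact {M : ModuleCat.{u} R} (P : ProjectiveResolution M)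
    {S : ShortComplex (ModuleCat.{u} R)} (hS : S.ShortExact) :
    (tensorResolutionShortComplex P S).ShortExact := by
  refine HomologicalComplex.shortExact_of_degreewise_shortExact _ fun n => ?_
  have : Module.Projective R (P.complex.X n) :=
    (IsProjective.iff_projective _).2 (inferInstanceAs (Projective (P.complex.X n)))
  exact hS.map_of_exact (tensorRight (P.complex.X n))

lemma isZero_Tor_iff {M : ModuleCat.{u} R} (P : ProjectiveResolution M)
    (X : ModuleCat.{u} R) (n : ℕ) :
    IsZero (((Tor (ModuleCat.{u} R) n).obj X).obj M) ↔
      IsZero ((tensorResolution P X).homology n) :=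
  (P.isoLeftDerivedObj _ n).isZero_iff

lemma isZero_homology_tensorResolution_succ_of_flat {M : ModuleCat.{u} R}
    (P : ProjectiveResolution M) (X : ModuleCat.{u} R) [Module.Flat R X] (n : ℕ) :
    IsZero ((tensorResolution P X).homology (n + 1)) := by
  rw [← HomologicalComplex.exactAt_iff_isZero_homology,
    HomologicalComplex.exactAt_iff' _ (n + 2) (n + 1) n (by simp) (by simp)]
  have h := P.complex_exactAt_succ n
  rw [HomologicalComplex.exactAt_iff' _ (n + 2) (n + 1) n (by simp) (by simp),
    ShortComplex.ShortExact.moduleCat_exact_iff_function_exact] at h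
  rw [ShortComplex.ShortExact.moduleCat_exact_iff_function_exact]
  exact Module.Flat.lTensor_exact X h

lemma isZero_Tor_succ_succ_iff {S : ShortComplex (ModuleCat.{u} R)} (hS : S.ShortExact)
    [Module.Flat R S.X₂] (M : ModuleCat.{u} R) (n : ℕ) :
    IsZero (((Tor (ModuleCat.{u} R) (n + 2)).obj S.X₃).obj M) ↔
      IsZero (((Tor (ModuleCat.{u} R) (n + 1)).obj S.X₁).obj M) := by
  let P := projectiveResolution M
  rw [isZero_Tor_iff P, isZero_Tor_iff P]
  exact ((tensorResolutionShortComplex_shortExact P hS).δIso (n + 2) (n + 1) (by simp)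
    (isZero_homology_tensorResolution_succ_of_flat P S.X₂ _)
    (isZero_homology_tensorResolution_succ_of_flat P S.X₂ _)).isZero_iff

lemma mono_homologyMap_zero_iff {C D : Type*} [Category* C] [Category* D] [Abelian C] [Abelian D]
    [HasProjectiveResolutions C] {F G : C ⥤ D} [F.Additive] [G.Additive]
    [PreservesFiniteColimits F] [PreservesFiniteColimits G] (α : F ⟶ G) {X : C}
    (P : ProjectiveResolution X) :
    Mono (HomologicalComplex.homologyMap
      ((NatTrans.mapHomologicalComplex α (ComplexShape.down ℕ)).app P.complex) 0) ↔
      Mono (α.app X) := by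
  let e : Arrow.mk (HomologicalComplex.homologyMap
      ((NatTrans.mapHomologicalComplex α (ComplexShape.down ℕ)).app P.complex) 0) ≅
      Arrow.mk (α.app X) :=
    Arrow.isoMk
      (ChainComplex.isoHomologyι₀ _ ≪≫ asIso (P.fromLeftDerivedZero' F))
      (ChainComplex.isoHomologyι₀ _ ≪≫ asIso (P.fromLeftDerivedZero' G))
      (by
        have h : HomologicalComplex.opcyclesMap
            ((NatTrans.mapHomologicalComplex α (ComplexShape.down ℕ)).app P.complex) 0 ≫
              P.fromLeftDerivedZero' G = P.fromLeftDerivedZero' F ≫ α.app X := by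
          rw [← cancel_epi (HomologicalComplex.pOpcycles _ _)]
          simpa using! (α.naturality (P.π.f 0)).symm
        simp [h])
  exact (MorphismProperty.monomorphisms _).arrow_mk_iso_iff e

instance preservesFiniteColimits_tensoringLeft_obj (X : ModuleCat.{u} R) :
    PreservesFiniteColimits ((tensoringLeft (ModuleCat.{u} R)).obj X) :=
  inferInstanceAs (PreservesFiniteColimits (tensorLeft X))

lemma isZero_Tor_one_iff {S : ShortComplex (ModuleCat.{u} R)} (hS : S.ShortExact)
    [Module.Flat R S.X₂] (M : ModuleCat.{u} R) :
    IsZero (((Tor (ModuleCat.{u} R) 1).obj S.X₃).obj M) ↔ Mono (S.f ▷ M) := by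
  let P := projectiveResolution M
  have hT := tensorResolutionShortComplex_shortExact P hS
  have h10 : (ComplexShape.down ℕ).Rel 1 0 := by simp
  have hmono : Mono (hT.δ 1 0 h10) :=
    hT.mono_δ _ _ _ (isZero_homology_tensorResolution_succ_of_flat P S.X₂ 0)
  have hex := hT.homology_exact₁ 1 0 h10
  rw [isZero_Tor_iff P]
  refine Iff.trans ?_ (mono_homologyMap_zero_iff ((tensoringLeft (ModuleCat.{u} R)).map S.f) P)
  refine Iff.trans ?_ hex.mono_g_iff.symm
  change IsZero ((tensorResolutionShortComplex P S).X₃.homology 1) ↔ hT.δ 1 0 h10 = 0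
  exact ⟨fun h => h.eq_of_src _ _, IsZero.of_mono_eq_zero _⟩

lemma span_singleton_le_ker_mulLeft (x y : R) (h : x * y = 0) :
    Ideal.span {x} ≤ LinearMap.ker (LinearMap.mulLeft R y) := by
  simp [Ideal.span_le, mul_comm y x, h]

/-- The short complex `R/(x) --y--> R ⟶ R/(y)`. -/
noncomputable def ezdShortComplex (x y : R) (h : x * y = 0) : ShortComplex (ModuleCat.{u} R) where
  X₁ := ModuleCat.of R (R ⧸ Ideal.span {x})
  X₂ := ModuleCat.of R R
  X₃ := ModuleCat.of R (R ⧸ Ideal.span {y})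
  f := ModuleCat.ofHom
    ((Ideal.span {x}).liftQ (LinearMap.mulLeft R y) (span_singleton_le_ker_mulLeft x y h))
  g := ModuleCat.ofHom (Submodule.mkQ (Ideal.span {y}))
  zero := by
    refine ModuleCat.hom_ext (Submodule.linearMap_qext _ (LinearMap.ext_ring ?_))
    refine (Submodule.Quotient.mk_eq_zero _).2 ?_
    exact Ideal.mul_mem_right _ _ (Ideal.mem_span_singleton_self y)

lemma ezdShortComplex_shortExact (x y : R) (hxy : IsEZDPair R R x y) :
    (ezdShortComplex x y hxy.mul_eq_zero).ShortExact := by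
  have h2 := (torsionBy_eq_span_smul_top_iff_exact _ _).1 hxy.2.2.2
  refine ShortComplex.ShortExact.mk' ?_ ?_ ?_
  · rw [ShortComplex.ShortExact.moduleCat_exact_iff_function_exact]
    intro (a : R)
    refine ((Submodule.Quotient.mk_eq_zero _).trans Ideal.mem_span_singleton').trans ?_
    constructor
    · rintro ⟨b, rfl⟩
      exact ⟨Submodule.Quotient.mk b, mul_comm y b⟩
    · rintro ⟨b, rfl⟩
      obtain ⟨b, rfl⟩ := Submodule.Quotient.mk_surjective _ b
      exact ⟨b, mul_comm b y⟩
  · rw [ModuleCat.mono_iff_injective]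
    refine (injective_iff_map_eq_zero _).2 fun a ha => ?_
    obtain ⟨a, rfl⟩ := Submodule.Quotient.mk_surjective _ a
    obtain ⟨b, rfl⟩ := (h2 a).1 ha
    exact (Submodule.Quotient.mk_eq_zero _).2
      (Ideal.mul_mem_right _ _ (Ideal.mem_span_singleton_self x))
  · rw [ModuleCat.epi_iff_surjective]
    exact Submodule.mkQ_surjective _

lemma mono_ezdShortComplex_f_whiskerRight_iff (x y : R) (h : x * y = 0)
    (M : Type u) [AddCommGroup M] [Module R M] :
    Mono ((ezdShortComplex x y h).f ▷ ModuleCat.of R M) ↔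
      Submodule.torsionBy R M y = Ideal.span {x} • (⊤ : Submodule R M) := by
  rw [ModuleCat.mono_iff_injective]
  let f := (Ideal.span {x}).liftQ (LinearMap.mulLeft R y) (span_singleton_le_ker_mulLeft x y h)
  let q : M →ₗ[R] TensorProduct R (R ⧸ Ideal.span {x}) M := TensorProduct.mk R _ M 1
  have hq : Function.Surjective q := TensorProduct.mk_surjective _ _ _ Ideal.Quotient.mk_surjective
  have hker : LinearMap.ker q = Ideal.span {x} • (⊤ : Submodule R M) := by
    rw [← LinearEquiv.ker_comp (TensorProduct.quotTensorEquivQuotSMul M (Ideal.span {x})) q,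
      TensorProduct.quotTensorEquivQuotSMul_comp_mk, Submodule.ker_mkQ]
  have hcomp (m : M) : TensorProduct.lid R M (f.rTensor M (q m)) = y • m := by
    change TensorProduct.lid R M ((y * 1) ⊗ₜ[R] m) = y • m
    simp
  have key : Function.Injective (f.rTensor M) ↔ Submodule.torsionBy R M y = LinearMap.ker q := by
    rw [injective_iff_map_eq_zero, hq.forall]
    have hle : LinearMap.ker q ≤ Submodule.torsionBy R M y := fun m hm => by
      rw [Submodule.mem_torsionBy_iff, ← hcomp, LinearMap.mem_ker.1 hm, map_zero, map_zero]
    rw [← hle.ge_iff_eq']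
    refine forall_congr' fun m => ?_
    rw [Submodule.mem_torsionBy_iff, ← hcomp, LinearEquiv.map_eq_zero_iff, LinearMap.mem_ker]
  rw [← hker, ← key]
  rfl

lemma subsingleton_torRMod_one_iff (x y : R) (hxy : IsEZDPair R R x y)
    (M : Type u) [AddCommGroup M] [Module R M] :
    Subsingleton (torRMod R (ModuleCat.of R (R ⧸ Ideal.span {y})) (ModuleCat.of R M) 1) ↔
      Submodule.torsionBy R M y = Ideal.span {x} • (⊤ : Submodule R M) := by
  have : Module.Flat R (ezdShortComplex x y hxy.mul_eq_zero).X₂ :=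
    inferInstanceAs (Module.Flat R R)
  rw [← ModuleCat.isZero_iff_subsingleton,
    ← mono_ezdShortComplex_f_whiskerRight_iff x y hxy.mul_eq_zero]
  exact isZero_Tor_one_iff (ezdShortComplex_shortExact x y hxy) (ModuleCat.of R M)

lemma subsingleton_torRMod_succ_succ_iff (x y : R) (hxy : IsEZDPair R R x y)
    (M : Type u) [AddCommGroup M] [Module R M] (n : ℕ) :
    Subsingleton (torRMod R (ModuleCat.of R (R ⧸ Ideal.span {y})) (ModuleCat.of R M) (n + 2)) ↔
      Subsingleton
        (torRMod R (ModuleCat.of R (R ⧸ Ideal.span {x})) (ModuleCat.of R M) (n + 1)) := by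
  have : Module.Flat R (ezdShortComplex x y hxy.mul_eq_zero).X₂ :=
    inferInstanceAs (Module.Flat R R)
  rw [← ModuleCat.isZero_iff_subsingleton, ← ModuleCat.isZero_iff_subsingleton]
  exact isZero_Tor_succ_succ_iff (ezdShortComplex_shortExact x y hxy) (ModuleCat.of R M) n

lemma forall_subsingleton_torRMod_iff (x y : R) (hxy : IsEZDPair R R x y)
    (M : Type u) [AddCommGroup M] [Module R M] :
    (∀ i : ℕ, 0 < i →
      Subsingleton (torRMod R (ModuleCat.of R (R ⧸ Ideal.span {x})) (ModuleCat.of R M) i)) ↔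
    Submodule.torsionBy R M x = Ideal.span {y} • (⊤ : Submodule R M) ∧
    Submodule.torsionBy R M y = Ideal.span {x} • (⊤ : Submodule R M) := by
  rw [← subsingleton_torRMod_one_iff x y hxy, ← subsingleton_torRMod_one_iff y x hxy.symm,
    ← subsingleton_torRMod_succ_succ_iff y x hxy.symm]
  refine ⟨fun h => ⟨h 1 (by simp), h 2 (by simp)⟩, fun ⟨h1, h2⟩ i hi => ?_⟩
  induction i using Nat.twoStepInduction with
  | zero => exact absurd hi (lt_irrefl _)
  | one => exact h1
  | more n ih _ =>
    rcases n with _ | n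
    · exact h2
    · rw [subsingleton_torRMod_succ_succ_iff y x hxy.symm,
        subsingleton_torRMod_succ_succ_iff x y hxy]
      exact ih n.succ_pos

end

/-- Let `(x, y)` be a pair of exact zero-divisors on `R`, `M` an `R`-module and
`R̄ = R/(x)`.  Then: (i) ⇒ (ii), (ii) ⇔ (iii), and if moreover `M ≠ xM` and
`x ∉ (0 :_R M)` then (ii) ⇒ (i), where
(i) `(x, y)` is a pair of exact zero-divisors on `M`;
(ii) `Ext^i_R(R̄, M) = 0` for all `i > 0`;
(iii) `Tor^R_i(R̄, M) = 0` for all `i > 0`. -/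
theorem ext_tor_vanishing_of_isEZDPair
    (R : Type u) [CommRing R] [IsNoetherianRing R] (x y : R)
    (hxy : IsEZDPair R R x y)
    (M : Type u) [AddCommGroup M] [Module R M] :
    (IsEZDPair R M x y → ∀ i : ℕ, 0 < i →
      Subsingleton (extRMod R (ModuleCat.of R (R ⧸ Ideal.span {x})) (ModuleCat.of R M) i)) ∧
    ((∀ i : ℕ, 0 < i →
        Subsingleton (extRMod R (ModuleCat.of R (R ⧸ Ideal.span {x})) (ModuleCat.of R M) i)) ↔
      (∀ i : ℕ, 0 < i →
        Subsingleton (torRMod R (ModuleCat.of R (R ⧸ Ideal.span {x})) (ModuleCat.of R M) i))) ∧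
    (Ideal.span {x} • (⊤ : Submodule R M) ≠ ⊤ → (∃ m : M, x • m ≠ 0) →
      (∀ i : ℕ, 0 < i →
        Subsingleton (extRMod R (ModuleCat.of R (R ⧸ Ideal.span {x})) (ModuleCat.of R M) i)) →
      IsEZDPair R M x y) := by
  rw [forall_subsingleton_extRMod_iff x y hxy, forall_subsingleton_torRMod_iff x y hxy]
  exact ⟨fun h => h.2.2, Iff.rfl, fun h1 h2 h => ⟨h1, h2, h⟩⟩
end

section
/- Let R be a commutative Noetherian ring and M an R-module, and let x_1, …, x_n be a sequence of exact zero-divisors on both R and M with the same twins y_1, …, y_n respectively. Set R̄ = R/(x_1, …, x_n) and M̄ = M/(x_1, …, x_n)M, and let N be an R̄-module. Then for all i ≥ 0: (i) Ext^i_R(N, M) ≅ Ext^i_{R̄}(N, M̄); (ii) Ext^i_R(M, N) ≅ Ext^i_{R̄}(M̄, N); (iii) Tor^R_i(M, N) ≅ Tor^{R̄}_i(M̄, N). -/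
universe u

section ChangeOfRings

open CategoryTheory

/-- A surjection from the cycles of a short complex of modules which kills exactly the boundaries
identifies the homology. -/
lemma CategoryTheory.ShortComplex.nonempty_homology_addEquiv {R : Type u} [Ring R]
    (S : ShortComplex (ModuleCat.{u} R)) {E : Type*} [AddCommGroup E]
    (ψ : LinearMap.ker S.g.hom →+ E) (hψ : Function.Surjective ψ)
    (hker : ∀ z, ψ z = 0 ↔ ∃ w, S.f w = z.1) : Nonempty (S.homology ≃+ E) := by
  have hle : (LinearMap.range S.moduleCatToCycles).toAddSubgroup = ψ.ker := by
    ext z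
    simp only [Submodule.mem_toAddSubgroup, LinearMap.mem_range, AddMonoidHom.mem_ker, hker]
    refine exists_congr fun w ↦ ?_
    rw [Subtype.ext_iff]
    rfl
  exact ⟨S.moduleCatHomologyIso.toLinearEquiv.toAddEquiv.trans
    ((QuotientAddGroup.quotientAddEquivOfEq hle).trans
      (QuotientAddGroup.quotientKerEquivOfSurjective ψ hψ))⟩

lemma CategoryTheory.ProjectiveResolution.extMk_eq_zero_iff_of_zero {C : Type*} [Category C]
    [Abelian C] [HasExt C] {X Y : C} (P : ProjectiveResolution X) (f : P.complex.X 0 ⟶ Y) (m : ℕ)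
    (hm : 0 + 1 = m) (hf : P.complex.d m 0 ≫ f = 0) :
    P.extMk f m hm hf = 0 ↔ f = 0 := by
  refine ⟨fun h ↦ ?_, fun h ↦ by subst h; simp⟩
  rw [← P.extEquivCohomologyClass.apply_eq_iff_eq, P.extEquivCohomologyClass_extMk,
    P.extEquivCohomologyClass_zero,
    CochainComplex.HomComplex.CohomologyClass.mk_eq_zero_iff,
    CochainComplex.HomComplex.Cocycle.toSingleMk_mem_coboundaries_iff _ _ _ _ _ 1 (by lia)] at h
  obtain ⟨g, hg⟩ := h
  have : Limits.IsZero (P.cochainComplex.X 1) := P.cochainComplex.isZero_of_isStrictlyLE 0 1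
  rw [this.eq_of_src g 0, Limits.comp_zero] at hg
  rw [← cancel_epi (P.cochainComplexXIso (-(0 : ℕ)) 0 rfl).hom, ← hg, Limits.comp_zero]

lemma nonempty_ext_addEquiv_abelianExt {R : Type u} [CommRing R] (X Y : ModuleCat.{u} R) (n : ℕ) :
    Nonempty (((Ext R (ModuleCat.{u} R) n).obj (Opposite.op X)).obj Y ≃+
      Abelian.Ext.{u} X Y n) := by
  let P := projectiveResolution X
  obtain ⟨e⟩ := ShortComplex.nonempty_homology_addEquiv ((P.complex.linearYonedaObj R Y).sc n)
    (E := Abelian.Ext.{u} X Y n)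
    { toFun z := P.extMk (show P.complex.X n ⟶ Y from z.1) ((ComplexShape.up ℕ).next n) (by simp)
        (show P.complex.d _ _ ≫ _ = 0 from z.2)
      map_zero' := P.extMk_zero _ _
      map_add' x y := (P.add_extMk _ _ _ _ x.2 y.2).symm }
    (fun α ↦ by
      obtain ⟨f, hf, rfl⟩ := P.extMk_surjective α ((ComplexShape.up ℕ).next n) (by simp)
      exact ⟨⟨f, hf⟩, rfl⟩)
    (fun z ↦ by
      obtain ⟨f, hf⟩ := z
      change P.complex.X n ⟶ Y at f
      replace hf : P.complex.d ((ComplexShape.up ℕ).next n) n ≫ f = 0 := hf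
      change P.extMk f _ (by simp) hf = 0 ↔ ∃ w, P.complex.d n ((ComplexShape.up ℕ).prev n) ≫ w = f
      cases n with
      | zero =>
        rw [P.extMk_eq_zero_iff_of_zero]
        simp [eq_comm]
      | succ n => exact P.extMk_eq_zero_iff _ _ _ _ _ (by simp))
  exact ⟨(P.isoExt n Y).toLinearEquiv.toAddEquiv.trans e⟩

section AdjunctionExt

open Limits Abelian

universe w w' v v' u₁ u₂

variable {C : Type u₁} [Category.{v} C] [Abelian C] [HasExt.{w} C]
  {D : Type u₂} [Category.{v'} D] [Abelian D] [HasExt.{w'} D]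

namespace CategoryTheory.Adjunction

/-- The map `Ext N (G M) ⟶ Ext (F N) M` induced by an adjunction `F ⊣ G` with `F` exact. -/
noncomputable def extHomOfLeftExact {F : C ⥤ D} {G : D ⥤ C} (adj : F ⊣ G) [F.Additive]
    [PreservesFiniteLimits F] [PreservesFiniteColimits F] (N : C) (M : D) (n : ℕ) :
    Ext N (G.obj M) n →+ Ext (F.obj N) M n :=
  ((Ext.mk₀ (adj.counit.app M)).postcomp (F.obj N) (add_zero n)).comp (F.mapExtAddHom _ _ n)

/-- The map `Ext (F M) N ⟶ Ext M (G N)` induced by an adjunction `F ⊣ G` with `G` exact. -/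
noncomputable def extHomOfRightExact {F : C ⥤ D} {G : D ⥤ C} (adj : F ⊣ G) [G.Additive]
    [PreservesFiniteLimits G] [PreservesFiniteColimits G] (M : C) (N : D) (n : ℕ) :
    Ext (F.obj M) N n →+ Ext M (G.obj N) n :=
  ((Ext.mk₀ (adj.unit.app M)).precomp (G.obj N) (zero_add n)).comp (G.mapExtAddHom _ _ n)

variable {F : C ⥤ D} {G : D ⥤ C} (adj : F ⊣ G)

lemma extHomOfLeftExact_apply [F.Additive] [PreservesFiniteLimits F]
    [PreservesFiniteColimits F] (N : C) (M : D) {n : ℕ} (x : Ext N (G.obj M) n) :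
    adj.extHomOfLeftExact N M n x =
      (x.mapExactFunctor F).comp (Ext.mk₀ (adj.counit.app M)) (add_zero n) := rfl

lemma extHomOfRightExact_apply [G.Additive] [PreservesFiniteLimits G]
    [PreservesFiniteColimits G] (M : C) (N : D) {n : ℕ} (x : Ext (F.obj M) N n) :
    adj.extHomOfRightExact M N n x =
      (Ext.mk₀ (adj.unit.app M)).comp (x.mapExactFunctor G) (zero_add n) := rfl

lemma extHomOfLeftExact_comp_mk₀ [F.Additive] [PreservesFiniteLimits F]
    [PreservesFiniteColimits F] (N : C) {M M' : D} (g : M ⟶ M') {n : ℕ} (x : Ext N (G.obj M) n) :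
    adj.extHomOfLeftExact N M' n (x.comp (Ext.mk₀ (G.map g)) (add_zero n)) =
      (adj.extHomOfLeftExact N M n x).comp (Ext.mk₀ g) (add_zero n) := by
  rw [extHomOfLeftExact_apply, extHomOfLeftExact_apply, Ext.mapExactFunctor_comp,
    Ext.mapExactFunctor_mk₀, Ext.comp_assoc_of_third_deg_zero,
    Ext.comp_assoc_of_third_deg_zero, Ext.mk₀_comp_mk₀, Ext.mk₀_comp_mk₀]
  exact congrArg (fun f ↦ (x.mapExactFunctor F).comp (Ext.mk₀ f) _) (adj.counit_naturality g)

lemma extHomOfLeftExact_comp_extClass [F.Additive] [G.Additive] [PreservesFiniteLimits F]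
    [PreservesFiniteColimits F] (N : C) {S : ShortComplex D} (hS : S.ShortExact)
    (hSG : (S.map G).ShortExact) {n : ℕ} (x : Ext N (G.obj S.X₃) n) :
    adj.extHomOfLeftExact N S.X₁ (n + 1) (x.comp hSG.extClass rfl) =
      (adj.extHomOfLeftExact N S.X₃ n x).comp hS.extClass rfl := by
  have hφ := ShortComplex.ShortExact.extClass_naturality (hSG.map_of_exact F) hS
    { τ₁ := adj.counit.app _
      τ₂ := adj.counit.app _
      τ₃ := adj.counit.app _
      comm₁₂ := (adj.counit_naturality S.f).symm
      comm₂₃ := (adj.counit_naturality S.g).symm }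
  refine (congrArg (fun e ↦ e.comp (Ext.mk₀ (adj.counit.app S.X₁)) (add_zero _))
    ((Ext.mapExactFunctor_comp F x hSG.extClass rfl).trans
      (congrArg (fun e ↦ (x.mapExactFunctor F).comp e rfl)
        (Ext.mapExactFunctor_extClass F hSG)))).trans ?_
  refine (Ext.comp_assoc_of_third_deg_zero _ _ _ _).trans
    (Eq.trans ?_ (Ext.comp_assoc_of_second_deg_zero _ _ _ _).symm)
  exact congrArg (fun e ↦ (x.mapExactFunctor F).comp e rfl) hφ

lemma extHomOfRightExact_mk₀_comp [G.Additive] [PreservesFiniteLimits G]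
    [PreservesFiniteColimits G] {M M' : C} (g : M ⟶ M') (N : D) {n : ℕ}
    (x : Ext (F.obj M') N n) :
    adj.extHomOfRightExact M N n ((Ext.mk₀ (F.map g)).comp x (zero_add n)) =
      (Ext.mk₀ g).comp (adj.extHomOfRightExact M' N n x) (zero_add n) := by
  rw [extHomOfRightExact_apply, extHomOfRightExact_apply, Ext.mapExactFunctor_comp,
    Ext.mapExactFunctor_mk₀, ← Ext.comp_assoc_of_second_deg_zero,
    ← Ext.comp_assoc_of_second_deg_zero, Ext.mk₀_comp_mk₀, Ext.mk₀_comp_mk₀]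
  exact congrArg (fun f ↦ (Ext.mk₀ f).comp (x.mapExactFunctor G) _) (adj.unit_naturality g)

lemma extHomOfRightExact_extClass_comp [F.Additive] [G.Additive] [PreservesFiniteLimits G]
    [PreservesFiniteColimits G] {S : ShortComplex C} (hS : S.ShortExact)
    (hSF : (S.map F).ShortExact) (N : D) {n : ℕ} (x : Ext (F.obj S.X₁) N n) :
    adj.extHomOfRightExact S.X₃ N (n + 1) (hSF.extClass.comp x (add_comm 1 n)) =
      hS.extClass.comp (adj.extHomOfRightExact S.X₁ N n x) (add_comm 1 n) := by
  have hφ := ShortComplex.ShortExact.extClass_naturality hS (hSF.map_of_exact G)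
    { τ₁ := adj.unit.app _
      τ₂ := adj.unit.app _
      τ₃ := adj.unit.app _
      comm₁₂ := adj.unit_naturality S.f
      comm₂₃ := adj.unit_naturality S.g }
  refine (congrArg (fun e ↦ (Ext.mk₀ (adj.unit.app S.X₃)).comp e (zero_add _))
    ((Ext.mapExactFunctor_comp G hSF.extClass x (add_comm 1 n)).trans
      (congrArg (fun e ↦ e.comp (x.mapExactFunctor G) (add_comm 1 n))
        (Ext.mapExactFunctor_extClass G hSF)))).trans ?_
  refine (Ext.comp_assoc _ _ _ (zero_add 1) (add_comm 1 n) (by lia)).symm.trans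
    (Eq.trans ?_ (Ext.comp_assoc_of_second_deg_zero _ _ _ _))
  exact congrArg (fun e ↦ e.comp (x.mapExactFunctor G) (add_comm 1 n)) hφ.symm

attribute [local instance] Ext.subsingleton_of_injective in
/-- For an adjunction `F ⊣ G` with `F` exact, the comparison map on `Ext` is bijective on a class
of objects having injective copresentations in the class which `G` keeps exact. -/
lemma extHomOfLeftExact_bijective [F.Additive] [G.Additive]
    [PreservesFiniteLimits F] [PreservesFiniteColimits F] (Good : D → Prop)
    (hGood : ∀ M, Good M → ∃ (I K : D) (f : M ⟶ I) (g : I ⟶ K) (w : f ≫ g = 0),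
      Injective I ∧ Good I ∧ Good K ∧ (ShortComplex.mk f g w).ShortExact ∧
      ((ShortComplex.mk f g w).map G).ShortExact)
    (N : C) (M : D) (hM : Good M) (n : ℕ) :
    Function.Bijective (adj.extHomOfLeftExact N M n) := by
  induction n generalizing M with
  | zero =>
    have : ⇑(adj.extHomOfLeftExact N M 0) =
        Ext.homEquiv₀.symm ∘ (adj.homEquiv N M).symm ∘ Ext.homEquiv₀ := by
      ext x
      obtain ⟨y, rfl⟩ := Ext.homEquiv₀.symm.surjective x
      simp [extHomOfLeftExact_apply, Ext.mapExactFunctor_mk₀, Ext.homEquiv₀, Adjunction.homEquiv_counit]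
    rw [this]
    exact Ext.homEquiv₀.symm.bijective.comp
      ((adj.homEquiv N M).symm.bijective.comp Ext.homEquiv₀.bijective)
  | succ n hn =>
    obtain ⟨I, K, f, g, w, hI, hGI, hGK, hS, hSG⟩ := hGood M hM
    have : Injective (G.obj I) := Injective.injective_of_adjoint adj I
    refine AddMonoidHom.bijective_of_surjective_of_bijective_of_right_exact _ _ _ _
      (adj.extHomOfLeftExact N I n) (adj.extHomOfLeftExact N K n)
      (adj.extHomOfLeftExact N M (n + 1)) ?_ ?_
      ((ShortComplex.ab_exact_iff_function_exact _).mp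
        (Ext.covariant_sequence_exact₃' N hSG n (n + 1) rfl))
      ((ShortComplex.ab_exact_iff_function_exact _).mp
        (Ext.covariant_sequence_exact₃' (F.obj N) hS n (n + 1) rfl))
      (hn I hGI).surjective (hn K hGK)
      (fun x₁ ↦ Ext.covariant_sequence_exact₁ _ hSG x₁
        (Subsingleton.elim (α := Ext N (G.obj I) (n + 1)) _ _) rfl)
      (fun y₁ ↦ Ext.covariant_sequence_exact₁ _ hS y₁
        (Subsingleton.elim (α := Ext (F.obj N) I (n + 1)) _ _) rfl)
    · ext x
      exact (adj.extHomOfLeftExact_comp_mk₀ N g x).symm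
    · ext x
      exact (adj.extHomOfLeftExact_comp_extClass N hS hSG x).symm

attribute [local instance] Ext.subsingleton_of_projective in
/-- For an adjunction `F ⊣ G` with `G` exact, the comparison map on `Ext` is bijective on a class
of objects having projective presentations in the class which `F` keeps exact. -/
lemma extHomOfRightExact_bijective [F.Additive] [G.Additive]
    [PreservesFiniteLimits G] [PreservesFiniteColimits G] (Good : C → Prop)
    (hGood : ∀ M, Good M → ∃ (K P : C) (f : K ⟶ P) (g : P ⟶ M) (w : f ≫ g = 0),
      Projective P ∧ Good P ∧ Good K ∧ (ShortComplex.mk f g w).ShortExact ∧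
      ((ShortComplex.mk f g w).map F).ShortExact)
    (N : D) (M : C) (hM : Good M) (n : ℕ) :
    Function.Bijective (adj.extHomOfRightExact M N n) := by
  induction n generalizing M with
  | zero =>
    have : ⇑(adj.extHomOfRightExact M N 0) =
        Ext.homEquiv₀.symm ∘ adj.homEquiv M N ∘ Ext.homEquiv₀ := by
      ext x
      obtain ⟨y, rfl⟩ := Ext.homEquiv₀.symm.surjective x
      simp [extHomOfRightExact_apply, Ext.mapExactFunctor_mk₀, Ext.homEquiv₀, Adjunction.homEquiv_unit]
    rw [this]
    exact Ext.homEquiv₀.symm.bijective.comp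
      ((adj.homEquiv M N).bijective.comp Ext.homEquiv₀.bijective)
  | succ n hn =>
    obtain ⟨K, P, f, g, w, hP, hGP, hGK, hS, hSF⟩ := hGood M hM
    have : Projective (F.obj P) := adj.map_projective P hP
    refine AddMonoidHom.bijective_of_surjective_of_bijective_of_right_exact _ _ _ _
      (adj.extHomOfRightExact P N n) (adj.extHomOfRightExact K N n)
      (adj.extHomOfRightExact M N (n + 1)) ?_ ?_
      ((ShortComplex.ab_exact_iff_function_exact _).mp
        (Ext.contravariant_sequence_exact₁' hSF N n (n + 1) (add_comm 1 n)))
      ((ShortComplex.ab_exact_iff_function_exact _).mp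
        (Ext.contravariant_sequence_exact₁' hS (G.obj N) n (n + 1) (add_comm 1 n)))
      (hn P hGP).surjective (hn K hGK)
      (fun x₃ ↦ Ext.contravariant_sequence_exact₃ hSF _ x₃
        (Subsingleton.elim (α := Ext (F.obj P) N (n + 1)) _ _) (add_comm 1 n))
      (fun y₃ ↦ Ext.contravariant_sequence_exact₃ hS _ y₃
        (Subsingleton.elim (α := Ext P (G.obj N) (n + 1)) _ _) (add_comm 1 n))
    · ext x
      exact (adj.extHomOfRightExact_mk₀_comp f N x).symm
    · ext x
      exact (adj.extHomOfRightExact_extClass_comp hS hSF N x).symm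

end CategoryTheory.Adjunction

end AdjunctionExt

/-- Every element of `M` which is killed by one of `x` and `y` is a multiple of the other one. -/
structure IsExactMulPair {A : Type*} [CommRing A] (M : Type*) [AddCommGroup M] [Module A M]
    (x y : A) : Prop where
  exists_eq_smul_right : ∀ m : M, x • m = 0 → ∃ m' : M, m = y • m'
  exists_eq_smul_left : ∀ m : M, y • m = 0 → ∃ m' : M, m = x • m'

namespace IsExactMulPair

section

variable {A : Type*} [CommRing A] {x y : A} {M₁ M₂ M₃ : Type*} [AddCommGroup M₁] [AddCommGroup M₂]
  [AddCommGroup M₃] [Module A M₁] [Module A M₂] [Module A M₃]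

lemma symm (h : IsExactMulPair M₁ x y) : IsExactMulPair M₁ y x :=
  ⟨h.exists_eq_smul_left, h.exists_eq_smul_right⟩

protected lemma finsupp (h : IsExactMulPair A x y) (ι : Type*) : IsExactMulPair (ι →₀ A) x y := by
  have aux : ∀ {x y : A}, (∀ a : A, x • a = 0 → ∃ b, a = y • b) →
      ∀ m : ι →₀ A, x • m = 0 → ∃ m', m = y • m' := by
    classical
    intro x y h m hm
    have (i : ι) : ∃ b, m i = y • b := h _ (by simpa using DFunLike.congr_fun hm i)
    choose b hb using this
    refine ⟨Finsupp.onFinset m.support (fun i ↦ if m i = 0 then 0 else b i) (by simp +contextual),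
      Finsupp.ext fun i ↦ ?_⟩
    by_cases hi : m i = 0
    · simp [hi]
    · simpa [hi] using hb i
  exact ⟨aux h.exists_eq_smul_right, aux h.exists_eq_smul_left⟩

variable {f : M₁ →ₗ[A] M₂} {g : M₂ →ₗ[A] M₃}

private lemma exists_eq_smul_of_exact_left (hxy : x * y = 0) (hf : Function.Injective f)
    (hfg : Function.Exact f g) (hg : Function.Surjective g)
    (h₂ : IsExactMulPair M₂ x y) (h₃ : IsExactMulPair M₃ x y) (m : M₁) (hm : x • m = 0) :
    ∃ m', m = y • m' := by
  obtain ⟨p, hp⟩ := h₂.exists_eq_smul_right (f m) (by rw [← map_smul, hm, map_zero])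
  obtain ⟨q, hq⟩ := h₃.exists_eq_smul_left (g p) (by
    rw [← map_smul, ← hp, hfg.apply_apply_eq_zero])
  obtain ⟨q, rfl⟩ := hg q
  obtain ⟨k, hk⟩ := (hfg (p - x • q)).1 (by simp [hq])
  exact ⟨k, hf (by rw [map_smul, hk, smul_sub, ← hp, smul_smul, mul_comm, hxy, zero_smul, sub_zero])⟩

lemma of_exact_left (hxy : x * y = 0) (hf : Function.Injective f)
    (hfg : Function.Exact f g) (hg : Function.Surjective g)
    (h₂ : IsExactMulPair M₂ x y) (h₃ : IsExactMulPair M₃ x y) : IsExactMulPair M₁ x y :=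
  ⟨exists_eq_smul_of_exact_left hxy hf hfg hg h₂ h₃,
    exists_eq_smul_of_exact_left (mul_comm x y ▸ hxy) hf hfg hg h₂.symm h₃.symm⟩

lemma exists_eq_smul_of_map_eq_smul (hxy : x * y = 0) (hf : Function.Injective f)
    (hfg : Function.Exact f g) (hg : Function.Surjective g) (h₃ : IsExactMulPair M₃ x y)
    {m : M₁} {p : M₂} (hm : f m = x • p) : ∃ m', m = x • m' := by
  obtain ⟨q, hq⟩ := h₃.exists_eq_smul_right (g p) (by
    rw [← map_smul, ← hm, hfg.apply_apply_eq_zero])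
  obtain ⟨q, rfl⟩ := hg q
  obtain ⟨k, hk⟩ := (hfg (p - y • q)).1 (by simp [hq])
  exact ⟨k, hf (by rw [map_smul, hk, smul_sub, ← hm, smul_smul, hxy, zero_smul, sub_zero])⟩

lemma exists_map_eq_of_smul_eq_zero (hxy : x * y = 0) (hg : Function.Surjective g)
    (h₃ : IsExactMulPair M₃ x y) {c : M₃} (hc : x • c = 0) : ∃ p, x • p = 0 ∧ g p = c := by
  obtain ⟨c, rfl⟩ := h₃.exists_eq_smul_right c hc
  obtain ⟨p, rfl⟩ := hg c
  exact ⟨y • p, by rw [smul_smul, hxy, zero_smul], map_smul _ _ _⟩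

private lemma exists_eq_smul_of_exact_right (hxy : x * y = 0) (hf : Function.Injective f)
    (hfg : Function.Exact f g) (hg : Function.Surjective g)
    (h₁ : IsExactMulPair M₁ x y) (h₂ : IsExactMulPair M₂ x y) (m : M₃) (hm : x • m = 0) :
    ∃ m', m = y • m' := by
  obtain ⟨p, rfl⟩ := hg m
  obtain ⟨k, hk⟩ := (hfg (x • p)).1 (by rw [map_smul, hm])
  obtain ⟨l, rfl⟩ := h₁.exists_eq_smul_left k
    (hf (by rw [map_smul, hk, smul_smul, mul_comm, hxy, zero_smul, map_zero]))
  obtain ⟨q, hq⟩ := h₂.exists_eq_smul_right (p - f l) (by rw [smul_sub, ← hk, map_smul, sub_self])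
  exact ⟨g q, by rw [← map_smul, ← hq, map_sub, hfg.apply_apply_eq_zero, sub_zero]⟩

lemma of_exact_right (hxy : x * y = 0) (hf : Function.Injective f)
    (hfg : Function.Exact f g) (hg : Function.Surjective g)
    (h₁ : IsExactMulPair M₁ x y) (h₂ : IsExactMulPair M₂ x y) : IsExactMulPair M₃ x y :=
  ⟨exists_eq_smul_of_exact_right hxy hf hfg hg h₁ h₂,
    exists_eq_smul_of_exact_right (mul_comm x y ▸ hxy) hf hfg hg h₁.symm h₂.symm⟩

end

lemma of_injective {A : Type u} [CommRing A] {x y : A} (h : IsExactMulPair A x y)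
    (I : Type u) [AddCommGroup I] [Module A I] [Module.Injective A I] : IsExactMulPair I x y := by
  have aux : ∀ {x y : A}, (∀ a : A, y • a = 0 → ∃ b, a = x • b) →
      ∀ i : I, x • i = 0 → ∃ j, i = y • j := by
    intro x y h i hi
    let φ : A →ₗ[A] A := LinearMap.toSpanSingleton A A y
    obtain ⟨e, he⟩ := Module.Injective.out ((LinearMap.ker φ).liftQ φ le_rfl)
      (LinearMap.ker_eq_bot.1 (Submodule.ker_liftQ_eq_bot _ _ _ le_rfl))
      ((LinearMap.ker φ).liftQ (LinearMap.toSpanSingleton A I i) (fun a ha ↦ by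
        obtain ⟨b, rfl⟩ := h a (by simpa [φ, mul_comm] using ha)
        simp [mul_comm x b, mul_smul, hi]))
    refine ⟨e 1, ?_⟩
    have := he (Submodule.Quotient.mk 1)
    rw [Submodule.liftQ_apply, Submodule.liftQ_apply] at this
    rw [← map_smul]
    simpa [φ] using this.symm
  exact ⟨aux h.exists_eq_smul_left, aux h.exists_eq_smul_right⟩

end IsExactMulPair

lemma nonempty_linearEquiv_of_semilinear {A B : Type*} [CommRing A] [CommRing B] {σ : A →+* B}
    (hσ : Function.Surjective σ) {M M₁ M₂ : Type*} [AddCommGroup M] [AddCommGroup M₁]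
    [AddCommGroup M₂] [Module A M] [Module B M₁] [Module B M₂] (f : M →ₛₗ[σ] M₁) (g : M →ₛₗ[σ] M₂)
    (hf : Function.Surjective f) (hg : Function.Surjective g) (h : ∀ m, f m = 0 ↔ g m = 0) :
    Nonempty (M₁ ≃ₗ[B] M₂) := by
  let e : M₁ ≃+ M₂ := (QuotientAddGroup.quotientKerEquivOfSurjective f.toAddMonoidHom hf).symm.trans
    ((QuotientAddGroup.quotientAddEquivOfEq (AddSubgroup.ext h)).trans
      (QuotientAddGroup.quotientKerEquivOfSurjective g.toAddMonoidHom hg))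
  have he (m : M) : e (f m) = g m := by
    have : (QuotientAddGroup.quotientKerEquivOfSurjective f.toAddMonoidHom hf).symm (f m) =
        QuotientAddGroup.mk m := (AddEquiv.symm_apply_eq _).2 rfl
    simp only [e, AddEquiv.trans_apply, this]
    rfl
  refine ⟨e.toLinearEquiv fun b m ↦ ?_⟩
  obtain ⟨a, rfl⟩ := hσ b
  obtain ⟨m, rfl⟩ := hf m
  rw [← map_smulₛₗ, he, he, map_smulₛₗ]

section OneStep

open Limits ModuleCat

variable {A B : Type u} [CommRing A] [CommRing B] {σ : A →+* B} {x y : A}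

variable (σ) in
/-- Evaluation at `1` of an element of the coextension of scalars. -/
noncomputable def coextendScalarsEval (M : ModuleCat.{u} A) : (coextendScalars σ).obj M →+ M :=
  (LinearMap.applyₗ (show (restrictScalars σ).obj (of B B) from (1 : B))).toAddMonoidHom.comp
    (CoextendScalars.equiv σ M).toLinearMap.toAddMonoidHom

lemma coextendScalarsEval_smul (M : ModuleCat.{u} A) (q : (coextendScalars σ).obj M) (a : A) :
    coextendScalarsEval σ M (σ a • q) = a • coextendScalarsEval σ M q := by
  refine Eq.trans ?_ ((CoextendScalars.equiv σ M q).map_smul a (show B from 1))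
  change CoextendScalars.equiv σ M q ((1 : B) * σ a) = CoextendScalars.equiv σ M q (σ a * (1 : B))
  rw [mul_comm]

lemma coextendScalars_ext (hσ : Function.Surjective σ) {M : ModuleCat.{u} A}
    {q q' : (coextendScalars σ).obj M}
    (h : coextendScalarsEval σ M q = coextendScalarsEval σ M q') : q = q' := by
  refine (CoextendScalars.equiv σ M).injective (LinearMap.ext fun b ↦ ?_)
  obtain ⟨a, rfl⟩ := hσ b
  have (p : (coextendScalars σ).obj M) :
      CoextendScalars.equiv σ M p (σ a) = a • coextendScalarsEval σ M p := by
    rw [← coextendScalarsEval_smul]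
    change CoextendScalars.equiv σ M p (σ a) = CoextendScalars.equiv σ M p ((1 : B) * σ a)
    rw [one_mul]
  rw [this, this, h]

lemma exists_coextendScalarsEval_eq (hσ : Function.Surjective σ)
    (hker : RingHom.ker σ = Ideal.span {x}) {M : ModuleCat.{u} A} {m : M} (hm : x • m = 0) :
    ∃ q : (coextendScalars σ).obj M, coextendScalarsEval σ M q = m := by
  let φ := AddMonoidHom.liftOfSurjective σ.toAddMonoidHom hσ
    ⟨(LinearMap.toSpanSingleton A M m).toAddMonoidHom, fun a ha ↦ by
      obtain ⟨b, rfl⟩ := Ideal.mem_span_singleton'.1 (hker.le ha)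
      simp [mul_smul, hm]⟩
  have hφ (a : A) : φ (σ a) = a • m := AddMonoidHom.liftOfRightInverse_comp_apply _ _ _ _ _
  refine ⟨(CoextendScalars.equiv σ M).symm { φ with map_smul' := fun a b ↦ ?_ }, ?_⟩
  · obtain ⟨b, rfl⟩ := hσ b
    change φ (σ a * σ b) = a • φ (σ b)
    rw [← map_mul, hφ, hφ, mul_smul]
  · change φ 1 = m
    rw [← map_one σ, hφ, one_smul]

lemma smul_coextendScalarsEval_eq_zero (hker : RingHom.ker σ = Ideal.span {x})
    {M : ModuleCat.{u} A} (q : (coextendScalars σ).obj M) :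
    x • coextendScalarsEval σ M q = 0 := by
  have : σ x = 0 := hker.ge (Ideal.mem_span_singleton_self x)
  rw [← coextendScalarsEval_smul, this]
  simp

lemma nonempty_linearEquiv_coextendScalars (hxy : x * y = 0) (hσ : Function.Surjective σ)
    (hker : RingHom.ker σ = Ideal.span {x}) {M : ModuleCat.{u} A} (hM : IsExactMulPair M x y)
    {M' : Type u} [AddCommGroup M'] [Module B M'] (f : M →ₛₗ[σ] M')
    (hf : Function.Surjective f) (hf₀ : ∀ m, f m = 0 ↔ ∃ m', m = x • m') :
    Nonempty (((coextendScalars σ).obj M) ≃ₗ[B] M') := by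
  have (m : M) : ∃ q : (coextendScalars σ).obj M, coextendScalarsEval σ M q = y • m :=
    exists_coextendScalarsEval_eq hσ hker (by rw [smul_smul, hxy, zero_smul])
  choose g hg using this
  refine nonempty_linearEquiv_of_semilinear hσ (M := M)
    { toFun := g
      map_add' m m' := coextendScalars_ext hσ (by
        rw [map_add, hg, hg, hg, smul_add])
      map_smul' a m := coextendScalars_ext hσ (by
        rw [coextendScalarsEval_smul, hg, hg, smul_comm]) } f
    (fun q ↦ ?_) hf (fun m ↦ ?_)
  · obtain ⟨m, hm⟩ := hM.exists_eq_smul_right _ (smul_coextendScalarsEval_eq_zero hker q)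
    exact ⟨m, coextendScalars_ext hσ (by rw [hm]; exact hg m)⟩
  · rw [hf₀]
    change g m = 0 ↔ _
    constructor
    · intro h
      exact hM.exists_eq_smul_left _ (by rw [← hg, h]; simp)
    · rintro ⟨m, rfl⟩
      refine coextendScalars_ext hσ ?_
      rw [hg, smul_smul, mul_comm, hxy]
      simp

lemma restrictCoextendScalarsAdj_bijective (hxy : x * y = 0) (hσ : Function.Surjective σ)
    (hker : RingHom.ker σ = Ideal.span {x}) (hA : IsExactMulPair A x y) {M : ModuleCat.{u} A}
    (hM : IsExactMulPair M x y) (N : ModuleCat.{u} B) (n : ℕ) :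
    Function.Bijective ((restrictCoextendScalarsAdj σ).extHomOfLeftExact N M n) := by
  have : (coextendScalars.{u, u, u} σ).Additive := (restrictCoextendScalarsAdj σ).right_adjoint_additive
  refine Adjunction.extHomOfLeftExact_bijective _ (fun M : ModuleCat.{u} A ↦ IsExactMulPair M x y)
    (fun M hM ↦ ?_) N M hM n
  let I : ModuleCat.{u} A := Injective.under M
  let f : M →ₗ[A] I := (Injective.ι M).hom
  have hf : Function.Injective f := (ModuleCat.mono_iff_injective _).1 inferInstance
  let g := (LinearMap.range f).mkQ
  have hfg : Function.Exact f g := LinearMap.exact_map_mkQ_range f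
  have hg : Function.Surjective g := Submodule.mkQ_surjective _
  have hI : IsExactMulPair I x y :=
    have := (Module.injective_iff_injective_object A I).mpr (Injective.injective_under M)
    hA.of_injective _
  have hK := IsExactMulPair.of_exact_right hxy hf hfg hg hM hI
  let S : ShortComplex (ModuleCat.{u} A) := .mk (Injective.ι M) (ofHom g)
    (by ext m; exact hfg.apply_apply_eq_zero m)
  have hS : S.ShortExact := ModuleCat.shortComplex_shortExact S hfg hf hg
  refine ⟨_, _, S.f, S.g, S.zero, inferInstance, hI, hK, hS, ?_⟩
  have := hS.mono_f
  let hadj := restrictCoextendScalarsAdj.{u, u, u} σ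
  have : PreservesLimitsOfSize.{0, 0} (coextendScalars.{u, u, u} σ) :=
    hadj.rightAdjoint_preservesLimits
  have : Mono (S.map (coextendScalars σ)).f :=
    (ModuleCat.mono_iff_injective _).2 fun q q' h ↦ coextendScalars_ext hσ
      (hf (congrArg (coextendScalarsEval σ (of A I)) h))
  have : Epi (S.map (coextendScalars σ)).g := by
    refine (ModuleCat.epi_iff_surjective _).2 fun q ↦ ?_
    obtain ⟨p, hp, hpq⟩ := hK.exists_map_eq_of_smul_eq_zero hxy hg
      (smul_coextendScalarsEval_eq_zero hker q)
    obtain ⟨r, hr⟩ := exists_coextendScalarsEval_eq (M := I) hσ hker hp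
    refine ⟨r, coextendScalars_ext hσ ?_⟩
    rw [← hpq, ← hr]
    rfl
  exact ⟨hS.exact.map_of_mono_of_preservesKernel _ inferInstance inferInstance⟩


section

open scoped ChangeOfRings

variable (σ) in
/-- The canonical map from a module to its extension of scalars. -/
noncomputable def extendScalarsMk (M : ModuleCat.{u} A) : M →ₛₗ[σ] (extendScalars σ).obj M where
  toFun m := (1 : B) ⊗ₜ[A,σ] m
  map_add' := TensorProduct.tmul_add _
  map_smul' a m := by
    have (X : ModuleCat.{u} A) (z : X) : z ⊗ₜ[A] (a • m) = (a • z) ⊗ₜ[A] m :=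
      (TensorProduct.smul_tmul a z m).symm
    exact this ((restrictScalars σ).obj (of B B)) (1 : B)

lemma extendScalars_map_extendScalarsMk {M M' : ModuleCat.{u} A} (f : M ⟶ M') (m : M) :
    (extendScalars σ).map f (extendScalarsMk σ M m) = extendScalarsMk σ M' (f m) := rfl

lemma extendScalarsMk_surjective (hσ : Function.Surjective σ) (M : ModuleCat.{u} A) :
    Function.Surjective (extendScalarsMk σ M) := by
  intro t
  induction t using TensorProduct.induction_on with
  | zero => exact ⟨0, map_zero _⟩
  | tmul b m =>
    obtain ⟨a, rfl⟩ := hσ b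
    refine ⟨a • m, (map_smulₛₗ (extendScalarsMk σ M) a m).trans ?_⟩
    change (σ a * (1 : B)) ⊗ₜ[A,σ] m = σ a ⊗ₜ[A,σ] m
    rw [mul_one]
  | add s t hs ht =>
    obtain ⟨m, rfl⟩ := hs
    obtain ⟨m', rfl⟩ := ht
    exact ⟨m + m', map_add _ _ _⟩

lemma extendScalarsMk_eq_zero_iff (hσ : Function.Surjective σ)
    (hker : RingHom.ker σ = Ideal.span {x}) (M : ModuleCat.{u} A) (m : M) :
    extendScalarsMk σ M m = 0 ↔ ∃ m', m = x • m' := by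
  have hx : σ x = 0 := hker.ge (Ideal.mem_span_singleton_self x)
  constructor
  · intro h
    let φ : A →ₗ[A] (restrictScalars σ).obj (of B B) :=
      { toFun := σ, map_add' := map_add σ, map_smul' := map_mul σ }
    have hφ : Function.Exact (LinearMap.toSpanSingleton A A x) φ := fun a ↦ by
      change a ∈ RingHom.ker σ ↔ _
      rw [hker, Ideal.mem_span_singleton']
      rfl
    obtain ⟨t, ht⟩ := (rTensor_exact M hφ hσ (1 ⊗ₜ m)).1 (by
      refine Eq.trans ?_ h
      change σ 1 ⊗ₜ[A,σ] m = (1 : B) ⊗ₜ[A,σ] m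
      rw [map_one])
    obtain ⟨m', rfl⟩ := (TensorProduct.lid A M).symm.surjective t
    refine ⟨m', ?_⟩
    simpa using (congrArg (TensorProduct.lid A M) ht).symm
  · rintro ⟨m', rfl⟩
    rw [map_smulₛₗ, hx, zero_smul]

end

lemma extendScalars_map_shortExact (hxy : x * y = 0) (hσ : Function.Surjective σ)
    (hker : RingHom.ker σ = Ideal.span {x}) {S : ShortComplex (ModuleCat.{u} A)}
    (hS : S.ShortExact) (h₃ : IsExactMulPair S.X₃ x y) : (S.map (extendScalars σ)).ShortExact := by
  let hadj := extendRestrictScalarsAdj.{u, u, u} σ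
  have : PreservesColimitsOfSize.{0, 0} (extendScalars.{u, u, u} σ) :=
    hadj.leftAdjoint_preservesColimits
  have hf := hS.moduleCat_injective_f
  have := hS.epi_g
  have : Epi (S.map (extendScalars σ)).g := (ModuleCat.epi_iff_surjective _).2 fun t ↦ by
    obtain ⟨m, rfl⟩ := extendScalarsMk_surjective hσ _ t
    obtain ⟨m, rfl⟩ := hS.moduleCat_surjective_g m
    exact ⟨_, extendScalars_map_extendScalarsMk S.g m⟩
  have : Mono (S.map (extendScalars σ)).f :=
    (ModuleCat.mono_iff_injective _).2 <| (injective_iff_map_eq_zero _).2 fun t ht ↦ by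
      obtain ⟨m, rfl⟩ := extendScalarsMk_surjective hσ _ t
      obtain ⟨p, hp⟩ := (extendScalarsMk_eq_zero_iff hσ hker _ (S.f m)).1 ht
      exact (extendScalarsMk_eq_zero_iff hσ hker _ m).2
        (IsExactMulPair.exists_eq_smul_of_map_eq_smul (f := S.f.hom) (g := S.g.hom) hxy hf
          ((ShortComplex.ShortExact.moduleCat_exact_iff_function_exact S).1 hS.exact)
          hS.moduleCat_surjective_g h₃ hp)
  exact ⟨hS.exact.map_of_epi_of_preservesCokernel _ inferInstance inferInstance⟩

/-- A presentation of a module by a free module, compatible with an exact pair of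
multiplications. -/
lemma exists_free_shortExact (hxy : x * y = 0) (hA : IsExactMulPair A x y) (M : ModuleCat.{u} A)
    (hM : IsExactMulPair M x y) : ∃ (K P : ModuleCat.{u} A) (f : K ⟶ P) (g : P ⟶ M) (w : f ≫ g = 0),
      Module.Free A P ∧ IsExactMulPair P x y ∧ IsExactMulPair K x y ∧
        (ShortComplex.mk f g w).ShortExact := by
  let g : (M →₀ A) →ₗ[A] M := Finsupp.linearCombination A id
  have hg : Function.Surjective g := Finsupp.linearCombination_id_surjective A M
  have hfg : Function.Exact (LinearMap.ker g).subtype g := LinearMap.exact_subtype_ker_map g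
  have hP : IsExactMulPair (M →₀ A) x y := hA.finsupp M
  have hf := (LinearMap.ker g).injective_subtype
  exact ⟨of A (LinearMap.ker g), of A (M →₀ A), ofHom (LinearMap.ker g).subtype, ofHom g,
    by ext m; exact hfg.apply_apply_eq_zero m, inferInstance, hP,
    IsExactMulPair.of_exact_left hxy hf hfg hg hP hM, ModuleCat.shortComplex_shortExact _ hfg hf hg⟩

lemma extendRestrictScalarsAdj_bijective (hxy : x * y = 0) (hσ : Function.Surjective σ)
    (hker : RingHom.ker σ = Ideal.span {x}) (hA : IsExactMulPair A x y) {M : ModuleCat.{u} A}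
    (hM : IsExactMulPair M x y) (N : ModuleCat.{u} B) (n : ℕ) :
    Function.Bijective ((extendRestrictScalarsAdj.{u, u, u} σ).extHomOfRightExact M N n) := by
  have : (extendScalars.{u, u, u} σ).Additive := (extendRestrictScalarsAdj σ).left_adjoint_additive
  refine Adjunction.extHomOfRightExact_bijective _ (fun M : ModuleCat.{u} A ↦ IsExactMulPair M x y)
    (fun M hM ↦ ?_) N M hM n
  obtain ⟨K, P, f, g, w, hP, hP', hK, hS⟩ := exists_free_shortExact hxy hA M hM
  exact ⟨K, P, f, g, w, ModuleCat.projective_of_free (Module.Free.chooseBasis A P), hP', hK, hS,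
    extendScalars_map_shortExact hxy hσ hker hS hM⟩

variable (M : Type u) [AddCommGroup M] [Module A M] {M' : Type u} [AddCommGroup M'] [Module B M']
  (N : Type u) [AddCommGroup N] [Module A N] [Module B N]

/-- An additive equivalence between modules which is compatible with scalars is an isomorphism. -/
def moduleIsoOfAddEquiv {X Y : ModuleCat.{u} A} (e : X ≃+ Y)
    (he : ∀ (a : A) (z : X), e (a • z) = a • e z) :
    X ≅ Y :=
  (e.toLinearEquiv he).toModuleIso

/-- A module over the codomain of a ring homomorphism, seen over the domain. -/
noncomputable def restrictScalarsIsoOf (hN : ∀ (a : A) (z : N), a • z = σ a • z) :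
    of A N ≅ (restrictScalars σ).obj (of B N) :=
  moduleIsoOfAddEquiv (X := of A N) (Y := (restrictScalars σ).obj (of B N)) (AddEquiv.refl N) hN

variable {M N}

theorem nonempty_ext_addEquiv_ext_right (hxy : x * y = 0) (hσ : Function.Surjective σ)
    (hker : RingHom.ker σ = Ideal.span {x}) (hA : IsExactMulPair A x y)
    (hM : IsExactMulPair M x y) (f : M →ₛₗ[σ] M')
    (hf : Function.Surjective f) (hf₀ : ∀ m, f m = 0 ↔ ∃ m', m = x • m')
    (hN : ∀ (a : A) (z : N), a • z = σ a • z) (n : ℕ) :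
    Nonempty (((Ext A (ModuleCat.{u} A) n).obj (.op (of A N))).obj (of A M) ≃+
      ((Ext B (ModuleCat.{u} B) n).obj (.op (of B N))).obj (of B M')) := by
  obtain ⟨e⟩ := nonempty_linearEquiv_coextendScalars hxy hσ hker (M := of A M) hM f hf hf₀
  obtain ⟨e₁⟩ := nonempty_ext_addEquiv_abelianExt ((restrictScalars σ).obj (of B N)) (of A M) n
  obtain ⟨e₂⟩ := nonempty_ext_addEquiv_abelianExt (of B N) ((coextendScalars σ).obj (of A M)) n
  exact ⟨((((Ext A (ModuleCat.{u} A) n).mapIso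
      (restrictScalarsIsoOf N hN).symm.op).app (of A M)).toLinearEquiv.toAddEquiv.trans e₁).trans <|
    (AddEquiv.ofBijective _ (restrictCoextendScalarsAdj_bijective hxy hσ hker hA
      (M := of A M) hM (of B N) n)).symm.trans <|
    e₂.symm.trans <| (((Ext B (ModuleCat.{u} B) n).obj (.op (of B N))).mapIso
      (LinearEquiv.toModuleIso e)).toLinearEquiv.toAddEquiv⟩

theorem nonempty_ext_addEquiv_ext_left (hxy : x * y = 0) (hσ : Function.Surjective σ)
    (hker : RingHom.ker σ = Ideal.span {x}) (hA : IsExactMulPair A x y)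
    (hM : IsExactMulPair M x y) (f : M →ₛₗ[σ] M')
    (hf : Function.Surjective f) (hf₀ : ∀ m, f m = 0 ↔ ∃ m', m = x • m')
    (hN : ∀ (a : A) (z : N), a • z = σ a • z) (n : ℕ) :
    Nonempty (((Ext A (ModuleCat.{u} A) n).obj (.op (of A M))).obj (of A N) ≃+
      ((Ext B (ModuleCat.{u} B) n).obj (.op (of B M'))).obj (of B N)) := by
  obtain ⟨e⟩ := nonempty_linearEquiv_of_semilinear hσ f (extendScalarsMk σ (of A M)) hf
    (extendScalarsMk_surjective hσ _)
    (fun m ↦ (hf₀ m).trans (extendScalarsMk_eq_zero_iff hσ hker (of A M) m).symm)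
  obtain ⟨e₁⟩ := nonempty_ext_addEquiv_abelianExt (of A M) ((restrictScalars σ).obj (of B N)) n
  obtain ⟨e₂⟩ := nonempty_ext_addEquiv_abelianExt ((extendScalars σ).obj (of A M)) (of B N) n
  exact ⟨((((Ext A (ModuleCat.{u} A) n).obj (.op (of A M))).mapIso
      (restrictScalarsIsoOf N hN)).toLinearEquiv.toAddEquiv.trans e₁).trans <|
    (AddEquiv.ofBijective _ (extendRestrictScalarsAdj_bijective hxy hσ hker hA
      (M := of A M) hM (of B N) n)).symm.trans <|
    e₂.symm.trans <| (((Ext B (ModuleCat.{u} B) n).mapIso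
      (LinearEquiv.toModuleIso e).op).app (of B N)).toLinearEquiv.toAddEquiv⟩

end OneStep

namespace CategoryTheory.ProjectiveResolution

open HomologicalComplex

lemma exists_quasiIso_of_exact {C : Type*} [Category* C] [Abelian C] {X : C}
    (P : ProjectiveResolution X) {Y : ChainComplex C ℕ} (p : Y ⟶ (ChainComplex.single₀ C).obj X)
    [QuasiIso p] {p₀ : Y.X 0 ⟶ X} (hp₀ : p.f 0 = p₀) (_ : Epi p₀) (hd : Y.d 1 0 ≫ p₀ = 0)
    (hY : (ShortComplex.mk _ _ hd).Exact) :
    ∃ θ : P.complex ⟶ Y, QuasiIso θ := by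
  have hY' (n : ℕ) : (ShortComplex.mk _ _ (Y.d_comp_d (n + 2) (n + 1) n)).Exact := by
    refine (exactAt_iff' _ (n + 2) (n + 1) n (by simp only [ChainComplex.prev]; rfl) (by simp)).1 ?_
    rw [← quasiIsoAt_iff_exactAt' p (n + 1) (ChainComplex.exactAt_succ_single_obj _ _)]
    infer_instance
  let π₀ : P.complex.X 0 ⟶ X := P.π.f 0
  have hπ₀ : P.complex.d 1 0 ≫ π₀ = 0 := P.complex_d_comp_π_f_zero
  let f₀ : P.complex.X 0 ⟶ Y.X 0 := Projective.factorThru π₀ p₀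
  have hf₀ : f₀ ≫ p₀ = π₀ := Projective.factorThru_comp _ _
  have h₁ : (P.complex.d 1 0 ≫ f₀) ≫ p₀ = 0 := by rw [Category.assoc, hf₀, hπ₀]
  let θ : P.complex ⟶ Y := ChainComplex.mkHom _ _ f₀
    (hY.liftFromProjective (P.complex.d 1 0 ≫ f₀) h₁) (hY.liftFromProjective_comp _ h₁)
    fun n ⟨g, g', w⟩ ↦
      have h : (P.complex.d (n + 2) (n + 1) ≫ g') ≫ Y.d (n + 1) n = 0 := by
        rw [Category.assoc, w, P.complex.d_comp_d_assoc, Limits.zero_comp]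
      ⟨(hY' n).liftFromProjective _ h, (hY' n).liftFromProjective_comp _ h⟩
  have hθ : θ ≫ p = P.π := by
    refine HomologicalComplex.to_single_hom_ext ?_
    have : (θ ≫ p).f 0 = f₀ ≫ p.f 0 := by simp [θ]
    rw [this, hp₀]
    exact hf₀
  have : QuasiIso (θ ≫ p) := by rw [hθ]; infer_instance
  exact ⟨θ, quasiIso_of_comp_right θ p⟩

lemma exists_quasiIso_map {C D : Type*} [Category* C] [Category* D] [Abelian C] [Abelian D]
    (F : C ⥤ D) [F.Additive] [F.PreservesHomology] {X : C} (Q : ProjectiveResolution X)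
    (P : ProjectiveResolution (F.obj X)) :
    ∃ θ : P.complex ⟶ (F.mapHomologicalComplex _).obj Q.complex, QuasiIso θ := by
  let p : (F.mapHomologicalComplex _).obj Q.complex ⟶ (ChainComplex.single₀ D).obj (F.obj X) :=
    (F.mapHomologicalComplex _).map Q.π ≫
      (singleMapHomologicalComplex F (ComplexShape.down ℕ) 0).hom.app X
  have : QuasiIso ((F.mapHomologicalComplex (ComplexShape.down ℕ)).map Q.π) :=
    quasiIso_map_of_preservesHomology _ _
  have : QuasiIso p := inferInstanceAs (QuasiIso (_ ≫ _))
  have hp : p.f 0 = F.map (Q.π.f 0) := by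
    refine (congrArg (F.map (Q.π.f 0) ≫ ·)
      (singleMapHomologicalComplex_hom_app_self F (ComplexShape.down ℕ) 0 X)).trans ?_
    rw [ChainComplex.single₀ObjXSelf, ChainComplex.single₀ObjXSelf]
    exact (congrArg (F.map (Q.π.f 0) ≫ ·) (by simp)).trans (Category.comp_id _)
  have hepi : Epi (F.map (Q.π.f 0)) := inferInstance
  exact exists_quasiIso_of_exact P (p₀ := F.map (Q.π.f 0)) p hp hepi _ (Q.exact₀.map F)

end CategoryTheory.ProjectiveResolution

section TensorEquiv

open TensorProduct

variable {A B : Type*} [CommRing A] [CommRing B] {σ : A →+* B} {x : A}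
  {M M' Z Z' : Type*} [AddCommGroup M] [AddCommGroup M'] [AddCommGroup Z] [AddCommGroup Z']
  [Module A M] [Module B M'] [Module A Z] [Module B Z']

/-- The map on tensor products induced by semilinear maps. -/
def tensorMapOfSemilinear (f : M →ₛₗ[σ] M') (g : Z →ₛₗ[σ] Z') : M ⊗[A] Z →+ M' ⊗[B] Z' :=
  liftAddHom
    (AddMonoidHom.mk' (fun m ↦ AddMonoidHom.mk' (fun z ↦ f m ⊗ₜ[B] g z)
      fun z z' ↦ by rw [map_add, tmul_add])
      fun m m' ↦ AddMonoidHom.ext fun z ↦ by simp [add_tmul])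
    fun a m z ↦ by simp [smul_tmul]

@[simp]
lemma tensorMapOfSemilinear_tmul (f : M →ₛₗ[σ] M') (g : Z →ₛₗ[σ] Z') (m : M) (z : Z) :
    tensorMapOfSemilinear f g (m ⊗ₜ z) = f m ⊗ₜ g z := rfl

lemma tensorMapOfSemilinear_smul (f : M →ₛₗ[σ] M') (g : Z →ₛₗ[σ] Z') (a : A) (t : M ⊗[A] Z) :
    tensorMapOfSemilinear f g (a • t) = σ a • tensorMapOfSemilinear f g t := by
  induction t using TensorProduct.induction_on with
  | zero => simp
  | tmul m z => simp [smul_tmul']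
  | add s t hs ht => rw [smul_add, map_add, map_add, smul_add, hs, ht]

lemma tensorMapOfSemilinear_bijective (hσ : Function.Surjective σ) (hx : σ x = 0)
    (f : M →ₛₗ[σ] M') (hf : Function.Surjective f) (hf₀ : ∀ m, f m = 0 → ∃ m', m = x • m')
    (g : Z →ₛₗ[σ] Z') (hg : Function.Bijective g) :
    Function.Bijective (tensorMapOfSemilinear f g) := by
  have hxz (z : Z) : x • z = 0 := hg.1 (by simp [hx])
  let g' : Z' ≃+ Z := (AddEquiv.ofBijective g.toAddMonoidHom hg).symm
  have hg' (z : Z') : g (g' z) = z :=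
    (AddEquiv.ofBijective g.toAddMonoidHom hg).apply_symm_apply z
  let h₀ : M →+ Z' →+ M ⊗[A] Z :=
    AddMonoidHom.mk' (fun m ↦ AddMonoidHom.mk' (fun z ↦ m ⊗ₜ[A] g' z)
      fun z z' ↦ by rw [map_add, tmul_add])
      fun m m' ↦ AddMonoidHom.ext fun z ↦ by simp [add_tmul]
  have hh₀ : f.toAddMonoidHom.ker ≤ h₀.ker := fun m hm ↦ by
    obtain ⟨m, rfl⟩ := hf₀ m hm
    refine AddMonoidHom.ext fun z ↦ ?_
    change (x • m) ⊗ₜ[A] g' z = 0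
    rw [smul_tmul, hxz, tmul_zero]
  let h : M' →+ Z' →+ M ⊗[A] Z := f.toAddMonoidHom.liftOfSurjective hf ⟨h₀, hh₀⟩
  have hh (m : M) (z : Z) : h (f m) (g z) = m ⊗ₜ z := by
    have : h (f m) = h₀ m := AddMonoidHom.liftOfRightInverse_comp_apply _ _ _ ⟨h₀, hh₀⟩ m
    rw [this]
    change m ⊗ₜ[A] g' (g z) = _
    rw [hg.1 (hg' (g z))]
  let k : M' ⊗[B] Z' →+ M ⊗[A] Z := liftAddHom h fun b m z ↦ by
    obtain ⟨a, rfl⟩ := hσ b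
    obtain ⟨m, rfl⟩ := hf m
    obtain ⟨z, rfl⟩ := hg.2 z
    rw [← map_smulₛₗ, ← map_smulₛₗ, hh, hh, smul_tmul]
  refine ⟨Function.LeftInverse.injective (g := k) fun t ↦ ?_, fun t ↦ ?_⟩
  · induction t using TensorProduct.induction_on with
    | zero => simp
    | tmul m z => exact hh m z
    | add s t hs ht => rw [map_add, map_add, hs, ht]
  · induction t using TensorProduct.induction_on with
    | zero => exact ⟨0, map_zero _⟩
    | tmul m z =>
      obtain ⟨m, rfl⟩ := hf m
      obtain ⟨z, rfl⟩ := hg.2 z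
      exact ⟨m ⊗ₜ z, rfl⟩
    | add s t hs ht =>
      obtain ⟨s, rfl⟩ := hs
      obtain ⟨t, rfl⟩ := ht
      exact ⟨s + t, map_add _ _ _⟩

end TensorEquiv

section TorOneStep

open Limits ModuleCat MonoidalCategory

variable {A B : Type u} [CommRing A] [CommRing B] {σ : A →+* B} {x y : A}

/-- The complex obtained by tensoring a chain complex of modules with a fixed module. -/
noncomputable abbrev tensorComplex (M : ModuleCat.{u} A) :
    ChainComplex (ModuleCat.{u} A) ℕ ⥤ ChainComplex (ModuleCat.{u} A) ℕ :=
  ((tensoringLeft (ModuleCat.{u} A)).obj M).mapHomologicalComplex _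

/-- The short complex of chain complexes obtained by tensoring a short complex of modules with a
chain complex of modules. -/
noncomputable def tensorShortComplex (S : ShortComplex (ModuleCat.{u} A))
    (X : ChainComplex (ModuleCat.{u} A) ℕ) : ShortComplex (ChainComplex (ModuleCat.{u} A) ℕ) :=
  ShortComplex.mk
    ((NatTrans.mapHomologicalComplex ((tensoringLeft (ModuleCat.{u} A)).map S.f) _).app X)
    ((NatTrans.mapHomologicalComplex ((tensoringLeft (ModuleCat.{u} A)).map S.g) _).app X) (by
      ext i : 1
      exact (S.map ((tensoringLeft (ModuleCat.{u} A)).flip.obj (X.X i))).zero)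

/-- The functoriality of `tensorShortComplex` with respect to the complex. -/
noncomputable def tensorShortComplexMap (S : ShortComplex (ModuleCat.{u} A))
    {X Y : ChainComplex (ModuleCat.{u} A) ℕ} (θ : X ⟶ Y) :
    tensorShortComplex S X ⟶ tensorShortComplex S Y where
  τ₁ := (tensorComplex S.X₁).map θ
  τ₂ := (tensorComplex S.X₂).map θ
  τ₃ := (tensorComplex S.X₃).map θ
  comm₁₂ := (NatTrans.mapHomologicalComplex _ _).naturality θ
  comm₂₃ := (NatTrans.mapHomologicalComplex _ _).naturality θ

/-- Tensoring with `Z` preserves the exactness of short exact sequences of modules on which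
`(x, y)` is an exact pair. -/
def IsTensorExact (x y : A) (Z : ModuleCat.{u} A) : Prop :=
  ∀ S : ShortComplex (ModuleCat.{u} A), S.ShortExact → IsExactMulPair S.X₁ x y →
    IsExactMulPair S.X₂ x y → IsExactMulPair S.X₃ x y →
    (S.map ((tensoringLeft (ModuleCat.{u} A)).flip.obj Z)).ShortExact

lemma tensorShortComplex_shortExact {X : ChainComplex (ModuleCat.{u} A) ℕ}
    (hX : ∀ i, IsTensorExact x y (X.X i)) {S : ShortComplex (ModuleCat.{u} A)} (hS : S.ShortExact)
    (h₁ : IsExactMulPair S.X₁ x y) (h₂ : IsExactMulPair S.X₂ x y)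
    (h₃ : IsExactMulPair S.X₃ x y) : (tensorShortComplex S X).ShortExact :=
  HomologicalComplex.shortExact_of_degreewise_shortExact _ fun i ↦ hX i S hS h₁ h₂ h₃

lemma quasiIso_tensorComplex_map_of_flat (F : ModuleCat.{u} A) [Module.Flat A F]
    {X Y : ChainComplex (ModuleCat.{u} A) ℕ} (θ : X ⟶ Y) [QuasiIso θ] :
    QuasiIso ((tensorComplex F).map θ) := by
  have : PreservesFiniteLimits ((tensoringLeft (ModuleCat.{u} A)).obj F) :=
    inferInstanceAs (PreservesFiniteLimits (tensorLeft F))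
  have : PreservesFiniteColimits ((tensoringLeft (ModuleCat.{u} A)).obj F) :=
    inferInstanceAs (PreservesFiniteColimits (tensorLeft F))
  exact HomologicalComplex.quasiIso_map_of_preservesHomology _ _

open HomologicalComplex in
lemma quasiIso_tensorComplex_map (hxy : x * y = 0) (hA : IsExactMulPair A x y)
    {X Y : ChainComplex (ModuleCat.{u} A) ℕ} (θ : X ⟶ Y) [QuasiIso θ]
    (hX : ∀ i, IsTensorExact x y (X.X i)) (hY : ∀ i, IsTensorExact x y (Y.X i))
    (M : ModuleCat.{u} A) (hM : IsExactMulPair M x y) :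
    QuasiIso ((tensorComplex M).map θ) := by
  suffices ∀ (i : ℕ) (M : ModuleCat.{u} A), IsExactMulPair M x y →
      IsIso (homologyMap ((tensorComplex M).map θ) i) from
    ⟨fun i ↦ (quasiIsoAt_iff_isIso_homologyMap _ _).2 (this i M hM)⟩
  have key (i : ℕ) (h : ∀ j, (ComplexShape.down ℕ).Rel i j → ∀ M : ModuleCat.{u} A,
      IsExactMulPair M x y → IsIso (homologyMap ((tensorComplex M).map θ) j)) :
      ∀ M : ModuleCat.{u} A, IsExactMulPair M x y →
        IsIso (homologyMap ((tensorComplex M).map θ) i) := by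
    have hepi (M : ModuleCat.{u} A) (hM : IsExactMulPair M x y) :
        Epi (homologyMap ((tensorComplex M).map θ) i) := by
      obtain ⟨K, F, f, g, w, hF, hF', hK, hS⟩ := exists_free_shortExact hxy hA M hM
      have := quasiIso_tensorComplex_map_of_flat F θ
      refine HomologySequence.epi_homologyMap_τ₃ (tensorShortComplexMap (.mk f g w) θ)
        (tensorShortComplex_shortExact hX hS hK hF' hM)
        (tensorShortComplex_shortExact hY hS hK hF' hM) i ?_ ?_ ?_
      · exact inferInstanceAs (Epi (homologyMap ((tensorComplex F).map θ) i))
      · intro j hj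
        have := h j hj K hK
        exact inferInstanceAs (Epi (homologyMap ((tensorComplex K).map θ) j))
      · intro j hj
        exact inferInstanceAs (Mono (homologyMap ((tensorComplex F).map θ) j))
    intro M hM
    obtain ⟨K, F, f, g, w, hF, hF', hK, hS⟩ := exists_free_shortExact hxy hA M hM
    have := quasiIso_tensorComplex_map_of_flat F θ
    refine HomologySequence.isIso_homologyMap_τ₃ (tensorShortComplexMap (.mk f g w) θ)
      (tensorShortComplex_shortExact hX hS hK hF' hM)
      (tensorShortComplex_shortExact hY hS hK hF' hM) i ?_ ?_ ?_ ?_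
    · exact hepi K hK
    · exact inferInstanceAs (IsIso (homologyMap ((tensorComplex F).map θ) i))
    · intro j hj
      exact h j hj K hK
    · intro j hj
      exact inferInstanceAs (Mono (homologyMap ((tensorComplex F).map θ) j))
  intro i
  induction i with
  | zero => exact key 0 fun j hj ↦ by simp at hj
  | succ i ih =>
    refine key (i + 1) fun j hj ↦ ?_
    obtain rfl : j = i := by simpa using hj
    exact ih

lemma isTensorExact_of_flat (x y : A) (Z : ModuleCat.{u} A) [Module.Flat A Z] :
    IsTensorExact x y Z := fun S hS _ _ _ ↦ by
  have : PreservesFiniteLimits ((tensoringLeft (ModuleCat.{u} A)).flip.obj Z) :=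
    inferInstanceAs (PreservesFiniteLimits (tensorRight Z))
  have : PreservesFiniteColimits ((tensoringLeft (ModuleCat.{u} A)).flip.obj Z) :=
    inferInstanceAs (PreservesFiniteColimits (tensorRight Z))
  have : ((tensoringLeft (ModuleCat.{u} A)).flip.obj Z).Additive :=
    inferInstanceAs ((tensorRight Z).Additive)
  exact hS.map_of_exact _

/-- Restriction of scalars, as a semilinear map. -/
def restrictScalarsOut (σ : A →+* B) (Z : ModuleCat.{u} B) : (restrictScalars σ).obj Z →ₛₗ[σ] Z where
  toFun z := z
  map_add' _ _ := rfl
  map_smul' _ _ := rfl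

section

variable (hσ : Function.Surjective σ) (hx : σ x = 0) {M : ModuleCat.{u} A} {M' : ModuleCat.{u} B}
  (f : M →ₛₗ[σ] M') (hf : Function.Surjective f) (hf₀ : ∀ m, f m = 0 → ∃ m', m = x • m')

/-- Compatibility of the tensor product with restriction of scalars. -/
noncomputable def tensorRestrictScalarsIso (Z : ModuleCat.{u} B) :
    ((tensoringLeft (ModuleCat.{u} A)).obj M).obj ((restrictScalars σ).obj Z) ≅
      (restrictScalars σ).obj (((tensoringLeft (ModuleCat.{u} B)).obj M').obj Z) :=
  moduleIsoOfAddEquiv (X := M ⊗ (restrictScalars σ).obj Z) (Y := (restrictScalars σ).obj (M' ⊗ Z))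
    (AddEquiv.ofBijective (tensorMapOfSemilinear f (restrictScalarsOut σ Z))
      (tensorMapOfSemilinear_bijective hσ hx f hf hf₀ _ Function.bijective_id))
    (tensorMapOfSemilinear_smul _ _)

/-- Compatibility of the tensor product with restriction of scalars, for functors. -/
noncomputable def tensorRestrictScalarsNatIso :
    restrictScalars σ ⋙ (tensoringLeft (ModuleCat.{u} A)).obj M ≅
      (tensoringLeft (ModuleCat.{u} B)).obj M' ⋙ restrictScalars σ :=
  NatIso.ofComponents (tensorRestrictScalarsIso hσ hx f hf hf₀) fun {Z Z'} g ↦ by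
    ext t
    induction t using TensorProduct.induction_on with
    | zero => exact (map_zero _).trans (map_zero _).symm
    | tmul m z => rfl
    | add s t hs ht => rw [map_add, map_add, hs, ht]

end

/-- Tensoring with the restriction of scalars of a module. -/
noncomputable def tensorRestrictScalarsExtendScalarsNatIso (hσ : Function.Surjective σ)
    (hker : RingHom.ker σ = Ideal.span {x}) (Z : ModuleCat.{u} B) :
    extendScalars.{u, u, u} σ ⋙ (tensoringLeft (ModuleCat.{u} B)).flip.obj Z ⋙ restrictScalars σ ≅
      (tensoringLeft (ModuleCat.{u} A)).flip.obj ((restrictScalars σ).obj Z) :=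
  NatIso.ofComponents (fun M ↦ (tensorRestrictScalarsIso hσ
    (hker.ge (Ideal.mem_span_singleton_self x)) (extendScalarsMk σ M)
    (extendScalarsMk_surjective hσ M)
    (fun m ↦ (extendScalarsMk_eq_zero_iff hσ hker M m).1) Z).symm) fun {M M'} g ↦ by
    rw [Iso.symm_hom, Iso.symm_hom, Iso.comp_inv_eq, Category.assoc, Iso.eq_inv_comp]
    ext t
    induction t using TensorProduct.induction_on with
    | zero => exact (map_zero _).trans (map_zero _).symm
    | tmul m z => rfl
    | add s t hs ht => rw [map_add, map_add, hs, ht]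

lemma isTensorExact_restrictScalars (hxy : x * y = 0) (hσ : Function.Surjective σ)
    (hker : RingHom.ker σ = Ideal.span {x}) (Z : ModuleCat.{u} B) [Module.Flat B Z] :
    IsTensorExact x y ((restrictScalars σ).obj Z) := fun S hS _ _ h₃ ↦ by
  have : (extendScalars.{u, u, u} σ).Additive := (extendRestrictScalarsAdj σ).left_adjoint_additive
  have : PreservesFiniteLimits ((tensoringLeft (ModuleCat.{u} B)).flip.obj Z) :=
    inferInstanceAs (PreservesFiniteLimits (tensorRight Z))
  have : PreservesFiniteColimits ((tensoringLeft (ModuleCat.{u} B)).flip.obj Z) :=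
    inferInstanceAs (PreservesFiniteColimits (tensorRight Z))
  have : ((tensoringLeft (ModuleCat.{u} B)).flip.obj Z).Additive :=
    inferInstanceAs ((tensorRight Z).Additive)
  have : ((tensoringLeft (ModuleCat.{u} A)).flip.obj ((restrictScalars σ).obj Z)).Additive :=
    inferInstanceAs ((tensorRight ((restrictScalars σ).obj Z)).Additive)
  have h := ((extendScalars_map_shortExact hxy hσ hker hS h₃).map_of_exact
    ((tensoringLeft (ModuleCat.{u} B)).flip.obj Z)).map_of_exact (restrictScalars σ)
  exact ShortComplex.shortExact_of_iso
    (S.mapNatIso (tensorRestrictScalarsExtendScalarsNatIso hσ hker Z)) h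

variable {M : Type u} [AddCommGroup M] [Module A M] {M' : Type u} [AddCommGroup M'] [Module B M']
  {N : Type u} [AddCommGroup N] [Module A N] [Module B N]

theorem nonempty_tor_addEquiv_tor (hxy : x * y = 0) (hσ : Function.Surjective σ)
    (hker : RingHom.ker σ = Ideal.span {x}) (hA : IsExactMulPair A x y)
    (hM : IsExactMulPair M x y) (f : M →ₛₗ[σ] M')
    (hf : Function.Surjective f) (hf₀ : ∀ m, f m = 0 ↔ ∃ m', m = x • m')
    (hN : ∀ (a : A) (z : N), a • z = σ a • z) (n : ℕ) :
    Nonempty (((Tor (ModuleCat.{u} A) n).obj (of A M)).obj (of A N) ≃+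
      ((Tor (ModuleCat.{u} B) n).obj (of B M')).obj (of B N)) := by
  let Q := projectiveResolution (of B N)
  let P := projectiveResolution ((restrictScalars σ).obj (of B N))
  obtain ⟨θ, hθ⟩ := ProjectiveResolution.exists_quasiIso_map (restrictScalars σ) Q P
  have (i : ℕ) : Module.Flat B (Q.complex.X i) := by
    have : Module.Projective B (Q.complex.X i) :=
      (IsProjective.iff_projective (Q.complex.X i)).2 (Q.projective i)
    infer_instance
  have (i : ℕ) : Module.Flat A (P.complex.X i) := by
    have : Module.Projective A (P.complex.X i) :=
      (IsProjective.iff_projective (P.complex.X i)).2 (P.projective i)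
    infer_instance
  have hT := quasiIso_tensorComplex_map hxy hA θ (fun i ↦ isTensorExact_of_flat x y _)
    (fun i ↦ isTensorExact_restrictScalars hxy hσ hker (Q.complex.X i)) (of A M) hM
  let e₁ : ((Tor (ModuleCat.{u} A) n).obj (of A M)).obj (of A N) ≅
      ((Tor (ModuleCat.{u} A) n).obj (of A M)).obj ((restrictScalars σ).obj (of B N)) :=
    ((Tor (ModuleCat.{u} A) n).obj (of A M)).mapIso (restrictScalarsIsoOf N hN)
  let e₂ : ((Tor (ModuleCat.{u} A) n).obj (of A M)).obj ((restrictScalars σ).obj (of B N)) ≅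
      ((tensorComplex (of A M)).obj P.complex).homology n :=
    P.isoLeftDerivedObj ((tensoringLeft (ModuleCat.{u} A)).obj (of A M)) n
  let e₃ := isoOfQuasiIsoAt ((tensorComplex (of A M)).map θ) n
  let e₄ := (HomologicalComplex.homologyFunctor _ (ComplexShape.down ℕ) n).mapIso
    ((NatIso.mapHomologicalComplex (tensorRestrictScalarsNatIso hσ
      (hker.ge (Ideal.mem_span_singleton_self x)) (M := of A M) (M' := of B M') f hf
      (fun m ↦ (hf₀ m).1)) _).app Q.complex)
  let e₅ := (((tensorComplex (of B M')).obj Q.complex).sc n).mapHomologyIso (restrictScalars σ)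
  let e₆ : ((Tor (ModuleCat.{u} B) n).obj (of B M')).obj (of B N) ≅
      ((tensorComplex (of B M')).obj Q.complex).homology n :=
    Q.isoLeftDerivedObj ((tensoringLeft (ModuleCat.{u} B)).obj (of B M')) n
  exact ⟨(e₁ ≪≫ e₂ ≪≫ e₃ ≪≫ e₄ ≪≫ e₅).toLinearEquiv.toAddEquiv.trans
    e₆.toLinearEquiv.toAddEquiv.symm⟩

end TorOneStep

/-- The natural isomorphisms `Ext_A(N, M) ≅ Ext_B(N, M')`, `Ext_A(M, N) ≅ Ext_B(M', N)` and
`Tor^A(M, N) ≅ Tor^B(M', N)` exist, as isomorphisms of abelian groups. -/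
def HasChangeOfRingsIso (A B M M' N : Type u) [CommRing A] [CommRing B] [AddCommGroup M]
    [AddCommGroup M'] [AddCommGroup N] [Module A M] [Module B M'] [Module A N] [Module B N] :
    Prop :=
  ∀ i : ℕ,
    Nonempty (extRMod A (ModuleCat.of A N) (ModuleCat.of A M) i ≃+
      extRMod B (ModuleCat.of B N) (ModuleCat.of B M') i) ∧
    Nonempty (extRMod A (ModuleCat.of A M) (ModuleCat.of A N) i ≃+
      extRMod B (ModuleCat.of B M') (ModuleCat.of B N) i) ∧
    Nonempty (torRMod A (ModuleCat.of A M) (ModuleCat.of A N) i ≃+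
      torRMod B (ModuleCat.of B M') (ModuleCat.of B N) i)

namespace HasChangeOfRingsIso

lemma trans {A B C M M' M'' N : Type u} [CommRing A] [CommRing B] [CommRing C] [AddCommGroup M]
    [AddCommGroup M'] [AddCommGroup M''] [AddCommGroup N] [Module A M] [Module B M'] [Module C M'']
    [Module A N] [Module B N] [Module C N] (h : HasChangeOfRingsIso A B M M' N)
    (h' : HasChangeOfRingsIso B C M' M'' N) : HasChangeOfRingsIso A C M M'' N := fun i ↦
  ⟨(h i).1.map2 AddEquiv.trans (h' i).1, (h i).2.1.map2 AddEquiv.trans (h' i).2.1,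
    (h i).2.2.map2 AddEquiv.trans (h' i).2.2⟩

lemma of_isExactMulPair {A B M M' N : Type u} [CommRing A] [CommRing B] [AddCommGroup M]
    [AddCommGroup M'] [AddCommGroup N] [Module A M] [Module B M'] [Module A N] [Module B N]
    {σ : A →+* B} {x y : A} (hxy : x * y = 0) (hσ : Function.Surjective σ)
    (hker : RingHom.ker σ = Ideal.span {x}) (hA : IsExactMulPair A x y)
    (hM : IsExactMulPair M x y) (f : M →ₛₗ[σ] M') (hf : Function.Surjective f)
    (hf₀ : ∀ m, f m = 0 ↔ ∃ m', m = x • m') (hN : ∀ (a : A) (z : N), a • z = σ a • z) :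
    HasChangeOfRingsIso A B M M' N := fun i ↦
  ⟨nonempty_ext_addEquiv_ext_right hxy hσ hker hA hM f hf hf₀ hN i,
    nonempty_ext_addEquiv_ext_left hxy hσ hker hA hM f hf hf₀ hN i,
    nonempty_tor_addEquiv_tor hxy hσ hker hA hM f hf hf₀ hN i⟩

end HasChangeOfRingsIso

namespace IsEZDPair

variable {R : Type*} [CommRing R] {X : Type*} [AddCommGroup X] [Module R X] {x y : R}

lemma isExactMulPair (h : IsEZDPair R X x y) (I : Ideal R) [Module (R ⧸ I) X]
    [IsScalarTower R (R ⧸ I) X] :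
    IsExactMulPair X (Ideal.Quotient.mk I x) (Ideal.Quotient.mk I y) := by
  have hmk (r : R) (m : X) : Ideal.Quotient.mk I r • m = r • m :=
    IsScalarTower.algebraMap_smul (R ⧸ I) r m
  refine ⟨fun m hm ↦ ?_, fun m hm ↦ ?_⟩
  · have : m ∈ Submodule.torsionBy R X x := by rwa [hmk] at hm
    rw [h.2.2.1, Submodule.ideal_span_singleton_smul,
      Submodule.mem_smul_pointwise_iff_exists] at this
    obtain ⟨m', -, rfl⟩ := this
    exact ⟨m', (hmk y m').symm⟩
  · have : m ∈ Submodule.torsionBy R X y := by rwa [hmk] at hm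
    rw [h.2.2.2, Submodule.ideal_span_singleton_smul,
      Submodule.mem_smul_pointwise_iff_exists] at this
    obtain ⟨m', -, rfl⟩ := this
    exact ⟨m', (hmk x m').symm⟩

lemma smul_smul_eq_zero (h : IsEZDPair R X x y) (m : X) : y • x • m = 0 := by
  have : x • m ∈ Submodule.torsionBy R X y := by
    rw [h.2.2.2]
    exact Submodule.smul_mem_smul (Ideal.mem_span_singleton_self x) trivial
  exact this

end IsEZDPair

/-- The canonical map `M ⧸ I M → M ⧸ J M` for ideals `I ≤ J`. -/
def quotientSMulTopFactor {R : Type*} [CommRing R] (M : Type*) [AddCommGroup M] [Module R M]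
    {I J : Ideal R} (h : I ≤ J) :
    (M ⧸ (I • ⊤ : Submodule R M)) →ₛₗ[Ideal.Quotient.factor h] M ⧸ (J • ⊤ : Submodule R M) where
  toFun := Submodule.factor (Submodule.smul_mono_left h)
  map_add' := map_add _
  map_smul' a m := by
    obtain ⟨a, rfl⟩ := Ideal.Quotient.mk_surjective a
    obtain ⟨m, rfl⟩ := Submodule.Quotient.mk_surjective _ m
    rfl

/-- The canonical map `M → M ⧸ I M`. -/
def quotientSMulTopMk {R : Type*} [CommRing R] (M : Type*) [AddCommGroup M] [Module R M]
    (I : Ideal R) : M →ₛₗ[Ideal.Quotient.mk I] M ⧸ (I • ⊤ : Submodule R M) where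
  toFun := Submodule.Quotient.mk
  map_add' _ _ := rfl
  map_smul' _ _ := rfl

section

variable {R : Type u} [CommRing R] {M N : Type u} [AddCommGroup M] [Module R M] [AddCommGroup N]

lemma hasChangeOfRingsIso_quotient_bot [Module R N] [Module (R ⧸ (⊥ : Ideal R)) N]
    [IsScalarTower R (R ⧸ (⊥ : Ideal R)) N] :
    HasChangeOfRingsIso R (R ⧸ (⊥ : Ideal R)) M (M ⧸ ((⊥ : Ideal R) • ⊤ : Submodule R M)) N := by
  have h {X : Type u} [AddCommGroup X] [Module R X] : IsExactMulPair X (0 : R) 1 :=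
    ⟨fun m _ ↦ ⟨m, (one_smul R m).symm⟩, fun m hm ↦ ⟨0, by simpa using hm⟩⟩
  refine .of_isExactMulPair (zero_mul 1) Ideal.Quotient.mk_surjective
    (by rw [Ideal.mk_ker, Ideal.span_singleton_eq_bot.2 rfl]) h h (quotientSMulTopMk M ⊥)
    (Submodule.Quotient.mk_surjective _) (fun m ↦ ?_)
    fun a z ↦ (IsScalarTower.algebraMap_smul (R ⧸ (⊥ : Ideal R)) a z).symm
  refine (Submodule.Quotient.mk_eq_zero _).trans ?_
  simp

lemma hasChangeOfRingsIso_quotient_sup {I J : Ideal R} {x y : R} (hJ : J = I ⊔ Ideal.span {x})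
    (hR : IsEZDPair R (R ⧸ (I • ⊤ : Submodule R R)) x y)
    (hM : IsEZDPair R (M ⧸ (I • ⊤ : Submodule R M)) x y) (h : I ≤ J) [Module (R ⧸ I) N]
    [Module (R ⧸ J) N] (hN : ∀ (a : R ⧸ I) (z : N), a • z = Ideal.Quotient.factor h a • z) :
    HasChangeOfRingsIso (R ⧸ I) (R ⧸ J) (M ⧸ (I • ⊤ : Submodule R M))
      (M ⧸ (J • ⊤ : Submodule R M)) N := by
  have hR' : IsEZDPair R (R ⧸ I) x y := by
    have (K : Ideal R) (hK : K = I) (hR : IsEZDPair R (R ⧸ K) x y) : IsEZDPair R (R ⧸ I) x y :=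
      hK ▸ hR
    exact this _ (Ideal.mul_top I) hR
  have hxy : Ideal.Quotient.mk I x * Ideal.Quotient.mk I y = 0 := by
    have := hR'.smul_smul_eq_zero (Ideal.Quotient.mk I 1)
    rw [mul_comm]
    simpa [Algebra.smul_def] using this
  have hker : RingHom.ker (Ideal.Quotient.factor h) = Ideal.span {Ideal.Quotient.mk I x} := by
    rw [Ideal.Quotient.factor_ker, hJ, Ideal.map_sup, Ideal.map_quotient_self, bot_sup_eq,
      Ideal.map_span, Set.image_singleton]
  have hf₀ (m : M ⧸ (I • ⊤ : Submodule R M)) : quotientSMulTopFactor M h m = 0 ↔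
      ∃ m', m = Ideal.Quotient.mk I x • m' := by
    obtain ⟨m, rfl⟩ := Submodule.Quotient.mk_surjective _ m
    refine (Submodule.Quotient.mk_eq_zero _).trans ?_
    rw [hJ, Submodule.sup_smul, Submodule.ideal_span_singleton_smul, Submodule.mem_sup]
    constructor
    · rintro ⟨m₁, hm₁, m₂, hm₂, rfl⟩
      obtain ⟨m', -, rfl⟩ := (Submodule.mem_smul_pointwise_iff_exists _ _ _).1 hm₂
      refine ⟨Submodule.Quotient.mk m', ?_⟩
      change Submodule.Quotient.mk _ = Submodule.Quotient.mk (x • m')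
      rw [Submodule.Quotient.eq]
      simpa using hm₁
    · rintro ⟨m', hm'⟩
      obtain ⟨m', rfl⟩ := Submodule.Quotient.mk_surjective _ m'
      refine ⟨m - x • m', (Submodule.Quotient.eq _).1 hm', x • m',
        Submodule.smul_mem_pointwise_smul _ _ _ trivial, sub_add_cancel _ _⟩
  have hA : IsExactMulPair (R ⧸ I) (Ideal.Quotient.mk I x) (Ideal.Quotient.mk I y) :=
    hR'.isExactMulPair I
  have hM' : IsExactMulPair (M ⧸ (I • ⊤ : Submodule R M)) (Ideal.Quotient.mk I x)
      (Ideal.Quotient.mk I y) := hM.isExactMulPair I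
  have hf : Function.Surjective (quotientSMulTopFactor M h) :=
    Submodule.factor_surjective (Submodule.smul_mono_left h)
  exact .of_isExactMulPair hxy (Ideal.Quotient.factor_surjective h) hker hA hM'
    (quotientSMulTopFactor M h) hf hf₀ hN

theorem hasChangeOfRingsIso_of_isEZDSeqWithTwins [Module R N] {n : ℕ} {x y : Fin n → R}
    (hR : IsEZDSeqWithTwins R R x y) (hM : IsEZDSeqWithTwins R M x y) (k : ℕ) (hk : k ≤ n)
    (I : Ideal R) (hI : I = Ideal.span (x '' {j | (j : ℕ) < k})) [Module (R ⧸ I) N]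
    [IsScalarTower R (R ⧸ I) N] :
    HasChangeOfRingsIso R (R ⧸ I) M (M ⧸ (I • ⊤ : Submodule R M)) N := by
  induction k generalizing I with
  | zero =>
    obtain rfl : I = ⊥ := by simpa using hI
    exact hasChangeOfRingsIso_quotient_bot
  | succ k ih =>
    let K := Ideal.span (x '' {j | (j : ℕ) < k})
    have hIK : I = K ⊔ Ideal.span {x ⟨k, hk⟩} := by
      rw [hI, ← Ideal.span_union]
      congr 1
      rw [← Set.image_singleton, ← Set.image_union]
      congr 1
      ext j
      simp only [Set.mem_ofPred_eq, Set.mem_union, Set.mem_singleton_iff, Fin.ext_iff]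
      lia
    have h : K ≤ I := hIK ▸ le_sup_left
    let _ := Module.compHom N (Ideal.Quotient.factor h)
    have : IsScalarTower R (R ⧸ K) N := ⟨fun r a z ↦ by
      change Ideal.Quotient.factor h (r • a) • z = r • Ideal.Quotient.factor h a • z
      rw [← smul_assoc]
      exact congrArg (· • z) (map_smul (Ideal.Quotient.factorₐ R h) r a)⟩
    exact (ih (Nat.le_of_succ_le hk) K rfl).trans
      (hasChangeOfRingsIso_quotient_sup hIK (hR ⟨k, hk⟩) (hM ⟨k, hk⟩) h fun _ _ ↦ rfl)

end

end ChangeOfRings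

/-- Let `x 0, …, x (n-1)` be a sequence of exact zero-divisors on both `R` and `M`
with the same twins `y 0, …, y (n-1)`; set `R̄ = R/(x 0, …, x (n-1))`,
`M̄ = M/(x 0, …, x (n-1))M`, and let `N` be an `R̄`-module.  Then for all `i ≥ 0`:
(i) `Ext^i_R(N, M) ≅ Ext^i_R̄(N, M̄)`;
(ii) `Ext^i_R(M, N) ≅ Ext^i_R̄(M̄, N)`;
(iii) `Tor^R_i(M, N) ≅ Tor^R̄_i(M̄, N)`. -/
theorem ext_tor_change_of_rings_of_isEZDSeq
    (R : Type u) [CommRing R] [IsNoetherianRing R]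
    (M : Type u) [AddCommGroup M] [Module R M]
    {n : ℕ} (x y : Fin n → R)
    (hR : IsEZDSeqWithTwins R R x y) (hM : IsEZDSeqWithTwins R M x y)
    (N : Type u) [AddCommGroup N]
    [Module (R ⧸ Ideal.span (Set.range x)) N] [Module R N]
    [IsScalarTower R (R ⧸ Ideal.span (Set.range x)) N] :
    ∀ i : ℕ,
      Nonempty ((extRMod R (ModuleCat.of R N) (ModuleCat.of R M) i) ≃+
        (extRMod (R ⧸ Ideal.span (Set.range x))
          (ModuleCat.of _ N)
          (ModuleCat.of _ (M ⧸ (Ideal.span (Set.range x) • (⊤ : Submodule R M)))) i)) ∧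
      Nonempty ((extRMod R (ModuleCat.of R M) (ModuleCat.of R N) i) ≃+
        (extRMod (R ⧸ Ideal.span (Set.range x))
          (ModuleCat.of _ (M ⧸ (Ideal.span (Set.range x) • (⊤ : Submodule R M))))
          (ModuleCat.of _ N) i)) ∧
      Nonempty ((torRMod R (ModuleCat.of R M) (ModuleCat.of R N) i) ≃+
        (torRMod (R ⧸ Ideal.span (Set.range x))
          (ModuleCat.of _ (M ⧸ (Ideal.span (Set.range x) • (⊤ : Submodule R M))))
          (ModuleCat.of _ N) i)) := by
  refine hasChangeOfRingsIso_of_isEZDSeqWithTwins hR hM n le_rfl _ ?_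
  simp
end
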